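/- arXiv:1304.1202 — 4 statements merged into one kernel-verified Lean document; each statement's English description precedes it below -/
import Mathlib

section
/- Let q be a prime power, H the Hermitian curve, and Φ_H the group of maps σ_{a,b,c} acting on H. Then Φ_H is (α,ε)-close to 2-steps uniform on H with α = ε = 1/q: for every u, v ∈ H there is a subset H' ⊆ H with |H'| ≥ (1 − 1/q)|H| such that for every p ∈ H', if one draws σ_1 uniformly from {σ ∈ Φ_H : σ(u) = v}, then w uniformly from H, then σ_2 uniformly from {σ ∈ Φ_H : σ(w) = σ_1(w)}, the distribution of σ_2(p) is within statistical distance 1/q of the uniform distribution on H. -/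
open scoped Classical

/-- The Hermitian curve `H = {(x,y) ∈ F² : x^(q+1) = y + y^q}` (here `F` is the field
with `q²` elements; `x^(q+1)` is the norm and `y + y^q` the trace down to `F_q`). -/
def Hset (F : Type*) [Field F] (q : ℕ) : Set (F × F) :=
  {p | p.1 ^ (q + 1) = p.2 + p.2 ^ q}

/-- The map `σ_{a,b,c} : (x,y) ↦ (a·x + b, a^(q+1)·y + a·b^q·x + c)`. -/
def sigmaMap {F : Type*} [Field F] (q : ℕ) (a b c : F) : F × F → F × F :=
  fun p => (a * p.1 + b, a ^ (q + 1) * p.2 + a * b ^ q * p.1 + c)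

/-- The collection `Φ_H = {σ_{a,b,c} : a ≠ 0, (b,c) ∈ H}` of automorphisms of the
Hermitian curve. -/
def PhiH (F : Type*) [Field F] (q : ℕ) : Set (F × F → F × F) :=
  {σ | ∃ a b c : F, a ≠ 0 ∧ (b, c) ∈ Hset F q ∧ σ = sigmaMap q a b c}

/-- The Hermitian curve as a finite set of points. -/
noncomputable def HFin (F : Type*) [Field F] [Fintype F] (q : ℕ) : Finset (F × F) :=
  Finset.univ.filter fun p => p ∈ Hset F q

/-- The automorphisms `σ_{a,b,c}` of the Hermitian curve, as a finite set of maps. -/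
noncomputable def PhiFin (F : Type*) [Field F] [Fintype F] (q : ℕ) :
    Finset (F × F → F × F) :=
  Finset.univ.filter fun σ => σ ∈ PhiH F q

/-- The automorphisms in `Φ_H` mapping `u` to `v`. -/
noncomputable def PhiStab (F : Type*) [Field F] [Fintype F] (q : ℕ) (u v : F × F) :
    Finset (F × F → F × F) :=
  (PhiFin F q).filter fun σ => σ u = v

/-- The average of `F` over the finite set `s`. -/
noncomputable def avg {β : Type*} (s : Finset β) (F : β → ℝ) : ℝ :=
  (∑ b ∈ s, F b) / (s.card : ℝ)

section Helpers

variable {F : Type*} [Field F] [Fintype F]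

theorem hx_card_roots (q : ℕ) (hq2 : 2 ≤ q) (α β γ : F) (hα : α ≠ 0) :
    (Finset.univ.filter fun s : F => α * s ^ q + β * s + γ = 0).card ≤ q := by
  set P : Polynomial F := Polynomial.C α * Polynomial.X ^ q +
    (Polynomial.C β * Polynomial.X + Polynomial.C γ) with hP
  have hdeg1 : (Polynomial.C β * Polynomial.X + Polynomial.C γ).degree < (q : WithBot ℕ) := by
    refine lt_of_le_of_lt Polynomial.degree_linear_le ?_
    exact_mod_cast hq2
  have hdeg : P.degree = q := by
    rw [hP, Polynomial.degree_add_eq_left_of_degree_lt]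
    · exact Polynomial.degree_C_mul_X_pow q hα
    · rw [Polynomial.degree_C_mul_X_pow q hα]; exact hdeg1
  have hP0 : P ≠ 0 := by
    intro h; rw [h] at hdeg; simp at hdeg
  have hn : P.natDegree = q := Polynomial.natDegree_eq_of_degree_eq_some hdeg
  calc _ ≤ P.roots.toFinset.card := by
        apply Finset.card_le_card
        intro s hs
        simp only [Finset.mem_filter, Finset.mem_univ, true_and] at hs
        rw [Multiset.mem_toFinset, Polynomial.mem_roots hP0]
        simp [hP, Polynomial.IsRoot, ← add_assoc, hs]
    _ ≤ P.roots.card := Multiset.toFinset_card_le _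
    _ ≤ P.natDegree := Polynomial.card_roots' P
    _ = q := hn

theorem hx_frob (q : ℕ) (hq : ∃ p n : ℕ, p.Prime ∧ 0 < n ∧ q = p ^ n)
    (hcard : Fintype.card F = q ^ 2) (x y : F) : (x + y) ^ q = x ^ q + y ^ q := by
  obtain ⟨p, n, hp, hn, rfl⟩ := hq
  obtain ⟨p', hc⟩ := CharP.exists F
  obtain ⟨m, hp', hm⟩ := FiniteField.card F p'
  have hpp : p' = p := by
    have h1 : p' ∣ (p ^ n) ^ 2 := by
      rw [← hcard, hm]; exact dvd_pow_self _ m.pos.ne'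
    exact (Nat.prime_dvd_prime_iff_eq hp' hp).1
      (hp'.dvd_of_dvd_pow (hp'.dvd_of_dvd_pow h1))
  subst hpp
  have : Fact p'.Prime := ⟨hp⟩
  exact add_pow_char_pow x y p' n

theorem hx_frob2 (q : ℕ) (hcard : Fintype.card F = q ^ 2) (x : F) : (x ^ q) ^ q = x := by
  rw [← pow_mul, ← sq, ← hcard, FiniteField.pow_card]

theorem hx_fsub (q : ℕ) (h1 : ∀ x y : F, (x + y) ^ q = x ^ q + y ^ q) (x y : F) :
    (x - y) ^ q = x ^ q - y ^ q := by
  have := h1 (x - y) y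
  rw [sub_add_cancel] at this
  rw [this]; ring

theorem hx_fiber (q : ℕ) (hq2 : 2 ≤ q) (hcard : Fintype.card F = q ^ 2)
    (h1 : ∀ x y : F, (x + y) ^ q = x ^ q + y ^ q) (h2 : ∀ x : F, (x ^ q) ^ q = x)
    (t : F) (ht : t ^ q = t) :
    (Finset.univ.filter fun y : F => t = y + y ^ q).card = q := by
  have hle : ∀ t : F, (Finset.univ.filter fun y : F => t = y + y ^ q).card ≤ q := by
    intro t
    refine le_trans (Finset.card_le_card ?_) (hx_card_roots q hq2 (1 : F) 1 (-t) one_ne_zero)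
    intro y hy
    simp only [Finset.mem_filter, Finset.mem_univ, true_and] at hy ⊢
    rw [hy]; ring
  have hfix : (Finset.univ.filter fun y : F => y ^ q = y).card ≤ q := by
    refine le_trans (Finset.card_le_card ?_) (hx_card_roots q hq2 (1 : F) (-1) 0 one_ne_zero)
    intro y hy
    simp only [Finset.mem_filter, Finset.mem_univ, true_and] at hy ⊢
    rw [hy]; ring
  have hsum : q ^ 2 = ∑ t ∈ (Finset.univ.filter fun y : F => y ^ q = y),
      (Finset.univ.filter fun y : F => t = y + y ^ q).card := by
    rw [← hcard, ← Finset.card_univ]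
    rw [Finset.card_eq_sum_card_fiberwise (f := fun y : F => y + y ^ q)
      (t := Finset.univ.filter fun y : F => y ^ q = y)]
    · refine Finset.sum_congr rfl fun t _ => ?_
      congr 1
      ext y
      simp [eq_comm]
    · intro y _
      simp [h1, h2, add_comm]
  by_contra hne
  have hlt := lt_of_le_of_ne (hle t) hne
  have : ∑ t ∈ (Finset.univ.filter fun y : F => y ^ q = y),
      (Finset.univ.filter fun y : F => t = y + y ^ q).card <
      ∑ t ∈ (Finset.univ.filter fun y : F => y ^ q = y), q :=
    Finset.sum_lt_sum (fun i _ => hle i) ⟨t, by simpa using ht, hlt⟩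
  rw [← hsum, Finset.sum_const, smul_eq_mul] at this
  nlinarith

theorem hx_fiberN (q : ℕ) (hq2 : 2 ≤ q) (hcard : Fintype.card F = q ^ 2)
    (h1 : ∀ x y : F, (x + y) ^ q = x ^ q + y ^ q) (h2 : ∀ x : F, (x ^ q) ^ q = x)
    (x : F) :
    (Finset.univ.filter fun y : F => x ^ (q + 1) = y + y ^ q).card = q := by
  apply hx_fiber q hq2 hcard h1 h2
  rw [pow_succ, mul_pow, h2, mul_comm]

theorem hx_cardH (q : ℕ) (hq2 : 2 ≤ q) (hcard : Fintype.card F = q ^ 2)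
    (h1 : ∀ x y : F, (x + y) ^ q = x ^ q + y ^ q) (h2 : ∀ x : F, (x ^ q) ^ q = x) :
    (HFin F q).card = q ^ 3 := by
  unfold HFin Hset
  rw [Finset.card_filter, Fintype.sum_prod_type]
  have : ∀ x : F, (∑ y : F, if (x, y) ∈ {p : F × F | p.1 ^ (q + 1) = p.2 + p.2 ^ q}
      then 1 else 0) = q := by
    intro x
    rw [← Finset.card_filter]
    exact hx_fiberN q hq2 hcard h1 h2 x
  rw [Finset.sum_congr rfl fun x _ => this x]
  simp [hcard]
  ring

theorem hx_pres (q : ℕ) (h1 : ∀ x y : F, (x + y) ^ q = x ^ q + y ^ q)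
    (h2 : ∀ x : F, (x ^ q) ^ q = x) (a b c : F) (hbc : (b, c) ∈ Hset F q)
    (z : F × F) (hz : z ∈ Hset F q) : sigmaMap q a b c z ∈ Hset F q := by
  simp only [Hset, Set.mem_ofPred_eq, sigmaMap, pow_succ, h1, mul_pow, h2] at *
  linear_combination hbc + a ^ q * a * hz

theorem hx_comp (q : ℕ) (h1 : ∀ x y : F, (x + y) ^ q = x ^ q + y ^ q)
    (a b c a' b' c' : F) (z : F × F) :
    sigmaMap q a b c (sigmaMap q a' b' c' z) =
      sigmaMap q (a * a') (sigmaMap q a b c (b', c')).1 (sigmaMap q a b c (b', c')).2 z := by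
  simp only [sigmaMap, pow_succ, h1, mul_pow, Prod.mk.injEq]
  constructor <;> ring

/-- The unique map with given `a` sending `w` to `w'`. -/
def hxMap (q : ℕ) (w w' : F × F) (a : F) : F × F → F × F :=
  sigmaMap q a (w'.1 - a * w.1)
    (w'.2 - a ^ (q + 1) * w.2 - a * (w'.1 - a * w.1) ^ q * w.1)

theorem hx_bc (q : ℕ) (h1 : ∀ x y : F, (x + y) ^ q = x ^ q + y ^ q)
    (h2 : ∀ x : F, (x ^ q) ^ q = x) (a : F)
    (w w' : F × F) (hw : w ∈ Hset F q) (hw' : w' ∈ Hset F q) :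
    (w'.1 - a * w.1, w'.2 - a ^ (q + 1) * w.2 - a * (w'.1 - a * w.1) ^ q * w.1) ∈ Hset F q := by
  simp only [Hset, Set.mem_ofPred_eq, pow_succ, hx_fsub q h1, mul_pow, h2] at *
  linear_combination hw' - a ^ q * a * hw

theorem hxMap_mem (q : ℕ) (h1 : ∀ x y : F, (x + y) ^ q = x ^ q + y ^ q)
    (h2 : ∀ x : F, (x ^ q) ^ q = x) (a : F) (ha : a ≠ 0)
    (w w' : F × F) (hw : w ∈ Hset F q) (hw' : w' ∈ Hset F q) :
    hxMap q w w' a ∈ PhiStab F q w w' := by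
  simp only [PhiStab, PhiFin, Finset.mem_filter, Finset.mem_univ, true_and]
  refine ⟨⟨a, _, _, ha, hx_bc q h1 h2 a w w' hw hw', rfl⟩, ?_⟩
  ext <;> simp [hxMap, sigmaMap]

theorem hx_cardStab (q : ℕ) (hcard : Fintype.card F = q ^ 2)
    (h1 : ∀ x y : F, (x + y) ^ q = x ^ q + y ^ q)
    (h2 : ∀ x : F, (x ^ q) ^ q = x)
    (w w' : F × F) (hw : w ∈ Hset F q) (hw' : w' ∈ Hset F q) :
    (PhiStab F q w w').card = q ^ 2 - 1 := by
  have : PhiStab F q w w' = (Finset.univ.erase (0 : F)).image (hxMap q w w') := by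
    ext σ
    rw [Finset.mem_image]
    constructor
    · intro h
      simp only [PhiStab, PhiFin, Finset.mem_filter, Finset.mem_univ, true_and] at h
      obtain ⟨⟨a, b, c, ha, hbc, rfl⟩, h⟩ := h
      refine ⟨a, by simpa using ha, ?_⟩
      rw [← h]
      unfold hxMap
      congr 1
      · simp [sigmaMap]
      · simp [sigmaMap]
        ring
    · rintro ⟨a, ha, rfl⟩
      exact hxMap_mem q h1 h2 a (by simpa using ha) w w' hw hw'
  rw [this, Finset.card_image_of_injective, Finset.card_erase_of_mem (Finset.mem_univ _),
    Finset.card_univ, hcard]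
  intro a a' h
  have e1 := congrArg Prod.fst (congrFun h (w.1 + 1, 0))
  simp only [hxMap, sigmaMap] at e1
  linear_combination e1

/-- The condition that a map fixing `w` takes `p` to `z`. -/
def hxCond (q : ℕ) (p z w : F × F) : Prop :=
  w ∈ Hset F q ∧ w.1 ≠ p.1 ∧ w.1 ≠ z.1 ∧
    (z.2 + w.2 ^ q - w.1 ^ q * z.1) * ((p.1 - w.1) * (p.1 ^ q - w.1 ^ q)) =
    (p.2 + w.2 ^ q - w.1 ^ q * p.1) * ((z.1 - w.1) * (z.1 ^ q - w.1 ^ q))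

theorem hx_cond_exists (q : ℕ) (h1 : ∀ x y : F, (x + y) ^ q = x ^ q + y ^ q)
    (h2 : ∀ x : F, (x ^ q) ^ q = x) (σ : F × F → F × F) (hσ : σ ∈ PhiH F q)
    (p z w : F × F) (h : hxCond q p z w) :
    ∃ σ₂ ∈ PhiStab F q w (σ w), σ₂ p = σ z := by
  obtain ⟨hw, hwp, hwz, hc⟩ := h
  obtain ⟨a, b, c, ha, hbc, rfl⟩ := hσ
  have n0 : p.1 - w.1 ≠ 0 := sub_ne_zero.2 hwp.symm
  have n1 : z.1 - w.1 ≠ 0 := sub_ne_zero.2 hwz.symm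
  have n0q : p.1 ^ q - w.1 ^ q ≠ 0 := by
    rw [← hx_fsub q h1]; exact pow_ne_zero _ n0
  set e : F := (z.1 - w.1) / (p.1 - w.1) with he
  have he0 : e ≠ 0 := div_ne_zero n1 n0
  have eA : e * (p.1 - w.1) = z.1 - w.1 := div_mul_cancel₀ _ n0
  have eB : e ^ q * (p.1 ^ q - w.1 ^ q) = z.1 ^ q - w.1 ^ q := by
    rw [← hx_fsub q h1, ← hx_fsub q h1, ← mul_pow, eA]
  have hN : z.2 + w.2 ^ q - w.1 ^ q * z.1 = (p.2 + w.2 ^ q - w.1 ^ q * p.1) * (e * e ^ q) := by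
    apply mul_right_cancel₀ (mul_ne_zero n0 n0q)
    rw [hc, ← eA, ← eB]; ring
  have hbc' := hx_bc q h1 h2 e w w hw hw
  have hτp : hxMap q w w e p = z := by
    have hw' : w.1 ^ q * w.1 = w.2 + w.2 ^ q := by rw [← pow_succ]; exact hw
    ext
    · simp only [hxMap, sigmaMap]
      linear_combination eA
    · simp only [hxMap, sigmaMap, pow_succ, hx_fsub q h1, mul_pow]
      linear_combination (-1) * hN + w.1 ^ q * eA + (e * e ^ q - 1) * hw'
  have hτw : hxMap q w w e w = w := by
    ext <;> simp [hxMap, sigmaMap]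
  have hcomp := hx_comp q h1 a b c e (z := p)
    (b' := w.1 - e * w.1) (c' := w.2 - e ^ (q + 1) * w.2 - e * (w.1 - e * w.1) ^ q * w.1)
  have hcompw := hx_comp q h1 a b c e (z := w)
    (b' := w.1 - e * w.1) (c' := w.2 - e ^ (q + 1) * w.2 - e * (w.1 - e * w.1) ^ q * w.1)
  refine ⟨_, ?_, hcomp.symm.trans (congrArg _ hτp)⟩
  simp only [PhiStab, PhiFin, Finset.mem_filter, Finset.mem_univ, true_and]
  refine ⟨⟨_, _, _, mul_ne_zero ha he0, ?_, rfl⟩, hcompw.symm.trans (congrArg _ hτw)⟩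
  exact hx_pres q h1 h2 a b c hbc _ hbc'

theorem hx_count (q : ℕ) (hq2 : 2 ≤ q) (hcard : Fintype.card F = q ^ 2)
    (h1 : ∀ x y : F, (x + y) ^ q = x ^ q + y ^ q) (h2 : ∀ x : F, (x ^ q) ^ q = x)
    (p z : F × F) (hp : p ∈ Hset F q) (hz : z ∈ Hset F q) (hpz : p.1 ≠ z.1) :
    q ^ 2 - 2 ≤ (Finset.univ.filter fun w : F × F => hxCond q p z w).card := by
  have hp' : p.1 ^ q * p.1 = p.2 + p.2 ^ q := by rw [← pow_succ]; exact hp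
  have hz' : z.1 ^ q * z.1 = z.2 + z.2 ^ q := by rw [← pow_succ]; exact hz
  have hd : p.1 - z.1 ≠ 0 := sub_ne_zero.2 hpz
  have hdq : p.1 ^ q - z.1 ^ q ≠ 0 := by rw [← hx_fsub q h1]; exact pow_ne_zero _ hd
  set D : F → F := fun s => (p.1 - s) * (p.1 ^ q - s ^ q) - (z.1 - s) * (z.1 ^ q - s ^ q) with hD
  set Z := Finset.univ.filter fun s : F => D s = 0 with hZ
  have hZc : Z.card ≤ q := by
    refine le_trans (Finset.card_le_card ?_) (hx_card_roots q hq2 (-(p.1 - z.1))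
      (-(p.1 ^ q - z.1 ^ q)) (p.1 * p.1 ^ q - z.1 * z.1 ^ q) (neg_ne_zero.2 hd))
    intro s hs
    simp only [hZ, hD, Finset.mem_filter, Finset.mem_univ, true_and] at hs ⊢
    linear_combination hs
  have hDp : D p.1 ≠ 0 := by
    have : D p.1 = -((p.1 - z.1) * (p.1 ^ q - z.1 ^ q)) := by simp only [hD]; ring
    rw [this]; exact neg_ne_zero.2 (mul_ne_zero hd hdq)
  have hDz : D z.1 ≠ 0 := by
    have : D z.1 = ((p.1 - z.1) * (p.1 ^ q - z.1 ^ q)) := by simp only [hD]; ring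
    rw [this]; exact (mul_ne_zero hd hdq)
  -- the special fibre
  set S : F := (p.2 - z.2) / (p.1 - z.1) with hS
  have hSe : S * (p.1 - z.1) = p.2 - z.2 := div_mul_cancel₀ _ hd
  have hSq : S ^ q * (p.1 ^ q - z.1 ^ q) = p.2 ^ q - z.2 ^ q := by
    rw [← hx_fsub q h1, ← mul_pow, hSe, hx_fsub q h1]
  have hDs : D (S ^ q) = 0 := by
    simp only [hD, h2]
    linear_combination hp' - hz' - hSe - hSq
  set E := ((Finset.univ.erase p.1).erase z.1) \ Z with hE
  have hEc : q ^ 2 - 2 - q ≤ E.card := by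
    have e1 : ((Finset.univ.erase p.1).erase z.1).card = q ^ 2 - 2 := by
      rw [Finset.card_erase_of_mem (by simp [hpz.symm]),
        Finset.card_erase_of_mem (Finset.mem_univ _), Finset.card_univ, hcard]
      omega
    have := Finset.le_card_sdiff Z ((Finset.univ.erase p.1).erase z.1)
    rw [← hE] at this
    omega
  set g : F → F × F := fun s => (s,
    (((p.2 - s ^ q * p.1) * ((z.1 - s) * (z.1 ^ q - s ^ q)) -
      (z.2 - s ^ q * z.1) * ((p.1 - s) * (p.1 ^ q - s ^ q))) / D s) ^ q) with hg
  set W1 := E.image g with hW1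
  set W2 := (Finset.univ.filter fun r : F => (S ^ q) ^ (q + 1) = r + r ^ q).image
    (fun r => (S ^ q, r)) with hW2
  have hW1c : W1.card = E.card := by
    apply Finset.card_image_of_injective
    intro s s' h
    exact congrArg Prod.fst h
  have hW2c : W2.card = q := by
    rw [hW2, Finset.card_image_of_injective, hx_fiberN q hq2 hcard h1 h2]
    intro s s' h
    exact congrArg Prod.snd h
  have hdisj : Disjoint W1 W2 := by
    rw [Finset.disjoint_left]
    intro w hw1 hw2
    rw [hW1, Finset.mem_image] at hw1
    rw [hW2, Finset.mem_image] at hw2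
    obtain ⟨s, hs, rfl⟩ := hw1
    obtain ⟨r, hr, h⟩ := hw2
    have : S ^ q = s := congrArg Prod.fst h
    rw [hE, Finset.mem_sdiff] at hs
    apply hs.2
    rw [← this]
    simpa [hZ] using hDs
  have hsub : W1 ∪ W2 ⊆ Finset.univ.filter fun w : F × F => hxCond q p z w := by
    intro w hw
    rw [Finset.mem_filter]
    refine ⟨Finset.mem_univ _, ?_⟩
    rcases Finset.mem_union.1 hw with hw | hw
    · rw [hW1, Finset.mem_image] at hw
      obtain ⟨s, hs, rfl⟩ := hw
      rw [hE, Finset.mem_sdiff, Finset.mem_erase, Finset.mem_erase] at hs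
      obtain ⟨⟨hsz, hsp, -⟩, hsZ⟩ := hs
      have hDs0 : D s ≠ 0 := by simpa [hZ] using hsZ
      have hDq : D s ^ q = D s := by
        simp only [hD, hx_fsub q h1, mul_pow, h2]; ring
      refine ⟨?_, hsp, hsz, ?_⟩
      · simp only [Hset, Set.mem_ofPred_eq, hg, h2]
        rw [div_pow, hDq, ← add_div, eq_div_iff hDs0, pow_succ]
        simp only [hx_fsub q h1, mul_pow, h2]
        simp only [hD]
        linear_combination ((z.1 - s) * (z.1 ^ q - s ^ q)) * hp' -
          ((p.1 - s) * (p.1 ^ q - s ^ q)) * hz'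
      · simp only [hg, h2]
        set T := ((p.2 - s ^ q * p.1) * ((z.1 - s) * (z.1 ^ q - s ^ q)) -
          (z.2 - s ^ q * z.1) * ((p.1 - s) * (p.1 ^ q - s ^ q))) / D s with hT
        have hTD : T * D s = ((p.2 - s ^ q * p.1) * ((z.1 - s) * (z.1 ^ q - s ^ q)) -
          (z.2 - s ^ q * z.1) * ((p.1 - s) * (p.1 ^ q - s ^ q))) := div_mul_cancel₀ _ hDs0
        simp only [hD] at hTD
        linear_combination hTD
    · rw [hW2, Finset.mem_image] at hw
      obtain ⟨r, hr, rfl⟩ := hw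
      rw [Finset.mem_filter] at hr
      refine ⟨hr.2, ?_, ?_, ?_⟩
      · rintro h
        simp only at h
        rw [h] at hDs; exact hDp hDs
      · rintro h
        simp only at h
        rw [h] at hDs; exact hDz hDs
      · simp only [hD, h2] at hDs ⊢
        linear_combination (z.2 + r ^ q - S * z.1) * hDs +
          ((z.1 - S ^ q) * (z.1 ^ q - S)) * hSe
  have := Finset.card_le_card hsub
  rw [Finset.card_union_of_disjoint hdisj, hW1c, hW2c] at this
  omega

/-- The inner average for fixed `σ` . -/
noncomputable def hxP (q : ℕ) (σ : F × F → F × F) (p : F × F) (A : Finset (F × F)) : ℝ :=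
  avg (HFin F q) fun w => avg (PhiStab F q w (σ w)) fun σ₂ =>
    if σ₂ p ∈ A then (1 : ℝ) else 0

theorem hx_memH (q : ℕ) (w : F × F) : w ∈ HFin F q ↔ w ∈ Hset F q := by
  simp [HFin]

theorem hxP_eq (q : ℕ) (hq2 : 2 ≤ q) (hcard : Fintype.card F = q ^ 2)
    (h1 : ∀ x y : F, (x + y) ^ q = x ^ q + y ^ q) (h2 : ∀ x : F, (x ^ q) ^ q = x)
    (σ : F × F → F × F) (hσ : σ ∈ PhiH F q) (p : F × F) (A : Finset (F × F)) :
    hxP q σ p A = ((∑ y ∈ A, ∑ w ∈ HFin F q,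
      ((PhiStab F q w (σ w)).filter fun σ₂ => σ₂ p = y).card : ℕ) : ℝ) /
        ((q : ℝ) ^ 3 * ((q : ℝ) ^ 2 - 1)) := by
  have hσH : ∀ w ∈ Hset F q, σ w ∈ Hset F q := by
    obtain ⟨a, b, c, ha, hbc, rfl⟩ := hσ
    exact fun w hw => hx_pres q h1 h2 a b c hbc w hw
  have hc : ((q ^ 2 - 1 : ℕ) : ℝ) = (q : ℝ) ^ 2 - 1 := by
    rw [Nat.cast_sub (by nlinarith)]; push_cast; ring
  unfold hxP
  rw [avg, hx_cardH q hq2 hcard h1 h2]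
  have : ∀ w ∈ HFin F q, (avg (PhiStab F q w (σ w)) fun σ₂ =>
      if σ₂ p ∈ A then (1 : ℝ) else 0) =
      ((∑ y ∈ A, ((PhiStab F q w (σ w)).filter fun σ₂ => σ₂ p = y).card : ℕ) : ℝ) /
        ((q : ℝ) ^ 2 - 1) := by
    intro w hw
    have hw := (hx_memH q w).1 hw
    rw [avg, hx_cardStab q hcard h1 h2 w (σ w) hw (hσH w hw), hc]
    congr 1
    simp only [Finset.card_filter]
    rw [Finset.sum_comm]
    push_cast
    refine Finset.sum_congr rfl fun s _ => ?_
    simp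
  rw [Finset.sum_congr rfl this, ← Finset.sum_div, div_div, Finset.sum_comm]
  push_cast
  rw [mul_comm]

theorem hxP_compl (q : ℕ) (hq2 : 2 ≤ q) (hcard : Fintype.card F = q ^ 2)
    (h1 : ∀ x y : F, (x + y) ^ q = x ^ q + y ^ q) (h2 : ∀ x : F, (x ^ q) ^ q = x)
    (σ : F × F → F × F) (hσ : σ ∈ PhiH F q) (p : F × F) (hp : p ∈ Hset F q)
    (A : Finset (F × F)) (hA : A ⊆ HFin F q) :
    hxP q σ p A + hxP q σ p (HFin F q \ A) = 1 := by
  have hσH : ∀ w ∈ Hset F q, σ w ∈ Hset F q := by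
    obtain ⟨a, b, c, ha, hbc, rfl⟩ := hσ
    exact fun w hw => hx_pres q h1 h2 a b c hbc w hw
  have hH := hx_cardH q hq2 hcard h1 h2
  unfold hxP avg
  rw [← add_div, ← Finset.sum_add_distrib]
  have : ∀ w ∈ HFin F q,
      (∑ σ₂ ∈ PhiStab F q w (σ w), if σ₂ p ∈ A then (1 : ℝ) else 0) /
        ((PhiStab F q w (σ w)).card : ℝ) +
      (∑ σ₂ ∈ PhiStab F q w (σ w), if σ₂ p ∈ HFin F q \ A then (1 : ℝ) else 0) /
        ((PhiStab F q w (σ w)).card : ℝ) = 1 := by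
    intro w hw
    have hw := (hx_memH q w).1 hw
    have hc := hx_cardStab q hcard h1 h2 w (σ w) hw (hσH w hw)
    have hc0 : ((PhiStab F q w (σ w)).card : ℝ) ≠ 0 := by
      rw [hc]
      have : 4 ≤ q ^ 2 := by nlinarith
      have : q ^ 2 - 1 ≠ 0 := by omega
      exact_mod_cast this
    rw [← add_div, ← Finset.sum_add_distrib, div_eq_one_iff_eq hc0, Finset.card_eq_sum_ones]
    push_cast
    refine Finset.sum_congr rfl fun s hs => ?_
    have hsp : s p ∈ HFin F q := by
      simp only [PhiStab, PhiFin, Finset.mem_filter, Finset.mem_univ, true_and] at hs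
      obtain ⟨⟨a, b, c, ha, hbc, rfl⟩, -⟩ := hs
      exact (hx_memH q _).2 (hx_pres q h1 h2 a b c hbc p hp)
    by_cases h : s p ∈ A <;> simp [h, hsp]
  rw [Finset.sum_congr rfl this, Finset.sum_const, nsmul_eq_mul, mul_one, div_self]
  rw [hH]
  have : q ^ 3 ≠ 0 := by positivity
  exact_mod_cast this

theorem hxP_lower (q : ℕ) (hq2 : 2 ≤ q) (hcard : Fintype.card F = q ^ 2)
    (h1 : ∀ x y : F, (x + y) ^ q = x ^ q + y ^ q) (h2 : ∀ x : F, (x ^ q) ^ q = x)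
    (σ : F × F → F × F) (hσ : σ ∈ PhiH F q) (p : F × F) (hp : p ∈ Hset F q)
    (A : Finset (F × F)) (hA : A ⊆ HFin F q) :
    (A.card : ℝ) / (q : ℝ) ^ 3 - 1 / (q : ℝ) ≤ hxP q σ p A := by
  have hH := hx_cardH q hq2 hcard h1 h2
  have hσH : ∀ w ∈ Hset F q, σ w ∈ Hset F q := by
    obtain ⟨a, b, c, ha, hbc, rfl⟩ := hσ
    exact fun w hw => hx_pres q h1 h2 a b c hbc w hw
  have hinj : Function.Injective σ := by
    obtain ⟨a, b, c, ha, hbc, rfl⟩ := hσ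
    intro z z' h
    simp only [sigmaMap, Prod.mk.injEq] at h
    obtain ⟨e1, e2⟩ := h
    have e3 : z.1 = z'.1 := mul_left_cancel₀ ha (add_right_cancel e1)
    rw [e3] at e2
    exact Prod.ext e3 (mul_left_cancel₀ (pow_ne_zero _ ha)
      (add_right_cancel (add_right_cancel e2)))
  have hfst : ∀ z z' : F × F, z.1 = z'.1 → (σ z).1 = (σ z').1 := by
    obtain ⟨a, b, c, ha, hbc, rfl⟩ := hσ
    intro z z' h
    simp [sigmaMap, h]
  have hsurj : (HFin F q).image σ = HFin F q := by
    apply Finset.eq_of_subset_of_card_le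
    · intro y hy
      obtain ⟨z, hz, rfl⟩ := Finset.mem_image.1 hy
      exact (hx_memH q _).2 (hσH z ((hx_memH q _).1 hz))
    · rw [Finset.card_image_of_injective _ hinj]
  rw [hxP_eq q hq2 hcard h1 h2 σ hσ]
  set n : F × F → ℕ := fun y => ∑ w ∈ HFin F q,
      ((PhiStab F q w (σ w)).filter fun σ₂ => σ₂ p = y).card with hn
  set B := A.filter fun y => y.1 = (σ p).1 with hB
  have hBc : B.card ≤ q := by
    rw [← hx_fiberN q hq2 hcard h1 h2 (σ p).1]
    apply Finset.card_le_card_of_injOn Prod.snd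
    · intro y hy
      rw [Finset.mem_coe, hB, Finset.mem_filter] at hy
      have := (hx_memH q _).1 (hA hy.1)
      simp only [Hset, Set.mem_ofPred_eq] at this
      rw [hy.2] at this
      simpa using this
    · intro y hy y' hy' h
      rw [Finset.mem_coe, hB, Finset.mem_filter] at hy hy'
      exact Prod.ext (hy.2.trans hy'.2.symm) h
  have hlow : ∀ y ∈ A \ B, q ^ 2 - 2 ≤ n y := by
    intro y hy
    rw [Finset.mem_sdiff] at hy
    obtain ⟨hyA, hyB⟩ := hy
    have hyH := hA hyA
    rw [← hsurj, Finset.mem_image] at hyH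
    obtain ⟨z, hz, rfl⟩ := hyH
    have hzH := (hx_memH q _).1 hz
    have hpz : p.1 ≠ z.1 := by
      intro h
      apply hyB
      rw [hB, Finset.mem_filter]
      exact ⟨hyA, hfst _ _ h.symm⟩
    refine le_trans (hx_count q hq2 hcard h1 h2 p z hp hzH hpz) ?_
    simp only [hn]
    rw [Finset.card_eq_sum_ones]
    have hs : (Finset.univ.filter fun w : F × F => hxCond q p z w) ⊆ HFin F q := by
      intro w hw
      exact (hx_memH q _).2 (Finset.mem_filter.1 hw).2.1
    refine le_trans (Finset.sum_le_sum fun w hw => ?_)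
      (Finset.sum_le_sum_of_subset hs)
    obtain ⟨σ₂, hσ₂, he⟩ := hx_cond_exists q h1 h2 σ hσ p z w (Finset.mem_filter.1 hw).2
    exact Finset.card_pos.2 ⟨σ₂, Finset.mem_filter.2 ⟨hσ₂, he⟩⟩
  have hsum : (A \ B).card * (q ^ 2 - 2) ≤ ∑ y ∈ A, n y := by
    rw [← smul_eq_mul, ← Finset.sum_const]
    exact le_trans (Finset.sum_le_sum hlow) (Finset.sum_le_sum_of_subset Finset.sdiff_subset)
  have hAB : (A \ B).card + B.card = A.card :=
    Finset.card_sdiff_add_card_eq_card (Finset.filter_subset _ _)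
  have hAc : A.card ≤ q ^ 3 := hH ▸ Finset.card_le_card hA
  have hq2' : (2 : ℝ) ≤ q := by exact_mod_cast hq2
  have hsumR : ((A.card : ℝ) - q) * ((q : ℝ) ^ 2 - 2) ≤ ((∑ y ∈ A, n y : ℕ) : ℝ) := by
    have e1 : (((A \ B).card * (q ^ 2 - 2) : ℕ) : ℝ) ≤ ((∑ y ∈ A, n y : ℕ) : ℝ) := by
      exact_mod_cast hsum
    refine le_trans ?_ e1
    have h2q : 2 ≤ q ^ 2 := by nlinarith
    rw [Nat.cast_mul, Nat.cast_sub h2q]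
    push_cast
    apply mul_le_mul_of_nonneg_right
    · have : (A.card : ℝ) = (A \ B).card + B.card := by exact_mod_cast hAB.symm
      have h3 : (B.card : ℝ) ≤ q := by exact_mod_cast hBc
      linarith
    · nlinarith
  have hAcR : (A.card : ℝ) ≤ (q : ℝ) ^ 3 := by exact_mod_cast hAc
  have hq0 : (0 : ℝ) < q := by linarith
  have hq21 : (0 : ℝ) < (q : ℝ) ^ 2 - 1 := by nlinarith
  rw [le_div_iff₀ (by positivity)]
  refine le_trans ?_ hsumR
  have e : ((A.card : ℝ) / (q : ℝ) ^ 3 - 1 / (q : ℝ)) * ((q : ℝ) ^ 3 * ((q : ℝ) ^ 2 - 1)) =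
      (A.card : ℝ) * ((q : ℝ) ^ 2 - 1) - (q : ℝ) ^ 2 * ((q : ℝ) ^ 2 - 1) := by
    field_simp
  rw [e]
  have k : (q : ℝ) ^ 3 * 2 ≤ (q : ℝ) ^ 3 * q := by
    apply mul_le_mul_of_nonneg_left hq2'; positivity
  nlinarith

theorem hxP_bound (q : ℕ) (hq2 : 2 ≤ q) (hcard : Fintype.card F = q ^ 2)
    (h1 : ∀ x y : F, (x + y) ^ q = x ^ q + y ^ q) (h2 : ∀ x : F, (x ^ q) ^ q = x)
    (σ : F × F → F × F) (hσ : σ ∈ PhiH F q) (p : F × F) (hp : p ∈ Hset F q)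
    (A : Finset (F × F)) (hA : A ⊆ HFin F q) :
    |hxP q σ p A - (A.card : ℝ) / ((HFin F q).card : ℝ)| ≤ 1 / (q : ℝ) := by
  have hH := hx_cardH q hq2 hcard h1 h2
  have l1 := hxP_lower q hq2 hcard h1 h2 σ hσ p hp A hA
  have l2 := hxP_lower q hq2 hcard h1 h2 σ hσ p hp (HFin F q \ A) Finset.sdiff_subset
  have l3 := hxP_compl q hq2 hcard h1 h2 σ hσ p hp A hA
  have hc : ((HFin F q \ A).card : ℝ) = (q : ℝ) ^ 3 - A.card := by
    have := Finset.card_sdiff_add_card_eq_card hA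
    rw [hH] at this
    have h' : ((HFin F q \ A).card : ℝ) + A.card = (q : ℝ) ^ 3 := by exact_mod_cast this
    linarith
  have hq0 : (q : ℝ) ^ 3 ≠ 0 := by
    have : q ^ 3 ≠ 0 := by positivity
    exact_mod_cast this
  rw [hc, sub_div, div_self hq0] at l2
  rw [hH, abs_le]
  push_cast
  constructor <;> linarith

end Helpers

/-- `Φ_H` is `(1/q, 1/q)`-close to 2-steps uniform on the Hermitian curve `H`: for all
`u, v ∈ H` there is `H' ⊆ H` with `|H'| ≥ (1 − 1/q)|H|` such that for every `p ∈ H'`,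
if one draws `σ₁` uniformly from `{σ ∈ Φ_H : σ u = v}`, then `w` uniformly from `H`,
then `σ₂` uniformly from `{σ ∈ Φ_H : σ w = σ₁ w}`, the distribution of `σ₂ p` is within
statistical distance `1/q` of the uniform distribution on `H`. -/
theorem hermitian_two_steps_uniform {F : Type*} [Field F] [Fintype F] [DecidableEq F]
    (q : ℕ) (hq : ∃ p n : ℕ, p.Prime ∧ 0 < n ∧ q = p ^ n)
    (hcard : Fintype.card F = q ^ 2)
    (u v : F × F) (hu : u ∈ Hset F q) (hv : v ∈ Hset F q) :
    ∃ H' ⊆ HFin F q,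
      (1 - 1 / (q : ℝ)) * ((HFin F q).card : ℝ) ≤ (H'.card : ℝ) ∧
      ∀ p ∈ H', ∀ A ⊆ HFin F q,
        |avg (PhiStab F q u v) (fun σ₁ =>
            avg (HFin F q) fun w =>
              avg (PhiStab F q w (σ₁ w)) fun σ₂ =>
                if σ₂ p ∈ A then (1 : ℝ) else 0)
          - (A.card : ℝ) / ((HFin F q).card : ℝ)| ≤ 1 / (q : ℝ) := by
  have hq2 : 2 ≤ q := by
    obtain ⟨p, n, hp, hn, rfl⟩ := hq
    exact le_trans hp.two_le (Nat.le_self_pow hn.ne' p)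
  have h1 := hx_frob (F := F) q hq hcard
  have h2 := hx_frob2 (F := F) q hcard
  refine ⟨HFin F q, Finset.Subset.refl _, ?_, ?_⟩
  · have hnn : (0 : ℝ) ≤ 1 / (q : ℝ) := by positivity
    have hc : (0 : ℝ) ≤ ((HFin F q).card : ℝ) := by positivity
    nlinarith
  · intro p hp A hA
    have hpH := (hx_memH q p).1 hp
    have hc0 : (0 : ℝ) < ((PhiStab F q u v).card : ℝ) := by
      rw [hx_cardStab q hcard h1 h2 u v hu hv]
      have : 4 ≤ q ^ 2 := by nlinarith
      have : 0 < q ^ 2 - 1 := by omega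
      exact_mod_cast this
    have hb : ∀ σ ∈ PhiStab F q u v,
        |hxP q σ p A - (A.card : ℝ) / ((HFin F q).card : ℝ)| ≤ 1 / (q : ℝ) := by
      intro σ hσ
      apply hxP_bound q hq2 hcard h1 h2 σ ?_ p hpH A hA
      simp only [PhiStab, PhiFin, Finset.mem_filter, Finset.mem_univ, true_and] at hσ
      exact hσ.1
    have key : |avg (PhiStab F q u v) (fun σ => hxP q σ p A)
        - (A.card : ℝ) / ((HFin F q).card : ℝ)| ≤ 1 / (q : ℝ) := by
      have e : avg (PhiStab F q u v) (fun σ => hxP q σ p A)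
          - (A.card : ℝ) / ((HFin F q).card : ℝ) =
          (∑ σ ∈ PhiStab F q u v, (hxP q σ p A - (A.card : ℝ) / ((HFin F q).card : ℝ))) /
            ((PhiStab F q u v).card : ℝ) := by
        rw [avg, Finset.sum_sub_distrib, Finset.sum_const, nsmul_eq_mul, sub_div,
          mul_div_cancel_left₀ _ hc0.ne']
      rw [e, abs_div, abs_of_pos hc0, div_le_iff₀ hc0]
      refine le_trans (Finset.abs_sum_le_sum_abs _ _) ?_
      refine le_trans (Finset.sum_le_sum hb) ?_
      rw [Finset.sum_const, nsmul_eq_mul, mul_comm]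
    unfold hxP at key
    convert key
end

section
/- Let q be a prime power, let δ ∈ (0,1) with r = (1−δ)q³ an integer, and suppose the Hermitian code Herm_q[r] has distance δ(Herm_q[r]) ≥ δ. Let Φ_H be the group of maps σ_{a,b,c} acting on the Hermitian curve H. Then for every m ≥ 1, the lifted code lift_{Φ_H}^m(Herm_q[r]) has distance at least δ² − (m+1)/q. -/
/-- The Hermitian curve as a subtype (the domain of the Hermitian code). -/
abbrev Hsub (F : Type*) [Field F] (q : ℕ) : Type _ :=
  {p : F × F // p.1 ^ (q + 1) = p.2 + p.2 ^ q}

/-- The Hermitian code `Herm_q[r] ⊆ (H → F)`: the `F`-span of the monomial functions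
`(x,y) ↦ x^i y^j` with `j < q` and `q·i + (q+1)·j < r`. -/
def HermCode (F : Type*) [Field F] (q r : ℕ) : Submodule F (Hsub F q → F) :=
  Submodule.span F {f : Hsub F q → F |
    ∃ i j : ℕ, j < q ∧ q * i + (q + 1) * j < r ∧
      f = fun p => p.1.1 ^ i * p.1.2 ^ j}

/-- The maps `σ_{a,b,c}` viewed as maps of the Hermitian curve `H` to itself. -/
def PhiHsub (F : Type*) [Field F] (q : ℕ) : Set (Hsub F q → Hsub F q) :=
  {τ | ∃ a b c : F, a ≠ 0 ∧ (b, c) ∈ Hset F q ∧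
    ∀ p : Hsub F q, (τ p : F × F) = sigmaMap q a b c (p : F × F)}

/-- Relative Hamming distance. -/
noncomputable def relDist {β R : Type*} (f g : β → R) : ℝ :=
  (Set.ncard {x | f x ≠ g x} : ℝ) / (Nat.card β : ℝ)

/-- Restriction of `f : Dᵐ → R` along a tuple of maps `D → D`. -/
def restr {D R : Type*} {m : ℕ} (f : (Fin m → D) → R) (σ : Fin m → D → D) : D → R :=
  fun z => f fun i => σ i z

/-- The `m`-dimensional `Φ`-lift of a code `C ⊆ (D → R)`. -/
def liftCode {D R : Type*} (Φ : Set (D → D)) (m : ℕ) (C : Set (D → R)) :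
    Set ((Fin m → D) → R) :=
  {f | ∀ σ : Fin m → D → D, (∀ i, σ i ∈ Φ) → restr f σ ∈ C}


namespace HermLift

section field
variable {F : Type*} [Field F] [Fintype F]

theorem frob_add (q : ℕ) (hq : ∃ p n : ℕ, p.Prime ∧ 0 < n ∧ q = p ^ n)
    (hcard : Fintype.card F = q ^ 2) (x y : F) : (x + y) ^ q = x ^ q + y ^ q := by
  obtain ⟨p, n, hp, hn, rfl⟩ := hq
  have : Fact p.Prime := ⟨hp⟩
  have : CharP F p := by
    obtain ⟨p', hp'⟩ := CharP.exists F
    obtain ⟨k, hpr, hk⟩ := FiniteField.card F p'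
    rw [hcard, ← pow_mul] at hk
    have h1 : p' ∣ p ^ (n * 2) := by rw [hk]; exact dvd_pow_self _ k.ne_zero
    have : p' = p := (Nat.prime_dvd_prime_iff_eq hpr hp).1 (hpr.dvd_of_dvd_pow h1)
    exact this ▸ hp'
  exact add_pow_char_pow x y p n

theorem frob_frob (q : ℕ) (hcard : Fintype.card F = q ^ 2) (x : F) : (x ^ q) ^ q = x := by
  rw [← pow_mul, ← sq, ← hcard, FiniteField.pow_card]

theorem two_le (q : ℕ) (hq : ∃ p n : ℕ, p.Prime ∧ 0 < n ∧ q = p ^ n) : 2 ≤ q := by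
  obtain ⟨p, n, hp, hn, rfl⟩ := hq
  calc 2 ≤ p := hp.two_le
    _ ≤ p ^ n := Nat.le_self_pow hn.ne' p

theorem neg_frob (q : ℕ) (hq : ∃ p n : ℕ, p.Prime ∧ 0 < n ∧ q = p ^ n)
    (hcard : Fintype.card F = q ^ 2) (x : F) : (-x) ^ q = - x ^ q := by
  have h := frob_add q hq hcard x (-x)
  have h2 := two_le q hq
  rw [add_neg_cancel, zero_pow (by omega)] at h
  linear_combination -h

/-- `σ_{a,u}` as a self-map of the curve. -/
def sig (q : ℕ) (hq : ∃ p n : ℕ, p.Prime ∧ 0 < n ∧ q = p ^ n)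
    (hcard : Fintype.card F = q ^ 2) (a : F) (u : Hsub F q) (p : Hsub F q) : Hsub F q :=
  ⟨sigmaMap q a u.1.1 u.1.2 p.1, by
    obtain ⟨⟨x, y⟩, h⟩ := p
    obtain ⟨⟨b, c⟩, h'⟩ := u
    simp only [sigmaMap] at *
    have e : (a ^ (q+1)) ^ q = a ^ (q + 1) := by
      rw [pow_succ, mul_pow, frob_frob q hcard]; ring
    rw [pow_succ, frob_add q hq hcard, frob_add q hq hcard, frob_add q hq hcard,
      mul_pow, mul_pow, mul_pow, mul_pow, frob_frob q hcard, e]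
    linear_combination a ^ (q+1) * h + h'⟩

theorem sig_mem (q : ℕ) (hq : ∃ p n : ℕ, p.Prime ∧ 0 < n ∧ q = p ^ n)
    (hcard : Fintype.card F = q ^ 2) (a : F) (ha : a ≠ 0) (u : Hsub F q) :
    sig q hq hcard a u ∈ PhiHsub F q :=
  ⟨a, u.1.1, u.1.2, ha, u.2, fun _ => rfl⟩

/-- the origin -/
def org (F : Type*) [Field F] (q : ℕ) (h : 2 ≤ q) : Hsub F q := ⟨(0, 0), by
  have h' : q ≠ 0 := by omega
  simp [h']⟩

theorem sig_org (q : ℕ) (hq : ∃ p n : ℕ, p.Prime ∧ 0 < n ∧ q = p ^ n)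
    (hcard : Fintype.card F = q ^ 2) (a : F) (u : Hsub F q) :
    sig q hq hcard a u (org F q (two_le q hq)) = u := by
  apply Subtype.ext
  simp [sig, org, sigmaMap]

open Polynomial in
theorem card_root_le [DecidableEq F] (P : F[X]) (hP : P ≠ 0) (s : Finset F) (d : ℕ)
    (hd : P.natDegree ≤ d) (hs : ∀ x ∈ s, P.eval x = 0) : s.card ≤ d := by
  refine le_trans ?_ hd
  refine le_trans ?_ (Polynomial.card_roots' P)
  refine le_trans ?_ (Multiset.toFinset_card_le _)
  apply Finset.card_le_card
  intro x hx
  rw [Multiset.mem_toFinset, mem_roots hP]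
  exact hs x hx

open Polynomial in
theorem fiber_le [DecidableEq F] (q : ℕ) (hq : 2 ≤ q) (c : F) :
    (Finset.univ.filter fun y : F => y + y ^ q = c).card ≤ q := by
  have hco : (X ^ q + X - C c : F[X]).coeff q = 1 := by
    simp [coeff_X, coeff_C]
    rw [if_neg (by omega), if_neg (by omega)]; simp
  apply card_root_le (X ^ q + X - C c)
  · intro h; rw [h] at hco; simp at hco
  · compute_degree; omega
  · intro x hx
    simp at hx
    simp
    linear_combination hx

open Polynomial in
theorem sub_le [DecidableEq F] (q : ℕ) (hq : 2 ≤ q) :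
    (Finset.univ.filter fun y : F => y ^ q = y).card ≤ q := by
  have hco : (X ^ q - X : F[X]).coeff q = 1 := by
    simp [coeff_X]
    omega
  apply card_root_le (X ^ q - X)
  · intro h; rw [h] at hco; simp at hco
  · compute_degree; omega
  · intro x hx
    simp at hx
    simp [hx]

theorem fiber_eq [DecidableEq F] (q : ℕ) (hq : ∃ p n : ℕ, p.Prime ∧ 0 < n ∧ q = p ^ n)
    (hcard : Fintype.card F = q ^ 2) (c : F) (hc : c ^ q = c) :
    (Finset.univ.filter fun y : F => y + y ^ q = c).card = q := by
  have h2 := two_le q hq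
  refine le_antisymm (fiber_le q h2 c) ?_
  by_contra hlt
  push Not at hlt
  have h1 : (Finset.univ : Finset F).card = ∑ c ∈ Finset.univ.filter (fun y : F => y ^ q = y),
      (Finset.univ.filter fun y : F => y + y ^ q = c).card := by
    apply Finset.card_eq_sum_card_fiberwise
    intro y _
    simp [frob_add q hq hcard, frob_frob q hcard, add_comm]
  have h3 : ∑ c ∈ Finset.univ.filter (fun y : F => y ^ q = y),
      (Finset.univ.filter fun y : F => y + y ^ q = c).card <
      ∑ c ∈ Finset.univ.filter (fun y : F => y ^ q = y), q := by
    apply Finset.sum_lt_sum (fun i _ => fiber_le q h2 i)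
    exact ⟨c, by simpa using hc, hlt⟩
  rw [Finset.sum_const, smul_eq_mul, ← h1, Finset.card_univ, hcard] at h3
  have := Nat.mul_le_mul_right q (sub_le (F := F) q h2)
  nlinarith

theorem fiberx [DecidableEq F] (q : ℕ) (hq : ∃ p n : ℕ, p.Prime ∧ 0 < n ∧ q = p ^ n)
    (hcard : Fintype.card F = q ^ 2) (x : F) :
    (Finset.univ.filter fun p : Hsub F q => p.1.1 = x).card = q := by
  refine Eq.trans ?_ (fiber_eq q hq hcard (x ^ (q + 1)) (by
      rw [pow_succ, mul_pow, frob_frob q hcard]; ring))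
  apply Finset.card_bij (fun p _ => p.1.2)
  · rintro ⟨⟨a, b⟩, h⟩ hp
    simp at hp h ⊢
    subst hp
    exact h.symm
  · rintro ⟨⟨a, b⟩, h⟩ hp ⟨⟨a', b'⟩, h'⟩ hp' e
    simp at hp hp' e ⊢
    exact ⟨hp.trans hp'.symm, e⟩
  · intro y hy
    simp at hy
    exact ⟨⟨(x, y), hy.symm⟩, by simp, rfl⟩

theorem cardH [DecidableEq F] (q : ℕ) (hq : ∃ p n : ℕ, p.Prime ∧ 0 < n ∧ q = p ^ n)
    (hcard : Fintype.card F = q ^ 2) : Fintype.card (Hsub F q) = q ^ 3 := by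
  rw [← Finset.card_univ, Finset.card_eq_sum_card_fiberwise (f := fun p : Hsub F q => p.1.1)
    (t := Finset.univ) (by intro x _; simp)]
  rw [Finset.sum_congr rfl (fun x _ => fiberx q hq hcard x)]
  simp [hcard]; ring

open Polynomial in
theorem roots_main [DecidableEq F] (q : ℕ) (hq : ∃ p n : ℕ, p.Prime ∧ 0 < n ∧ q = p ^ n)
    (hcard : Fintype.card F = q ^ 2) (s t Z Y : F) :
    (t + s ≠ 1 → (Finset.univ.filter fun b : F =>
      s * (Z - b) ^ (q + 1) + t * b ^ (q + 1) + b ^ q * (Z - b) = Y).card ≤ q + 1) ∧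
    (t + s = 1 → Z ≠ 0 → (Finset.univ.filter fun b : F =>
      s * (Z - b) ^ (q + 1) + t * b ^ (q + 1) + b ^ q * (Z - b) = Y).card ≤ q) := by
  have h2 := two_le q hq
  have key : ∀ b, s * (Z - b) ^ (q + 1) + t * b ^ (q + 1) + b ^ q * (Z - b) = Y →
      (t + s - 1) * b ^ (q+1) + ((1 - s) * Z) * b ^ q + (- s * Z ^ q) * b + (s * Z ^ (q + 1) - Y)
        = 0 := by
    intro b hb
    have : (Z - b) ^ q = Z ^ q - b ^ q := by
      rw [sub_eq_add_neg, frob_add q hq hcard, neg_frob q hq hcard]; ring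
    rw [pow_succ, this] at hb
    linear_combination hb
  constructor
  · intro hk
    have hco : (C (t+s-1) * X ^ (q+1) + C ((1-s)*Z) * X ^ q + C (-s * Z^q) * X
      + C (s * Z ^ (q+1) - Y) : F[X]).coeff (q+1) = t + s - 1 := by
      simp only [coeff_add, coeff_C_mul, coeff_X_pow, coeff_X, coeff_C]
      rw [if_pos trivial, if_neg (by omega), if_neg (by omega), if_neg (by omega)]; simp
    apply card_root_le (C (t+s-1) * X ^ (q+1) + C ((1-s)*Z) * X ^ q + C (-s * Z^q) * X
      + C (s * Z ^ (q+1) - Y))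
    · intro h; rw [h] at hco; simp at hco
      exact hk (by linear_combination -hco)
    · compute_degree
    · intro x hx
      simp only [Finset.mem_filter, Finset.mem_univ, true_and] at hx
      simpa using key x hx
  · intro hk hZ
    have hco : (C ((1-s)*Z) * X ^ q + C (-s * Z^q) * X
      + C (s * Z ^ (q+1) - Y) : F[X]).coeff q = (1-s)*Z := by
      simp only [coeff_add, coeff_C_mul, coeff_X_pow, coeff_X, coeff_C]
      rw [if_pos trivial, if_neg (by omega), if_neg (by omega)]; simp
    have hco1 : (C ((1-s)*Z) * X ^ q + C (-s * Z^q) * X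
      + C (s * Z ^ (q+1) - Y) : F[X]).coeff 1 = -s * Z^q := by
      simp only [coeff_add, coeff_C_mul, coeff_X_pow, coeff_X, coeff_C]
      rw [if_neg (by omega), if_pos trivial, if_neg (by omega)]; simp
    apply card_root_le (C ((1-s)*Z) * X ^ q + C (-s * Z^q) * X
      + C (s * Z ^ (q+1) - Y))
    · intro h; rw [h] at hco hco1
      simp only [coeff_zero] at hco hco1
      have a1 := (mul_eq_zero.1 hco.symm).resolve_right hZ
      have a2 := (mul_eq_zero.1 hco1.symm).resolve_right (pow_ne_zero _ hZ)
      apply one_ne_zero (α := F)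
      linear_combination a1 - a2
    · compute_degree; omega
    · intro x hx
      simp only [Finset.mem_filter, Finset.mem_univ, true_and] at hx
      have := key x hx
      rw [hk] at this
      simpa using this

end field

/-- product comparison lemma -/
theorem prod_compare {m : ℕ} {H Ω : Type*} [Fintype H] [DecidableEq H] [Fintype Ω]
    (G : Fin m → Ω → H) (N : Finset (Fin m → H)) (q : ℕ) (L : ℝ) (hL : 0 ≤ L)
    (hk : ∀ i, L ≤ ∑ w, ((min (Finset.univ.filter fun ω => G i ω = w).card q : ℕ) : ℝ)) :
    ((Finset.univ.filter fun ω : Fin m → Ω => (fun i => G i (ω i)) ∈ N).card : ℝ) ≤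
      N.card * (q : ℝ) ^ m + (Fintype.card Ω : ℝ) ^ m - L ^ m := by
  classical
  set n : Fin m → H → ℕ := fun i w => (Finset.univ.filter fun ω => G i ω = w).card with hn
  have h1 : (Finset.univ.filter fun ω : Fin m → Ω => (fun i => G i (ω i)) ∈ N).card =
      ∑ w ∈ N, ∏ i, n i (w i) := by
    rw [Finset.card_eq_sum_card_fiberwise (f := fun (ω : Fin m → Ω) i => G i (ω i)) (t := N)
      (by intro x hx; simpa using hx)]
    apply Finset.sum_congr rfl
    intro w hw
    rw [← Fintype.card_piFinset]
    congr 1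
    ext ω
    simp only [Finset.mem_filter, Finset.mem_univ, true_and, Fintype.mem_piFinset, funext_iff]
    constructor
    · exact fun h => h.2
    · intro h
      refine ⟨?_, h⟩
      have : (fun i => G i (ω i)) = w := funext h
      rwa [this]
  have h2 : ∑ w : Fin m → H, ∏ i, (n i (w i) : ℝ) = (Fintype.card Ω : ℝ) ^ m := by
    rw [← Fintype.prod_sum (fun i w => (n i w : ℝ))]
    have : ∀ i, ∑ w, (n i w : ℝ) = Fintype.card Ω := by
      intro i
      rw [← Nat.cast_sum, ← Finset.card_univ (α := Ω),
        Finset.card_eq_sum_card_fiberwise (f := G i) (t := Finset.univ) (by intro x _; simp)]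
    simp [this]
  have h3 : L ^ m ≤ ∑ w : Fin m → H, ∏ i, ((min (n i (w i)) q : ℕ) : ℝ) := by
    rw [← Fintype.prod_sum (fun i w => ((min (n i w) q : ℕ) : ℝ))]
    calc L ^ m = ∏ i : Fin m, L := by simp
      _ ≤ _ := Finset.prod_le_prod (fun _ _ => hL) (fun i _ => hk i)
  have h4 : ∑ w ∈ N, (∏ i, (n i (w i) : ℝ) - ∏ i, ((min (n i (w i)) q : ℕ) : ℝ)) ≤
      ∑ w : Fin m → H, (∏ i, (n i (w i) : ℝ) - ∏ i, ((min (n i (w i)) q : ℕ) : ℝ)) := by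
    apply Finset.sum_le_sum_of_subset_of_nonneg (Finset.subset_univ _)
    intro w _ _
    rw [sub_nonneg]
    apply Finset.prod_le_prod
    · intros; positivity
    · intro i _
      exact_mod_cast min_le_left _ _
  have h5 : ∑ w ∈ N, ∏ i, ((min (n i (w i)) q : ℕ) : ℝ) ≤ N.card * (q : ℝ) ^ m := by
    rw [← nsmul_eq_mul]
    apply Finset.sum_le_card_nsmul
    intro w _
    calc _ ≤ ∏ i : Fin m, (q : ℝ) := by
          apply Finset.prod_le_prod
          · intros; positivity
          · intro i _
            exact_mod_cast min_le_right _ _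
      _ = _ := by simp
  rw [h1]
  push_cast
  rw [Finset.sum_sub_distrib, Finset.sum_sub_distrib] at h4
  linarith

section excess
variable {F : Type*} [Field F] [Fintype F] [DecidableEq F]

/-- fibres of the two-step map -/
theorem excess (q : ℕ) (hq : ∃ p n : ℕ, p.Prime ∧ 0 < n ∧ q = p ^ n)
    (hcard : Fintype.card F = q ^ 2) (P p p' : Hsub F q) (hp : p.1.1 ≠ 0) (hp' : p'.1.1 ≠ 0) :
    (q : ℝ) ^ 4 - q ^ 3 - q ^ 2 ≤ ∑ w : Hsub F q,
      ((min (Finset.univ.filter fun ω : Fˣ × Fˣ =>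
        sig q hq hcard ω.2 (sig q hq hcard ω.1 P p) p' = w).card q : ℕ) : ℝ) := by
  have h2 := two_le q hq
  set G : Fˣ × Fˣ → Hsub F q := fun ω => sig q hq hcard ω.2 (sig q hq hcard ω.1 P p) p' with hG
  set n : F × F → ℕ := fun w => (Finset.univ.filter fun ω => (G ω).1 = w).card with hn
  have hn1 : ∀ w : Hsub F q, (Finset.univ.filter fun ω => G ω = w).card = n w.1 := by
    intro w
    simp only [hn, Subtype.ext_iff]
  change _ ≤ ∑ w : Hsub F q, ((min (Finset.univ.filter fun ω => G ω = w).card q : ℕ) : ℝ)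
  simp only [hn1]
  have hcΩ : Fintype.card (Fˣ × Fˣ) = (q ^ 2 - 1) ^ 2 := by
    rw [Fintype.card_prod, Fintype.card_units, hcard, sq (q ^ 2 - 1)]
  have htot : ∑ w : Hsub F q, n w.1 = (q ^ 2 - 1) ^ 2 := by
    rw [← hcΩ, ← Finset.card_univ, Finset.card_eq_sum_card_fiberwise (f := G) (t := Finset.univ)
      (by intro x _; simp)]
    exact Finset.sum_congr rfl fun w _ => (hn1 w).symm
  have hexc : ∑ w : Hsub F q, (n w.1 - q) ≤ ∑ X : F, ∑ Y : F, (n (X, Y) - q) := by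
    rw [← Fintype.sum_prod_type (f := fun w : F × F => n w - q)]
    have := Finset.sum_map (Finset.univ : Finset (Hsub F q))
      (⟨Subtype.val, Subtype.val_injective⟩ : Hsub F q ↪ F × F) (fun w : F × F => n w - q)
    simp only [Function.Embedding.coeFn_mk] at this
    rw [← this]
    exact Finset.sum_le_sum_of_subset (Finset.subset_univ _)
  have hG1 : ∀ ω, (G ω).1.1 = ω.2 * p'.1.1 + (ω.1 * p.1.1 + P.1.1) := fun _ => rfl
  have hG2 : ∀ ω, (G ω).1.2 = ω.2 ^ (q+1) * p'.1.2 + ω.2 * (ω.1 * p.1.1 + P.1.1) ^ q * p'.1.1 +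
    (ω.1 ^ (q+1) * p.1.2 + ω.1 * P.1.1 ^ q * p.1.1 + P.1.2) := fun _ => rfl
  have hinj : ∀ ω ω' : Fˣ × Fˣ, (G ω).1.1 = (G ω').1.1 → (ω.1 : F) = ω'.1 → ω = ω' := by
    intro ω ω' h h'
    rw [hG1, hG1, h'] at h
    refine Prod.ext (Units.ext h') (Units.ext ?_)
    exact mul_right_cancel₀ hp' (add_right_cancel h)
  have hfst : ∀ X, ∑ Y : F, n (X, Y) ≤ q ^ 2 := by
    intro X
    have h3 : (Finset.univ.filter fun ω => (G ω).1.1 = X).card = ∑ Y : F, n (X, Y) := by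
      rw [Finset.card_eq_sum_card_fiberwise (f := fun ω => (G ω).1.2) (t := Finset.univ)
        (by intro x _; simp)]
      apply Finset.sum_congr rfl
      intro Y _
      simp only [hn, Finset.filter_filter, Prod.ext_iff]
    rw [← h3, ← hcard, ← Finset.card_univ]
    apply Finset.card_le_card_of_injOn (fun ω => (ω.1 : F)) (by intro x _; simp)
    intro ω hω ω' hω' h
    simp at hω hω'
    exact hinj ω ω' (hω.trans hω'.symm) h
  have hroot : ∀ X Y, ∃ Y', n (X, Y) ≤ (Finset.univ.filter fun b : F =>
      (p'.1.2 / p'.1.1 ^ (q+1)) * ((X - P.1.1) - b) ^ (q + 1) + (p.1.2 / p.1.1 ^ (q+1)) * b ^ (q + 1)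
        + b ^ q * ((X - P.1.1) - b) = Y').card := by
    intro X Y
    refine ⟨Y - P.1.1 ^ q * (X - P.1.1) - P.1.2, ?_⟩
    apply Finset.card_le_card_of_injOn (fun ω => (ω.1 : F) * p.1.1)
    · intro ω hω
      simp only [Finset.coe_filter, Finset.mem_univ, true_and, Set.mem_ofPred_eq, Prod.ext_iff,
        hG1, hG2] at hω ⊢
      obtain ⟨h3, h4⟩ := hω
      have h5 : X - P.1.1 - ω.1 * p.1.1 = ω.2 * p'.1.1 := by rw [← h3]; ring
      have h6 : X - P.1.1 = ω.1 * p.1.1 + ω.2 * p'.1.1 := by rw [← h3]; ring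
      have h7 : p'.1.2 / p'.1.1 ^ (q+1) * (ω.2 * p'.1.1) ^ (q+1) = ω.2 ^ (q+1) * p'.1.2 := by
        rw [mul_pow]; field_simp
      have h8 : p.1.2 / p.1.1 ^ (q+1) * (ω.1 * p.1.1) ^ (q+1) = ω.1 ^ (q+1) * p.1.2 := by
        rw [mul_pow]; field_simp
      rw [h5, h6, h7, h8, ← h4, frob_add q hq hcard]
      ring
    · intro ω hω ω' hω' h
      simp only [Finset.coe_filter, Finset.mem_univ, true_and, Set.mem_ofPred_eq] at hω hω'
      exact hinj ω ω' (by rw [hω, hω']) (mul_right_cancel₀ hp h)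
  have hmain : ∑ X : F, ∑ Y : F, (n (X, Y) - q) + q ^ 2 ≤ q ^ 3 := by
    by_cases hk : p.1.2 / p.1.1 ^ (q+1) + p'.1.2 / p'.1.1 ^ (q+1) = 1
    · have hz : ∑ X : F, ∑ Y : F, (n (X, Y) - q) = ∑ Y : F, (n (P.1.1, Y) - q) := by
        apply Finset.sum_eq_single_of_mem _ (Finset.mem_univ _)
        intro X _ hX
        apply Finset.sum_eq_zero
        intro Y _
        obtain ⟨Y', h⟩ := hroot X Y
        have := (roots_main q hq hcard (p'.1.2 / p'.1.1 ^ (q+1)) (p.1.2 / p.1.1 ^ (q+1))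
          (X - P.1.1) Y').2 hk (sub_ne_zero.2 hX)
        omega
      rw [hz]
      have : ∑ Y : F, (n (P.1.1, Y) - q) ≤ ∑ Y : F, n (P.1.1, Y) :=
        Finset.sum_le_sum fun _ _ => Nat.sub_le _ _
      have := hfst P.1.1
      nlinarith
    · have : ∀ X : F, ∑ Y : F, (n (X, Y) - q) ≤ q - 1 := by
        intro X
        have h3 : (q + 1) * ∑ Y : F, (n (X, Y) - q) ≤ ∑ Y : F, n (X, Y) := by
          rw [Finset.mul_sum]
          apply Finset.sum_le_sum
          intro Y _
          obtain ⟨Y', h⟩ := hroot X Y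
          have := (roots_main q hq hcard (p'.1.2 / p'.1.1 ^ (q+1)) (p.1.2 / p.1.1 ^ (q+1))
            (X - P.1.1) Y').1 hk
          have h5 : n (X, Y) ≤ q + 1 := h.trans this
          rcases Nat.lt_or_ge q (n (X, Y)) with h6 | h6
          · have : n (X, Y) = q + 1 := by omega
            rw [this]; simp
          · rw [Nat.sub_eq_zero_of_le h6]; simp
        have := hfst X
        by_contra hc
        have h7 : q ≤ ∑ Y : F, (n (X, Y) - q) := by omega
        have := Nat.mul_le_mul_left (q+1) h7
        nlinarith
      have h8 := Finset.sum_le_sum (s := Finset.univ) fun X _ => this X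
      rw [Finset.sum_const, Finset.card_univ, hcard, smul_eq_mul] at h8
      obtain ⟨k, rfl⟩ : ∃ k, q = k + 1 := ⟨q - 1, by omega⟩
      simp only [Nat.add_sub_cancel] at h8
      nlinarith
  have hmin : ∑ w : Hsub F q, min (n w.1) q + ∑ w : Hsub F q, (n w.1 - q)
      = ∑ w : Hsub F q, n w.1 := by
    rw [← Finset.sum_add_distrib]
    apply Finset.sum_congr rfl
    intro w _
    omega
  rw [← Nat.cast_sum]
  have e1 : ((∑ w : Hsub F q, min (n w.1) q : ℕ) : ℝ) + (∑ w : Hsub F q, (n w.1 - q) : ℕ)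
      = ((q : ℝ) ^ 2 - 1) ^ 2 := by
    rw [← Nat.cast_add, hmin, htot]
    push_cast [Nat.one_le_pow]
    rw [Nat.cast_sub (Nat.one_le_pow _ _ (by omega))]
    push_cast; ring
  have e2 : ((∑ w : Hsub F q, (n w.1 - q) : ℕ) : ℝ) + q ^ 2 ≤ q ^ 3 := by
    exact_mod_cast (Nat.add_le_add_right hexc _).trans hmain
  nlinarith

end excess

end HermLift
set_option maxHeartbeats 2000000

/-- Distance of the lifted Hermitian code: if `Herm_q[r]` (with `r = (1−δ)q³`) has
relative distance at least `δ`, then for every `m ≥ 1` the lifted code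
`lift_{Φ_H}^m(Herm_q[r])` has relative distance at least `δ² − (m+1)/q`. -/
theorem lifted_hermitian_distance {F : Type*} [Field F] [Fintype F] [DecidableEq F]
    (q : ℕ) (hq : ∃ p n : ℕ, p.Prime ∧ 0 < n ∧ q = p ^ n)
    (hcard : Fintype.card F = q ^ 2)
    (δ : ℝ) (hδ0 : 0 < δ) (hδ1 : δ < 1)
    (r : ℕ) (hr : (r : ℝ) = (1 - δ) * (q : ℝ) ^ 3)
    (hdist : ∀ f ∈ HermCode F q r, ∀ g ∈ HermCode F q r, f ≠ g → δ ≤ relDist f g)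
    (m : ℕ) [NeZero m] :
    ∀ f ∈ liftCode (PhiHsub F q) m (HermCode F q r : Set (Hsub F q → F)),
      ∀ g ∈ liftCode (PhiHsub F q) m (HermCode F q r : Set (Hsub F q → F)),
        f ≠ g → δ ^ 2 - ((m : ℝ) + 1) / (q : ℝ) ≤ relDist f g := by
  classical
  intro f hf g hg hfg
  have h2 := HermLift.two_le q hq
  have hH := HermLift.cardH q hq hcard
  have hq0 : (0 : ℝ) < q := by exact_mod_cast (by omega : 0 < q)
  set N : Finset (Fin m → Hsub F q) := Finset.univ.filter fun w => f w ≠ g w with hN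
  have hrel : relDist f g = N.card / ((q : ℝ) ^ 3) ^ m := by
    unfold relDist
    rw [Nat.card_eq_fintype_card, Fintype.card_fun, hH, Fintype.card_fin, ← Set.ncard_coe_finset]
    push_cast
    congr 3
    ext w; simp [hN]
  rcases Nat.lt_or_ge (m + 1) q with hmq | hmq
  swap
  · have h1 : (1 : ℝ) ≤ ((m : ℝ) + 1) / q := by
      rw [le_div_iff₀ hq0, one_mul]; exact_mod_cast hmq
    have : 0 ≤ relDist f g := by rw [hrel]; positivity
    nlinarith
  -- one step
  have step : ∀ u ∈ N, ∀ a : Fin m → Fˣ, δ * (q : ℝ) ^ 3 ≤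
      ((Finset.univ.filter fun p : Hsub F q =>
        (fun i => HermLift.sig q hq hcard (a i) (u i) p) ∈ N).card : ℝ) := by
    intro u hu a
    have hσ : ∀ i, HermLift.sig q hq hcard (a i : F) (u i) ∈ PhiHsub F q :=
      fun i => HermLift.sig_mem q hq hcard _ (a i).ne_zero _
    have := hdist _ (hf _ hσ) _ (hg _ hσ) (by
      intro h
      have := congrFun h (HermLift.org F q h2)
      simp only [restr, HermLift.sig_org] at this
      simp [hN] at hu
      exact hu this)
    unfold relDist at this
    rw [Nat.card_eq_fintype_card, hH, le_div_iff₀ (by positivity)] at this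
    push_cast at this
    refine this.trans (le_of_eq ?_)
    rw [← Set.ncard_coe_finset]
    congr 2
    ext w; simp [hN, restr]
  obtain ⟨P, hP⟩ : ∃ P, P ∈ N := by
    by_contra hc
    push Not at hc
    apply hfg
    funext w
    have := hc w
    simpa [hN] using this
  set G : Hsub F q → Hsub F q → Fin m → Fˣ × Fˣ → Hsub F q := fun p p' i ω =>
    HermLift.sig q hq hcard ω.2 (HermLift.sig q hq hcard ω.1 (P i) p) p' with hG
  have two : ∀ ω : Fin m → Fˣ × Fˣ, δ ^ 2 * (q : ℝ) ^ 6 ≤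
      ∑ p : Hsub F q, ∑ p' : Hsub F q, if (fun i => G p p' i (ω i)) ∈ N then (1 : ℝ) else 0 := by
    intro ω
    have h1 := step P hP (fun i => (ω i).1)
    have h3 : ∀ p : Hsub F q,
        (if (fun i => HermLift.sig q hq hcard (ω i).1 (P i) p) ∈ N then δ * (q : ℝ) ^ 3 else 0) ≤
        ∑ p' : Hsub F q, if (fun i => G p p' i (ω i)) ∈ N then (1 : ℝ) else 0 := by
      intro p
      split_ifs with hp
      · refine (step _ hp (fun i => (ω i).2)).trans (le_of_eq ?_)
        rw [Finset.sum_boole]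
      · apply Finset.sum_nonneg
        intros; split_ifs <;> norm_num
    refine le_trans ?_ (Finset.sum_le_sum fun p _ => h3 p)
    rw [← Finset.sum_filter, Finset.sum_const, nsmul_eq_mul]
    calc δ ^ 2 * (q : ℝ) ^ 6 = (δ * (q : ℝ) ^ 3) * (δ * (q : ℝ) ^ 3) := by ring
      _ ≤ _ := mul_le_mul_of_nonneg_right h1 (by positivity)
  set M : ℝ := (Fintype.card (Fˣ × Fˣ) : ℝ) ^ m with hM
  set L : ℝ := (q : ℝ) ^ 4 - q ^ 3 - q ^ 2 with hL
  set B : ℝ := N.card * (q : ℝ) ^ m + M - L ^ m with hB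
  have hq2 : (2 : ℝ) ≤ q := by exact_mod_cast h2
  have hL0 : 0 ≤ L := by
    have : L = q ^ 2 * ((q : ℝ) * (q - 1) - 1) := by rw [hL]; ring
    rw [this]
    have : (0 : ℝ) ≤ (q : ℝ) * (q - 1) - 1 := by nlinarith
    positivity
  have hcΩ : (Fintype.card (Fˣ × Fˣ) : ℝ) = ((q : ℝ) ^ 2 - 1) ^ 2 := by
    rw [Fintype.card_prod, Fintype.card_units, hcard]
    push_cast
    rw [Nat.cast_sub (Nat.one_le_pow _ _ (by omega))]
    push_cast; ring
  have hM0 : 0 ≤ M := by positivity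
  have hMq : M ≤ ((q : ℝ) ^ 4) ^ m := by
    rw [hM, hcΩ]
    apply pow_le_pow_left₀ (by positivity)
    nlinarith
  have hLM : L ^ m ≤ M := by
    rw [hM, hcΩ]
    apply pow_le_pow_left₀ hL0
    rw [hL]
    have : (q : ℝ) ^ 2 * 2 ≤ q ^ 3 := by nlinarith [sq_nonneg (q : ℝ)]
    nlinarith
  have hB0 : 0 ≤ B := by
    have : (0 : ℝ) ≤ N.card * (q : ℝ) ^ m := by positivity
    linarith
  set c : Hsub F q → Hsub F q → ℝ := fun p p' =>
    ((Finset.univ.filter fun ω : Fin m → Fˣ × Fˣ => (fun i => G p p' i (ω i)) ∈ N).card : ℝ) with hc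
  have hcle : ∀ p p', c p p' ≤ B + (if p.1.1 = 0 then M else 0) + (if p'.1.1 = 0 then M else 0) := by
    intro p p'
    have htriv : c p p' ≤ M := by
      have : (Finset.univ.filter fun ω : Fin m → Fˣ × Fˣ => (fun i => G p p' i (ω i)) ∈ N).card ≤
        Fintype.card (Fˣ × Fˣ) ^ m := by
        refine (Finset.card_le_univ _).trans (le_of_eq ?_)
        rw [Fintype.card_fun, Fintype.card_fin]
      rw [hM, hc, ← Nat.cast_pow]
      exact Nat.cast_le.2 this
    by_cases hp : p.1.1 = 0
    · rw [if_pos hp]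
      split_ifs <;> linarith
    · by_cases hp' : p'.1.1 = 0
      · rw [if_pos hp', if_neg hp]; linarith
      · rw [if_neg hp, if_neg hp', add_zero, add_zero]
        exact HermLift.prod_compare (G p p') N q L hL0
          (fun i => HermLift.excess q hq hcard (P i) p p' hp hp')
  have hzero : ∑ p : Hsub F q, (if p.1.1 = 0 then M else 0) = q * M := by
    rw [← Finset.sum_filter, Finset.sum_const, HermLift.fiberx q hq hcard, nsmul_eq_mul]
  have hsum : M * (δ ^ 2 * (q : ℝ) ^ 6) ≤ ∑ p, ∑ p', c p p' := by
    have h1 : ∑ ω : Fin m → Fˣ × Fˣ, δ ^ 2 * (q : ℝ) ^ 6 ≤ _ :=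
      Finset.sum_le_sum fun ω _ => two ω
    rw [Finset.sum_const, Finset.card_univ, Fintype.card_fun, Fintype.card_fin, nsmul_eq_mul] at h1
    push_cast at h1
    refine h1.trans (le_of_eq ?_)
    rw [Finset.sum_comm]
    apply Finset.sum_congr rfl
    intro p _
    rw [Finset.sum_comm]
    apply Finset.sum_congr rfl
    intro p' _
    rw [Finset.sum_boole]
  have hsum2 : ∑ p, ∑ p', c p p' ≤ q ^ 6 * B + 2 * q ^ 4 * M := by
    refine (Finset.sum_le_sum fun p _ => Finset.sum_le_sum fun p' _ => hcle p p').trans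
      (le_of_eq ?_)
    simp only [Finset.sum_add_distrib, hzero, Finset.sum_const, Finset.card_univ, hH, nsmul_eq_mul,
      ← Finset.mul_sum]
    push_cast; ring
  have hfin : M * (δ ^ 2 - 1 - 2 / q ^ 2) ≤ N.card * (q : ℝ) ^ m - L ^ m := by
    have h1 := hsum.trans hsum2
    have h3 : (q : ℝ) ^ 6 * (M * (δ ^ 2 - 1 - 2 / q ^ 2)) ≤
        (q : ℝ) ^ 6 * (N.card * (q : ℝ) ^ m - L ^ m) := by
      have : (q : ℝ) ^ 6 * (M * (δ ^ 2 - 1 - 2 / q ^ 2)) =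
        M * (δ ^ 2 * (q : ℝ) ^ 6) - q ^ 6 * M - 2 * q ^ 4 * M := by field_simp
      rw [this]
      rw [hB] at h1
      linarith
    exact le_of_mul_le_mul_left h3 (by positivity)
  have hneg : δ ^ 2 - 1 - 2 / (q : ℝ) ^ 2 ≤ 0 := by
    have : 0 ≤ 2 / (q : ℝ) ^ 2 := by positivity
    nlinarith
  have hfin2 : ((q : ℝ) ^ 4) ^ m * (δ ^ 2 - 1 - 2 / q ^ 2) ≤ N.card * (q : ℝ) ^ m - L ^ m :=
    (mul_le_mul_of_nonpos_right hMq hneg).trans hfin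
  have hLeq : L ^ m = ((q : ℝ) ^ 4) ^ m * (1 + (- (1 / q + 1 / q ^ 2))) ^ m := by
    rw [← mul_pow]
    congr 1
    rw [hL]; field_simp; ring
  have hbern : 1 + (m : ℝ) * (- (1 / q + 1 / (q : ℝ) ^ 2)) ≤ (1 + (- (1 / q + 1 / (q : ℝ) ^ 2))) ^ m := by
    apply one_add_mul_le_pow
    have h1 : 1 / (q : ℝ) ≤ 1 := by rw [div_le_one hq0]; linarith
    have h3 : 1 / (q : ℝ) ^ 2 ≤ 1 := by rw [div_le_one (by positivity)]; nlinarith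
    linarith
  have hqm : (N.card : ℝ) * (q : ℝ) ^ m = ((q : ℝ) ^ 4) ^ m * relDist f g := by
    rw [hrel]
    have : ((q : ℝ) ^ 4) ^ m = ((q : ℝ) ^ 3) ^ m * q ^ m := by rw [← mul_pow]; ring
    rw [this]; field_simp
  rw [hqm, hLeq, ← mul_sub] at hfin2
  have h9 := le_of_mul_le_mul_left hfin2 (by positivity)
  have hm : (m : ℝ) + 2 ≤ q := by exact_mod_cast hmq
  have h10 : ((m : ℝ) + 2) / q ^ 2 ≤ 1 / q := by
    rw [div_le_div_iff₀ (by positivity) hq0, one_mul, sq]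
    exact mul_le_mul_of_nonneg_right hm hq0.le
  have h11 : ((m : ℝ) + 1) / q = m * (1 / q) + 1 / q := by ring
  have h12 : ((m : ℝ) + 2) / q ^ 2 = m * (1 / q ^ 2) + 2 / q ^ 2 := by ring
  linarith
end

section
/- Let m ≥ 1, let ℓ be a positive integer and q = 2^ℓ, let b = 2 + ⌈log₂ m⌉, let c be a positive integer with ℓ − c > ⌈log₂ m⌉, and let r = (1 − 2^{−c})q³. Then the F_{q²}-dimension of L = lift_{Φ_H}^m(Herm_q[r]) satisfies dim_{F_{q²}} L ≥ q^{3m}·(1 − (1 − 2^{−m(b+1)})^{⌊c/(b+1)⌋}); equivalently, the rate dim_{F_{q²}}(L)/q^{3m} of L is at least 1 − (1 − 2^{−m(b+1)})^{⌊c/(b+1)⌋}. -/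
theorem sum_pow_zero {F : Type*} [Field F] (n : ℕ) (S : Finset F) (hS : n ≤ S.card)
    (a : Fin n → F) (h : ∀ s ∈ S, ∑ j, a j * s ^ (j : ℕ) = 0) : a = 0 := by
  obtain ⟨S', hS', hc⟩ := Finset.exists_subset_card_eq hS
  let e := S'.equivFinOfCardEq hc
  apply Matrix.eq_zero_of_forall_index_sum_pow_mul_eq_zero (f := fun i => ((e.symm i : S') : F))
  · intro i j hij
    exact e.symm.injective (Subtype.ext hij)
  · intro j
    rw [← h _ (hS' (e.symm j).2)]
    exact Finset.sum_congr rfl fun i _ => mul_comm _ _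

theorem card_pow_root {F : Type*} [Field F] [Fintype F] [DecidableEq F] (q : ℕ) (hq : 2 ≤ q) (s n : F) :
    (Finset.univ.filter fun y : F => y ^ q + s * y = n).card ≤ q := by
  classical
  let p : Polynomial F := Polynomial.X ^ q + (Polynomial.C s * Polynomial.X - Polynomial.C n)
  have hd : (Polynomial.C s * Polynomial.X - Polynomial.C n : Polynomial F).degree < q := by
    refine lt_of_le_of_lt (b := ((1 : ℕ) : WithBot ℕ)) ?_ (by exact_mod_cast hq)
    rw [← Polynomial.natDegree_le_iff_degree_le]
    compute_degree
  have hdeg : p.natDegree = q := by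
    have h2 : p.degree = q := by
      rw [← Polynomial.degree_X_pow (R := F) q] at hd
      rw [Polynomial.degree_add_eq_left_of_degree_lt hd, Polynomial.degree_X_pow]
    exact Polynomial.natDegree_eq_of_degree_eq_some h2
  have hp0 : p ≠ 0 := fun h => by rw [h] at hdeg; simp at hdeg; omega
  calc _ ≤ p.roots.toFinset.card := by
        apply Finset.card_le_card
        intro y hy
        simp only [Finset.mem_filter, Finset.mem_univ, true_and] at hy
        rw [Multiset.mem_toFinset, Polynomial.mem_roots hp0]
        simp only [p, Polynomial.IsRoot, Polynomial.eval_add, Polynomial.eval_sub, Polynomial.eval_mul,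
          Polynomial.eval_pow, Polynomial.eval_X, Polynomial.eval_C]
        rw [← hy]; ring
    _ ≤ Multiset.card p.roots := p.roots.toFinset_card_le
    _ ≤ p.natDegree := p.card_roots'
    _ = q := hdeg

theorem fiber_card {F : Type*} [Field F] [Fintype F] [DecidableEq F] (q : ℕ) (hq : 2 ≤ q)
    (hadd : ∀ x y : F, (x + y) ^ q = x ^ q + y ^ q)
    (hcard : Fintype.card F = q ^ 2) (x : F) :
    q ≤ (Finset.univ.filter fun y : F => x ^ (q + 1) = y + y ^ q).card := by
  have hpc : ∀ z : F, (z ^ q) ^ q = z := by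
    intro z
    rw [← pow_mul, ← pow_two, ← hcard, FiniteField.pow_card]
  set Fix := Finset.univ.filter fun z : F => z ^ q + (-1) * z = 0 with hFix
  have hF : Fix.card ≤ q := card_pow_root q hq (-1) 0
  let T : F → F := fun y => y ^ q + 1 * y
  have hmap : ∀ y ∈ (Finset.univ : Finset F), T y ∈ Fix := by
    intro y _
    simp only [hFix, Finset.mem_filter, Finset.mem_univ, true_and, T]
    rw [one_mul, hadd, hpc]; ring
  have hsum := Finset.card_eq_sum_card_fiberwise hmap
  rw [Finset.card_univ, hcard] at hsum
  have hx : x ^ (q + 1) ∈ Fix := by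
    simp only [hFix, Finset.mem_filter, Finset.mem_univ, true_and]
    rw [pow_succ, mul_pow, hpc]; ring
  by_contra hlt
  push Not at hlt
  have h1 : ∑ b ∈ Fix, (Finset.univ.filter fun y => T y = b).card < ∑ b ∈ Fix, q := by
    apply Finset.sum_lt_sum
    · intro b _
      exact card_pow_root q hq 1 b
    · refine ⟨_, hx, lt_of_le_of_lt (le_of_eq ?_) hlt⟩
      congr 1
      ext y
      simp only [Finset.mem_filter, Finset.mem_univ, true_and, T]
      rw [one_mul, add_comm, eq_comm]
  rw [Finset.sum_const, smul_eq_mul] at h1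
  have : Fix.card * q ≤ q * q := Nat.mul_le_mul_right _ hF
  nlinarith

theorem li_one {F : Type*} [Field F] [Fintype F] [DecidableEq F] (q : ℕ) (hq : 2 ≤ q)
    (hadd : ∀ x y : F, (x + y) ^ q = x ^ q + y ^ q)
    (hcard : Fintype.card F = q ^ 2) :
    LinearIndependent F (fun (e : Fin (q ^ 2) × Fin q) (p : Hsub F q) =>
      p.1.1 ^ (e.1 : ℕ) * p.1.2 ^ (e.2 : ℕ)) := by
  rw [Fintype.linearIndependent_iff]
  intro g hg
  have h1 : ∀ x : F, (fun j : Fin q => ∑ i : Fin (q ^ 2), g (i, j) * x ^ (i : ℕ)) = 0 := by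
    intro x
    apply sum_pow_zero q _ (fiber_card q hq hadd hcard x)
    intro y hy
    simp only [Finset.mem_filter, Finset.mem_univ, true_and] at hy
    have := congrFun hg ⟨(x, y), hy⟩
    simp only [Finset.sum_apply, Pi.smul_apply, smul_eq_mul, Pi.zero_apply] at this
    rw [Fintype.sum_prod_type_right] at this
    rw [← this]
    refine Finset.sum_congr rfl fun j _ => ?_
    rw [Finset.sum_mul]
    exact Finset.sum_congr rfl fun i _ => by ring
  rintro ⟨i, j⟩
  have := sum_pow_zero (q ^ 2) (Finset.univ : Finset F) (by rw [Finset.card_univ, hcard])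
    (fun i => g (i, j)) (fun x _ => congrFun (h1 x) j)
  exact congrFun this i

theorem li_prod {F D A : Type*} [Field F] [Fintype D] [DecidableEq D] [Fintype A] [DecidableEq A] (m : ℕ)
    (f : A → D → F) (hf : LinearIndependent F f) :
    LinearIndependent F (fun (e : Fin m → A) (p : Fin m → D) => ∏ k, f (e k) (p k)) := by
  obtain ⟨G, hG⟩ := LinearMap.exists_leftInverse_of_injective
    (Fintype.linearCombination F f) (by
      rw [LinearMap.ker_eq_bot]; exact linearIndependent_iff_injective_fintypeLinearCombination.1 hf)
  have hd : ∀ a b, ∑ p, f b p * G (Pi.single p 1) a = if b = a then 1 else 0 := by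
    intro a b
    have h1 : G (f b) = Pi.single b 1 := by
      have := LinearMap.congr_fun hG (Pi.single b 1)
      simpa using this
    have h2 := LinearMap.pi_apply_eq_sum_univ G (f b)
    rw [h1] at h2
    have h3 := congrFun h2 a
    simp only [Finset.sum_apply, Pi.smul_apply, smul_eq_mul, Pi.single_apply] at h3
    have h4 : (if b = a then (1 : F) else 0) = if a = b then 1 else 0 := by simp [eq_comm]
    rw [h4, h3]
    refine Finset.sum_congr rfl fun p _ => ?_
    have h5 : (Pi.single p 1 : D → F) = fun j => if p = j then 1 else 0 := by
      funext z
      simp [Pi.single_apply, eq_comm]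
    rw [h5]
  rw [Fintype.linearIndependent_iff]
  intro g hg a
  have key : ∀ b : Fin m → A, ∑ P : Fin m → D, (∏ k, f (b k) (P k)) * ∏ k, G (Pi.single (P k) 1) (a k)
      = if b = a then 1 else 0 := by
    intro b
    simp_rw [← Finset.prod_mul_distrib]
    rw [← Fintype.piFinset_univ, ← Finset.prod_univ_sum (fun _ => Finset.univ) (fun k p => f (b k) p * G (Pi.single p 1) (a k))]
    simp_rw [hd]
    by_cases h : b = a
    · simp [h]
    · rw [if_neg h]
      obtain ⟨k, hk⟩ := Function.ne_iff.1 h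
      exact Finset.prod_eq_zero (Finset.mem_univ k) (if_neg hk)
  have : ∑ P : Fin m → D, (∑ b, g b • (fun p : Fin m → D => ∏ k, f (b k) (p k))) P * ∏ k, G (Pi.single (P k) 1) (a k) = g a := by
    simp only [Finset.sum_apply, Pi.smul_apply, smul_eq_mul, Finset.sum_mul]
    rw [Finset.sum_comm]
    simp_rw [mul_assoc, ← Finset.mul_sum, key]
    simp
  rw [← this, hg]
  simp

/-- Filtered pieces. -/
def MF (F : Type*) [Field F] (q P N d : ℕ) : Submodule F (Hsub F q → F) :=
  Submodule.span F {f : Hsub F q → F |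
    ∃ h i j : ℕ, h ≤ N ∧ q * i + (q + 1) * j ≤ d ∧
      f = fun p => p.1.1 ^ (P * h + i) * p.1.2 ^ j}

theorem MF_mul {F : Type*} [Field F] {q P N d N' d' : ℕ} {f g : Hsub F q → F}
    (hf : f ∈ MF F q P N d) (hg : g ∈ MF F q P N' d') : f * g ∈ MF F q P (N + N') (d + d') := by
  have h := Submodule.mul_mem_mul hf hg
  unfold MF at h
  rw [Submodule.span_mul_span] at h
  refine Submodule.span_mono ?_ h
  rintro _ ⟨_, ⟨h, i, j, hh, hd, rfl⟩, _, ⟨h', i', j', hh', hd', rfl⟩, rfl⟩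
  refine ⟨h + h', i + i', j + j', by omega, by nlinarith, ?_⟩
  funext p
  simp only [Pi.mul_apply]
  ring

theorem MF_mono {F : Type*} [Field F] {q P N d N' d' : ℕ} (hN : N ≤ N') (hd : d ≤ d') :
    MF F q P N d ≤ MF F q P N' d' := by
  apply Submodule.span_mono
  rintro _ ⟨h, i, j, hh, hd, rfl⟩
  exact ⟨h, i, j, by omega, by omega, rfl⟩

theorem MF_one {F : Type*} [Field F] {q P : ℕ} : (1 : Hsub F q → F) ∈ MF F q P 0 0 := by
  apply Submodule.subset_span
  exact ⟨0, 0, 0, le_rfl, by simp, by funext p; simp⟩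

theorem MF_pow {F : Type*} [Field F] {q P N d : ℕ} {f : Hsub F q → F}
    (hf : f ∈ MF F q P N d) (n : ℕ) : f ^ n ∈ MF F q P (n * N) (n * d) := by
  induction n with
  | zero => simpa using MF_one
  | succ n ih =>
    rw [pow_succ, add_mul, add_mul, one_mul, one_mul]
    exact MF_mul ih hf

theorem MF_prod {F ι : Type*} [Field F] {q P : ℕ} (s : Finset ι) (N d : ι → ℕ) (f : ι → Hsub F q → F)
    (hf : ∀ k, f k ∈ MF F q P (N k) (d k)) :
    ∏ k ∈ s, f k ∈ MF F q P (∑ k ∈ s, N k) (∑ k ∈ s, d k) := by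
  classical
  induction s using Finset.induction_on with
  | empty => simpa using MF_one
  | insert a s ha ih =>
    rw [Finset.prod_insert ha, Finset.sum_insert ha, Finset.sum_insert ha]
    exact MF_mul (hf a) ih

theorem MF_gen {F : Type*} [Field F] {q P N d : ℕ} (h i j : ℕ) (hh : h ≤ N)
    (hd : q * i + (q + 1) * j ≤ d) :
    (fun p : Hsub F q => p.1.1 ^ (P * h + i) * p.1.2 ^ j) ∈ MF F q P N d :=
  Submodule.subset_span ⟨h, i, j, hh, hd, rfl⟩

theorem MF_const {F : Type*} [Field F] {q P N d : ℕ} (a : F) :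
    (fun _ : Hsub F q => a) ∈ MF F q P N d := by
  have := Submodule.smul_mem _ a (MF_mono (N' := N) (d' := d) (Nat.zero_le _) (Nat.zero_le _) (MF_one (F := F) (q := q) (P := P)))
  convert this using 1
  funext p; simp

theorem MF_lin {F : Type*} [Field F] {q P : ℕ} (a b : F) :
    (fun p : Hsub F q => a * p.1.1 + b) ∈ MF F q P 0 q := by
  have h1 := Submodule.smul_mem _ a (MF_gen (F := F) (q := q) (P := P) (N := 0) (d := q) 0 1 0 le_rfl (by simp))
  have := Submodule.add_mem _ h1 (MF_const b)
  convert this using 1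
  funext p; simp

theorem MF_linP {F : Type*} [Field F] {q P : ℕ} (a b : F) :
    (fun p : Hsub F q => a * p.1.1 ^ P + b) ∈ MF F q P 1 0 := by
  have h1 := Submodule.smul_mem _ a (MF_gen (F := F) (q := q) (P := P) (N := 1) (d := 0) 1 0 0 le_rfl (by simp))
  have := Submodule.add_mem _ h1 (MF_const b)
  convert this using 1
  funext p; simp

theorem MF_y {F : Type*} [Field F] {q P : ℕ} (a b c : F) :
    (fun p : Hsub F q => a * p.1.2 + b * p.1.1 + c) ∈ MF F q P 0 (q + 1) := by
  have h1 := Submodule.smul_mem _ a (MF_gen (F := F) (q := q) (P := P) (N := 0) (d := q + 1) 0 0 1 le_rfl (by simp))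
  have h2 := Submodule.smul_mem _ b (MF_gen (F := F) (q := q) (P := P) (N := 0) (d := q + 1) 0 1 0 le_rfl (by simp))
  have := Submodule.add_mem _ (Submodule.add_mem _ h1 h2) (MF_const c)
  convert this using 1
  funext p; simp

/-- Reduce the power of `y` without increasing the weight. -/
theorem reduce_y {F : Type*} [Field F] {q : ℕ} (hq : 2 ≤ q) (S : Submodule F (Hsub F q → F)) (h d : ℕ)
    (hS : ∀ i j : ℕ, j < q → q * i + (q + 1) * j ≤ d →
      (fun p : Hsub F q => p.1.1 ^ (h + i) * p.1.2 ^ j) ∈ S) (j : ℕ) :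
    ∀ i, q * i + (q + 1) * j ≤ d → (fun p : Hsub F q => p.1.1 ^ (h + i) * p.1.2 ^ j) ∈ S := by
  induction j using Nat.strong_induction_on with
  | _ j ih =>
    intro i hij
    rcases lt_or_ge j q with hj | hj
    · exact hS i j hj hij
    · obtain ⟨j, rfl⟩ := Nat.exists_eq_add_of_le hj
      have h1 := ih j (by omega) (i + (q + 1)) (by nlinarith)
      have h2 := ih (j + 1) (by omega) i (by nlinarith)
      convert Submodule.sub_mem _ h1 h2 using 1
      funext p
      have hp := p.2
      have hp' : p.1.2 ^ q = p.1.1 ^ (q + 1) - p.1.2 := by rw [hp]; ring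
      simp only [Pi.sub_apply]
      rw [pow_add p.1.2 q j, hp']
      ring

theorem MF_le_Herm {F : Type*} [Field F] {q P E N d r m : ℕ} (hq : 2 ≤ q)
    (hx : ∀ x : F, x ^ (q ^ 2) = x) (hPE : P * E = q ^ 2) (hE : 0 < E)
    (hN : N ≤ m * E) (hr : q * (P * (E - 1) + m) + d < r) :
    MF F q P N d ≤ HermCode F q r := by
  apply Submodule.span_le.2
  rintro _ ⟨h, i, j, hh, hd, rfl⟩
  refine reduce_y hq _ _ d ?_ j i hd
  intro i j hj hd
  apply Submodule.subset_span
  refine ⟨P * (h % E) + h / E + i, j, hj, ?_, ?_⟩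
  · have h1 : h % E ≤ E - 1 := by have := Nat.mod_lt h hE; omega
    have h2 : h / E ≤ m := by
      rw [Nat.div_le_iff_le_mul_add_pred hE]; nlinarith
    have h3 : P * (h % E) ≤ P * (E - 1) := Nat.mul_le_mul_left _ h1
    nlinarith [Nat.mul_le_mul_left q (Nat.add_le_add h3 h2)]
  · funext p
    congr 1
    have : P * h + i = q ^ 2 * (h / E) + (P * (h % E) + i) := by
      conv_lhs => rw [← Nat.div_add_mod h E]
      rw [← hPE]; ring
    rw [this, pow_add, pow_mul, hx]
    ring

theorem arith_bound {m ℓ c w cl : ℕ} (hm : m ≤ 2 ^ cl) (hm0 : 0 < m) (hlc : cl + c < ℓ) (hw : 2 * ℓ - c ≤ w)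
    (hW : w + (2 + cl) + 1 ≤ 2 * ℓ) :
    2 ^ ℓ * (2 ^ (w + (2 + cl) + 1) * (2 ^ (2 * ℓ - (w + (2 + cl) + 1)) - 1) + m)
      + m * ((2 ^ w - 1) * 2 ^ ℓ + (2 ^ ℓ - 1) * (2 ^ ℓ + 1)) < 2 ^ (3 * ℓ) - 2 ^ (3 * ℓ - c) := by
  have e1 : 2 ^ (3 * ℓ - c) ≤ 2 ^ ℓ * 2 ^ w := by
    rw [← pow_add]; exact Nat.pow_le_pow_right (by norm_num) (by omega)
  have e2 : 2 ^ ℓ ≤ 2 ^ w := Nat.pow_le_pow_right (by norm_num) (by omega)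
  have e3 : 2 ^ (w + (2 + cl) + 1) = 8 * (2 ^ cl * 2 ^ w) := by ring
  have e4 : 2 ^ (w + (2 + cl) + 1) * 2 ^ (2 * ℓ - (w + (2 + cl) + 1)) = 2 ^ ℓ * 2 ^ ℓ := by
    rw [← pow_add, ← pow_add]; congr 1; omega
  have e5 : 2 ^ (3 * ℓ) = 2 ^ ℓ * (2 ^ ℓ * 2 ^ ℓ) := by ring
  have e6 : 2 ^ (w + (2 + cl) + 1) ≤ 2 ^ ℓ * 2 ^ ℓ := by
    rw [← pow_add]; exact Nat.pow_le_pow_right (by norm_num) (by omega)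
  have e7 : 1 ≤ 2 ^ (2 * ℓ - (w + (2 + cl) + 1)) := Nat.one_le_two_pow
  have e8 : 1 ≤ 2 ^ w := Nat.one_le_two_pow
  have e9 : 1 ≤ 2 ^ ℓ := Nat.one_le_two_pow
  rw [Nat.mul_sub, e4, e5, mul_one]
  rw [e3] at e6 ⊢
  generalize 2 ^ (3 * ℓ - c) = R at *
  generalize 2 ^ w = w' at *
  generalize 2 ^ ℓ = q at *
  generalize 2 ^ cl = C at *
  have f1 : m * w' ≤ C * w' := Nat.mul_le_mul_right _ hm
  have f2 : w' ≤ m * w' := Nat.le_mul_of_pos_left _ hm0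
  have f3 : m * q ≤ m * w' := Nat.mul_le_mul_left _ e2
  have f4 : m ≤ m * w' := Nat.le_mul_of_pos_right _ e8
  have f5 : (w' - 1) * q ≤ w' * q := Nat.mul_le_mul_right _ (by omega)
  have f6 : (q - 1) * (q + 1) ≤ q * q := by
    obtain ⟨k, rfl⟩ := Nat.exists_eq_add_of_le e9
    simp; nlinarith
  have f7 : m * ((w' - 1) * q + (q - 1) * (q + 1)) ≤ m * (w' * q + q * q) :=
    Nat.mul_le_mul_left _ (by omega)
  obtain ⟨z, hz⟩ := Nat.exists_eq_add_of_le e6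
  rw [hz, Nat.add_sub_cancel_left]
  have f8 : z + m + m * w' + m * q + w' < 8 * (C * w') + z := by omega
  have f9 := Nat.mul_lt_mul_of_pos_left f8 (show 0 < q by omega)
  have f10 : m * (w' * q + q * q) = q * (m * w') + q * (m * q) := by ring
  have f11 : q * (z + m + m * w' + m * q + w') = q * (z + m) + q * (m * w') + q * (m * q) + q * w' := by ring
  omega

theorem restr_mem {F : Type*} [Field F] [CharP F 2] (m ℓ c q r cl w : ℕ) (hq : q = 2 ^ ℓ)
    (hx : ∀ x : F, x ^ (q ^ 2) = x)
    (hm : m ≤ 2 ^ cl) (hm0 : 0 < m) (hlc : cl + c < ℓ) (hw : 2 * ℓ - c ≤ w)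
    (hW : w + (2 + cl) + 1 ≤ 2 * ℓ)
    (hr : r = 2 ^ (3 * ℓ) - 2 ^ (3 * ℓ - c))
    (I J : Fin m → ℕ) (hI : ∀ k, I k < q ^ 2) (hJ : ∀ k, J k < q)
    (hz : ∀ k, I k / 2 ^ w % 2 ^ (2 + cl + 1) = 0) :
    (fun P : Fin m → Hsub F q => ∏ k, ((P k).1.1 ^ I k * (P k).1.2 ^ J k)) ∈
      liftCode (PhiHsub F q) m (HermCode F q r : Set (Hsub F q → F)) := by
  intro σ hσ
  choose a b' c' ha hbc hσ using hσ
  set P := 2 ^ (w + (2 + cl) + 1) with hP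
  set E := 2 ^ (2 * ℓ - (w + (2 + cl) + 1)) with hE
  have hPE : P * E = q ^ 2 := by
    rw [hP, hE, hq, ← pow_add, ← pow_mul]; congr 1; omega
  have hP0 : 0 < P := by positivity
  have hq2 : 2 ≤ q := by
    rw [hq]; calc 2 = 2 ^ 1 := rfl
      _ ≤ _ := Nat.pow_le_pow_right (by norm_num) (by omega)
  have hmod : ∀ k, I k % P < 2 ^ w := by
    intro k
    have h1 : P = 2 ^ w * 2 ^ (2 + cl + 1) := by rw [hP, ← pow_add]; congr 1
    rw [h1, Nat.mod_mul, hz k, mul_zero, add_zero]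
    exact Nat.mod_lt _ (by positivity)
  have hdiv : ∀ k, I k / P ≤ E := by
    intro k
    rw [Nat.div_le_iff_le_mul_add_pred hP0]
    have := hI k
    rw [← hPE] at this; omega
  have hk : ∀ k, (fun z : Hsub F q => (σ k z).1.1 ^ I k * (σ k z).1.2 ^ J k) ∈
      MF F q P E ((2 ^ w - 1) * 2 ^ ℓ + (2 ^ ℓ - 1) * (2 ^ ℓ + 1)) := by
    intro k
    have h1 := MF_pow (MF_linP (F := F) (q := q) (P := P) (a k ^ P) (b' k ^ P)) (I k / P)
    have h2 := MF_pow (MF_lin (F := F) (q := q) (P := P) (a k) (b' k)) (I k % P)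
    have h3 := MF_pow (MF_y (F := F) (q := q) (P := P) (a k ^ (q + 1)) (a k * b' k ^ q) (c' k)) (J k)
    have h4 := MF_mul (MF_mul h1 h2) h3
    have h5 : I k % P * q ≤ (2 ^ w - 1) * 2 ^ ℓ := by
      rw [← hq]; have := hmod k; exact Nat.mul_le_mul_right _ (by omega)
    have h6 : J k * (q + 1) ≤ (2 ^ ℓ - 1) * (2 ^ ℓ + 1) := by
      rw [← hq]; have := hJ k; exact Nat.mul_le_mul_right _ (by omega)
    have h7 := MF_mono (N' := E) (d' := (2 ^ w - 1) * 2 ^ ℓ + (2 ^ ℓ - 1) * (2 ^ ℓ + 1))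
      (by have := hdiv k; omega) (by omega) h4
    convert h7 using 1
    funext z
    rw [hσ k z]
    simp only [sigmaMap, Pi.mul_apply, Pi.pow_apply]
    congr 1
    conv_lhs => rw [← Nat.div_add_mod (I k) P, pow_add, pow_mul]
    congr 2
    rw [hP, add_pow_char_pow, mul_pow]
  have hprod := MF_prod Finset.univ _ _ _ hk
  have hle := MF_le_Herm (F := F) (m := m) (N := ∑ k : Fin m, E)
    (d := ∑ k : Fin m, ((2 ^ w - 1) * 2 ^ ℓ + (2 ^ ℓ - 1) * (2 ^ ℓ + 1))) (r := r) hq2 hx hPE (by positivity) (by simp) (by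
      rw [hr, hq, Finset.sum_const, Finset.card_univ, Fintype.card_fin, smul_eq_mul]
      exact arith_bound hm hm0 hlc hw hW)
  have := hle hprod
  have heq : restr (fun P : Fin m → Hsub F q => ∏ k, ((P k).1.1 ^ I k * (P k).1.2 ^ J k)) σ =
      ∏ k, fun z : Hsub F q => (σ k z).1.1 ^ I k * (σ k z).1.2 ^ J k := by
    funext z
    simp [restr, Finset.prod_apply]
  rw [heq]
  exact this

theorem good_card (m T D K q : ℕ) [NeZero D] :
    ((((Fintype.piFinset fun _ : Fin T => (Finset.univ : Finset (Fin m → Fin D)).erase 0) ×ˢ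
      (Finset.univ : Finset ((Fin m → Fin K) × (Fin m → Fin q))))ᶜ.card : ℕ) : ℝ) =
      (K ^ m * q ^ m : ℝ) * ((D ^ m) ^ T - (D ^ m - 1) ^ T) := by
  have h1 : 1 ≤ D ^ m := Nat.one_le_pow _ _ (NeZero.pos D)
  rw [Finset.card_compl, Nat.cast_sub (Finset.card_le_univ _)]
  simp only [Fintype.card_prod, Fintype.card_fun, Fintype.card_fin, Finset.card_product,
    Fintype.card_piFinset, Finset.card_erase_of_mem (Finset.mem_univ _), Finset.card_univ,
    Finset.prod_const]
  push_cast [Nat.cast_sub h1]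
  ring

/-- Rate of the lifted Hermitian code: with `q = 2^ℓ`, `b = 2 + ⌈log₂ m⌉`,
`ℓ − c > ⌈log₂ m⌉`, and `r = (1 − 2^(−c))·q³`, the lift `L = lift_{Φ_H}^m(Herm_q[r])` is
an `F`-linear subspace of the functions `H^m → F` of dimension at least
`q^(3m) · (1 − (1 − 2^(−m(b+1)))^⌊c/(b+1)⌋)` (equivalently, its rate is at least
`1 − (1 − 2^(−m(b+1)))^⌊c/(b+1)⌋`). -/
theorem lifted_hermitian_rate {F : Type*} [Field F] [Fintype F] [DecidableEq F]
    (m ℓ c q b r : ℕ) [NeZero m] (hl : 0 < ℓ) (hc : 0 < c)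
    (hq : q = 2 ^ ℓ) (hb : b = 2 + Nat.clog 2 m)
    (hlc : Nat.clog 2 m + c < ℓ)
    (hr : r = 2 ^ (3 * ℓ) - 2 ^ (3 * ℓ - c))
    (hcard : Fintype.card F = q ^ 2) :
    ∃ W : Submodule F ((Fin m → Hsub F q) → F),
      (W : Set ((Fin m → Hsub F q) → F))
          = liftCode (PhiHsub F q) m (HermCode F q r : Set (Hsub F q → F)) ∧
      (q : ℝ) ^ (3 * m) * (1 - (1 - ((2 : ℝ) ^ (m * (b + 1)))⁻¹) ^ (c / (b + 1)))
          ≤ (Module.finrank F W : ℝ) := by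
  have hm0 : 0 < m := NeZero.pos m
  have hm : m ≤ 2 ^ Nat.clog 2 m := Nat.le_pow_clog (by norm_num) m
  have hq2 : 2 ≤ q := by
    rw [hq]; calc 2 = 2 ^ 1 := rfl
      _ ≤ _ := Nat.pow_le_pow_right (by norm_num) (by omega)
  haveI : Fact (Nat.Prime 2) := ⟨Nat.prime_two⟩
  haveI : CharP F 2 := by
    apply charP_of_card_eq_prime_pow (f := ℓ * 2)
    rw [hcard, hq, ← pow_mul]
  have hadd : ∀ x y : F, (x + y) ^ q = x ^ q + y ^ q := by
    intro x y; rw [hq, add_pow_char_pow]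
  have hx : ∀ x : F, x ^ (q ^ 2) = x := by
    intro x; rw [← hcard, FiniteField.pow_card]
  let W : Submodule F ((Fin m → Hsub F q) → F) :=
    { carrier := liftCode (PhiHsub F q) m (HermCode F q r : Set (Hsub F q → F))
      add_mem' := fun {f g} hf hg σ hσ => (HermCode F q r).add_mem (hf σ hσ) (hg σ hσ)
      zero_mem' := fun σ hσ => (HermCode F q r).zero_mem
      smul_mem' := fun a f hf σ hσ => (HermCode F q r).smul_mem a (hf σ hσ) }
  refine ⟨W, rfl, ?_⟩
  set T := c / (b + 1) with hT
  have hTc : T * (b + 1) ≤ c := Nat.div_mul_le_self c (b + 1)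
  obtain ⟨κ, hκ⟩ : ∃ κ, κ + T * (b + 1) = 2 * ℓ := ⟨2 * ℓ - T * (b + 1), by omega⟩
  obtain ⟨D, hD⟩ : ∃ D, D = 2 ^ (b + 1) := ⟨_, rfl⟩
  obtain ⟨K, hK⟩ : ∃ K, K = 2 ^ κ := ⟨_, rfl⟩
  have hD0 : 0 < D := by rw [hD]; positivity
  have hK0 : 0 < K := by rw [hK]; positivity
  haveI : NeZero D := ⟨hD0.ne'⟩
  have hDK : D ^ T * K = q ^ 2 := by
    rw [hD, hK, hq, ← pow_mul, ← pow_add, ← pow_mul]; congr 1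
    rw [mul_comm ℓ 2, ← hκ]; ring
  let Ψ : (Fin T → Fin m → Fin D) × (Fin m → Fin K) × (Fin m → Fin q) →
      (Fin m → Fin (q ^ 2) × Fin q) := fun x k =>
    (finCongr hDK (finProdFinEquiv (finFunctionFinEquiv (fun t => x.1 t k), x.2.1 k)), x.2.2 k)
  have hΨ : Function.Injective Ψ := by
    rintro ⟨δ, u, j⟩ ⟨δ', u', j'⟩ h
    have h1 : ∀ k, (fun t => δ t k) = (fun t => δ' t k) ∧ u k = u' k ∧ j k = j' k := by
      intro k
      have h2 := congrFun h k
      simp only [Ψ, Prod.mk.injEq, EmbeddingLike.apply_eq_iff_eq] at h2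
      exact ⟨h2.1.1, h2.1.2, h2.2⟩
    have e1 : δ = δ' := by
      funext t k
      exact congrFun (h1 k).1 t
    have e2 : u = u' := funext fun k => (h1 k).2.1
    have e3 : j = j' := funext fun k => (h1 k).2.2
    rw [e1, e2, e3]
  let G := ((Fintype.piFinset fun _ : Fin T => (Finset.univ : Finset (Fin m → Fin D)).erase 0) ×ˢ
      (Finset.univ : Finset ((Fin m → Fin K) × (Fin m → Fin q))))ᶜ
  have hli := (li_prod m _ (li_one q hq2 hadd hcard)).comp (fun x : G => Ψ x.1)
    (hΨ.comp Subtype.val_injective)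
  have hmem : ∀ x : G, (fun P : Fin m → Hsub F q =>
      ∏ k, ((P k).1.1 ^ ((Ψ x.1 k).1 : ℕ) * (P k).1.2 ^ ((Ψ x.1 k).2 : ℕ))) ∈ W := by
    rintro ⟨⟨δ, u, j⟩, hG⟩
    simp only [G, Finset.mem_compl, Finset.mem_product, Fintype.mem_piFinset, Finset.mem_erase,
      Finset.mem_univ, and_true] at hG
    push Not at hG
    obtain ⟨t, ht⟩ := hG
    have htT : (t : ℕ) * (b + 1) + (b + 1) ≤ T * (b + 1) := by
      rw [← Nat.succ_mul]; exact Nat.mul_le_mul_right _ t.2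
    refine restr_mem m ℓ c q r (Nat.clog 2 m) (κ + t * (b + 1)) hq hx hm hm0 hlc (by omega) (by omega) hr
      _ _ (fun k => Fin.is_lt _) (fun k => Fin.is_lt _) ?_
    intro k
    have hv : ((Ψ (δ, u, j) k).1 : ℕ) = u k + K * (finFunctionFinEquiv (fun t => δ t k) : ℕ) := rfl
    have hdig : (finFunctionFinEquiv (fun t => δ t k) : ℕ) / D ^ (t : ℕ) % D = 0 := by
      have h1 := congrFun (finFunctionFinEquiv.symm_apply_apply (fun t => δ t k)) t
      have h2 := congrArg Fin.val h1
      rw [finFunctionFinEquiv_symm_apply_val] at h2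
      rw [h2]
      simp [ht]
    have hp : 2 ^ (κ + t * (b + 1)) = K * D ^ (t : ℕ) := by
      rw [hK, hD, pow_add, ← pow_mul, mul_comm (b + 1)]
    rw [← hb, ← hD, hp, hv, ← Nat.div_div_eq_div_mul, Nat.add_mul_div_left _ _ hK0,
      Nat.div_eq_of_lt (u k).2, zero_add]
    exact hdig
  have hliW : LinearIndependent F (fun x : G => (⟨_, hmem x⟩ : W)) :=
    LinearIndependent.of_comp W.subtype hli
  have hle := hliW.fintype_card_le_finrank
  rw [Fintype.card_coe] at hle
  have hle' : (G.card : ℝ) ≤ (Module.finrank F W : ℝ) := by exact_mod_cast hle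
  refine le_trans (le_of_eq ?_) hle'
  rw [good_card]
  have hDm : ((2 : ℝ) ^ (m * (b + 1))) = (D : ℝ) ^ m := by
    rw [hD]; push_cast; rw [← pow_mul, mul_comm]
  have hDR : (D : ℝ) ^ m ≠ 0 := by positivity
  have hDK' : (q : ℝ) ^ 2 = (D : ℝ) ^ T * K := by exact_mod_cast hDK.symm
  have hqm : (q : ℝ) ^ (3 * m) = ((D : ℝ) ^ m) ^ T * (K ^ m * q ^ m) := by
    rw [pow_mul, show (q : ℝ) ^ 3 = q ^ 2 * q by ring, hDK']; ring
  rw [hDm, hqm, show (1 : ℝ) - ((D : ℝ) ^ m)⁻¹ = ((D : ℝ) ^ m - 1) / (D : ℝ) ^ m by field_simp, div_pow]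
  field_simp
end

section
/- For every ε ∈ (0,1) and α ∈ (0,1) there exists τ > 0 such that for every N₀ there exist N ≥ N₀, a power of two q, and an integer m ≥ 1 with the following properties: N = q^{3m}; q² ≤ N^{ε/3}; q⁶ ≤ N^ε; and the lifted Hermitian code L = lift_{Φ_H}^m(Herm_q[r]) (for a suitable integer r of the form (1 − 2^{−c})q³) is an F_{q²}-linear code of block length N with dim_{F_{q²}}(L) ≥ (1−α)·N and relative distance δ(L) ≥ τ. -/
namespace LH

section algebraPart
variable {F A : Type*} [Field F] [CommRing A] [Algebra F A]

/-- All monomials lie in the span of the footprint. -/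
lemma footprint_span (q i0 j0 : ℕ) (hq2 : 2 ≤ q) (hj0 : j0 < q) (X Y : A)
    (hH : X ^ (q + 1) = Y + Y ^ q)
    (hrel : X ^ i0 * Y ^ j0 ∈ Submodule.span F
      {g : A | ∃ i j : ℕ, q * i + (q + 1) * j < q * i0 + (q + 1) * j0 ∧ g = X ^ i * Y ^ j})
    (S : Set A)
    (hS1 : ∀ i j, i < i0 → j0 ≤ j → j < q → X ^ i * Y ^ j ∈ S)
    (hS2 : ∀ i j, i < i0 + q + 1 → j < j0 → X ^ i * Y ^ j ∈ S) :
    ∀ w j i : ℕ, q * i + (q + 1) * j = w → X ^ i * Y ^ j ∈ Submodule.span F S := by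
  have hq : 0 < q := by omega
  have hmul : ∀ a b : ℕ, X ^ (i0 + a) * Y ^ (j0 + b) ∈ Submodule.span F
      {g : A | ∃ i j : ℕ, q * i + (q + 1) * j < q * (i0 + a) + (q + 1) * (j0 + b) ∧
        g = X ^ i * Y ^ j} := by
    intro a b
    have key : ∀ g ∈ Submodule.span F
      {g : A | ∃ i j : ℕ, q * i + (q + 1) * j < q * i0 + (q + 1) * j0 ∧ g = X ^ i * Y ^ j},
      g * (X ^ a * Y ^ b) ∈ Submodule.span F
      {g : A | ∃ i j : ℕ, q * i + (q + 1) * j < q * (i0 + a) + (q + 1) * (j0 + b) ∧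
        g = X ^ i * Y ^ j} := by
      intro g hg
      induction hg using Submodule.span_induction with
      | mem g hg =>
        obtain ⟨i, j, hlt, rfl⟩ := hg
        apply Submodule.subset_span
        refine ⟨i + a, j + b, by nlinarith, by ring⟩
      | zero => simp
      | add x y _ _ hx hy => rw [add_mul x y]; exact Submodule.add_mem _ hx hy
      | smul c x _ hx => rw [smul_mul_assoc]; exact Submodule.smul_mem _ _ hx
    have := key _ hrel
    convert this using 1
    ring
  intro w
  induction w using Nat.strong_induction_on with
  | _ w ihw =>
  have hlow : ∀ k, k ≤ w → ∀ g ∈ Submodule.span F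
      {g : A | ∃ i j : ℕ, q * i + (q + 1) * j < k ∧ g = X ^ i * Y ^ j},
      g ∈ Submodule.span F S := by
    intro k hk g hg
    refine (Submodule.span_le.2 ?_) hg
    rintro _ ⟨i, j, hlt, rfl⟩
    exact ihw _ (lt_of_lt_of_le hlt hk) j i rfl
  intro j
  induction j using Nat.strong_induction_on with
  | _ j ihj =>
  intro i hw
  by_cases hjq : q ≤ j
  · obtain ⟨j', rfl⟩ := Nat.exists_eq_add_of_le hjq
    have e : X ^ i * Y ^ (q + j') = X ^ (i + (q + 1)) * Y ^ j' - X ^ i * Y ^ (j' + 1) := by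
      have : X ^ (i + (q + 1)) = X ^ i * (Y + Y ^ q) := by rw [pow_add, hH]
      rw [this]; ring
    rw [e]
    refine Submodule.sub_mem _ (ihj j' (by omega) _ ?_) (ihw _ ?_ _ _ rfl)
    · rw [← hw]; ring
    · rw [← hw]; nlinarith
  push Not at hjq
  by_cases h1 : j0 ≤ j
  · by_cases h2 : i < i0
    · exact Submodule.subset_span (hS1 i j h2 h1 hjq)
    · push Not at h2
      obtain ⟨j', rfl⟩ := Nat.exists_eq_add_of_le h1
      obtain ⟨i', rfl⟩ := Nat.exists_eq_add_of_le h2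
      exact hlow _ hw.le _ (hmul i' j')
  · push Not at h1
    by_cases h2 : i < i0 + q + 1
    · exact Submodule.subset_span (hS2 i j h2 h1)
    · push Not at h2
      obtain ⟨i', rfl⟩ := Nat.exists_eq_add_of_le h2
      have e : X ^ (i0 + q + 1 + i') * Y ^ j
          = X ^ (i0 + i') * Y ^ (j + 1) + X ^ (i0 + i') * Y ^ (j0 + (j + q - j0)) := by
        have h3 : j0 + (j + q - j0) = j + q := by omega
        have : X ^ (i0 + q + 1 + i') = X ^ (i0 + i') * (Y + Y ^ q) := by
          rw [← hH]; ring
        rw [h3, this]; ring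
      rw [e]
      refine Submodule.add_mem _ (ihw _ ?_ _ _ rfl) (hlow _ ?_ _ (hmul i' (j + q - j0)))
      · rw [← hw]; nlinarith
      · have h3 : j0 + (j + q - j0) = j + q := by omega
        rw [h3, ← hw]; apply le_of_eq; ring

end algebraPart

/-- Monomials span all functions on a finite set of points. -/
lemma mono_span_top {F Z : Type*} [Field F] [Fintype F] [Finite Z] (X Y : Z → F)
    (hinj : ∀ z w, X z = X w → Y z = Y w → z = w) :
    Submodule.span F {g : Z → F | ∃ i j : ℕ, g = X ^ i * Y ^ j} = ⊤ := by
  classical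
  have := Fintype.ofFinite Z
  have h1 : Subalgebra.toSubmodule (Algebra.adjoin F {X, Y}) ≤
      Submodule.span F {g : Z → F | ∃ i j : ℕ, g = X ^ i * Y ^ j} := by
    rw [Algebra.adjoin_eq_span]
    apply Submodule.span_mono
    intro g hg
    rw [SetLike.mem_coe, Submonoid.mem_closure_pair] at hg
    obtain ⟨a, b, rfl⟩ := hg
    exact ⟨a, b, rfl⟩
  rw [eq_top_iff]
  refine le_trans ?_ h1
  have hX : X ∈ Algebra.adjoin F ({X, Y} : Set (Z → F)) := Algebra.subset_adjoin (by simp)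
  have hY : Y ∈ Algebra.adjoin F ({X, Y} : Set (Z → F)) := Algebra.subset_adjoin (by simp)
  have hsingle : ∀ z : Z, (Pi.single z (1 : F) : Z → F) ∈ Algebra.adjoin F ({X, Y} : Set (Z → F)) := by
    intro z
    have e : (Pi.single z (1 : F) : Z → F) =
        (1 - (X - algebraMap F (Z → F) (X z)) ^ (Fintype.card F - 1)) *
        (1 - (Y - algebraMap F (Z → F) (Y z)) ^ (Fintype.card F - 1)) := by
      have hc : Fintype.card F - 1 ≠ 0 := by
        have := Fintype.one_lt_card (α := F); omega
      funext w
      by_cases hw : w = z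
      · subst hw
        simp [hc]
      · rw [Pi.single_eq_of_ne hw]
        by_cases hx : X w = X z
        · have hy : Y w - Y z ≠ 0 := fun h => hw (hinj _ _ hx (sub_eq_zero.1 h))
          simp [FiniteField.pow_card_sub_one_eq_one _ hy]
        · have hx : X w - X z ≠ 0 := fun h => hx (sub_eq_zero.1 h)
          simp [FiniteField.pow_card_sub_one_eq_one _ hx]
    rw [e]
    refine mul_mem (sub_mem (one_mem _) (pow_mem (sub_mem hX (algebraMap_mem _ _)) _))
      (sub_mem (one_mem _) (pow_mem (sub_mem hY (algebraMap_mem _ _)) _))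
  intro g _
  have : g = ∑ z, g z • (Pi.single z (1 : F) : Z → F) := by
    funext w
    simp [Finset.sum_apply, Pi.single_apply]
  rw [this]
  exact Submodule.sum_mem _ fun z _ => Submodule.smul_mem _ _ (hsingle z)

section herm
variable {F : Type*} [Field F]

/-- coordinate functions -/
def cX (F : Type*) [Field F] (q : ℕ) : Hsub F q → F := fun p => p.1.1
def cY (F : Type*) [Field F] (q : ℕ) : Hsub F q → F := fun p => p.1.2

lemma cXY (q : ℕ) : cX F q ^ (q + 1) = cY F q + cY F q ^ q := by
  funext p; exact p.2

lemma herm_eq (q r : ℕ) : HermCode F q r = Submodule.span F {f : Hsub F q → F |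
    ∃ i j : ℕ, j < q ∧ q * i + (q + 1) * j < r ∧ f = cX F q ^ i * cY F q ^ j} := rfl

lemma wt_inj {q i j i' j' : ℕ} (hj : j < q) (hj' : j' < q)
    (h : q * i + (q + 1) * j = q * i' + (q + 1) * j') : i = i' ∧ j = j' := by
  have h1 : (q * (i + j) + j) % q = (q * (i' + j') + j') % q := by
    congr 1; nlinarith
  rw [Nat.mul_add_mod, Nat.mul_add_mod, Nat.mod_eq_of_lt hj, Nat.mod_eq_of_lt hj'] at h1
  subst h1
  refine ⟨?_, rfl⟩
  have : q * i = q * i' := by omega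
  exact Nat.eq_of_mul_eq_mul_left (by omega) this

/-- leading term -/
lemma exists_leading (q r : ℕ) (f : Hsub F q → F) (hf : f ∈ HermCode F q r) (hf0 : f ≠ 0) :
    ∃ i0 j0 : ℕ, j0 < q ∧ q * i0 + (q + 1) * j0 < r ∧ ∃ c : F, c ≠ 0 ∧
      ∃ g ∈ HermCode F q (q * i0 + (q + 1) * j0), f = c • (cX F q ^ i0 * cY F q ^ j0) + g := by
  induction r with
  | zero =>
    exfalso; apply hf0
    rw [herm_eq] at hf
    simpa using hf
  | succ k ih =>
    by_cases hk : ∃ i0 j0 : ℕ, j0 < q ∧ q * i0 + (q + 1) * j0 = k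
    · obtain ⟨i0, j0, hj0, hk⟩ := hk
      have : ∀ f ∈ HermCode F q (k + 1), ∃ c : F, ∃ g ∈ HermCode F q k,
          f = c • (cX F q ^ i0 * cY F q ^ j0) + g := by
        intro f hf
        rw [herm_eq] at hf
        induction hf using Submodule.span_induction with
        | mem x hx =>
          obtain ⟨i, j, hj, hlt, rfl⟩ := hx
          rcases Nat.lt_succ_iff_lt_or_eq.1 hlt with h | h
          · exact ⟨0, _, by rw [herm_eq]; exact Submodule.subset_span ⟨i, j, hj, h, rfl⟩, by simp⟩
          · obtain ⟨rfl, rfl⟩ := wt_inj hj hj0 (h.trans hk.symm)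
            exact ⟨1, 0, Submodule.zero_mem _, by simp⟩
        | zero => exact ⟨0, 0, Submodule.zero_mem _, by simp⟩
        | add x y _ _ hx hy =>
          obtain ⟨c, g, hg, rfl⟩ := hx
          obtain ⟨c', g', hg', rfl⟩ := hy
          exact ⟨c + c', g + g', Submodule.add_mem _ hg hg', by rw [add_smul]; abel⟩
        | smul a x _ hx =>
          obtain ⟨c, g, hg, rfl⟩ := hx
          exact ⟨a * c, a • g, Submodule.smul_mem _ _ hg, by rw [smul_add, mul_smul]⟩
      obtain ⟨c, g, hg, hfe⟩ := this f hf
      by_cases hc : c = 0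
      · have hfk : f ∈ HermCode F q k := by rw [hfe, hc]; simpa using hg
        obtain ⟨i0, j0, h1, h2, h3⟩ := ih hfk
        exact ⟨i0, j0, h1, by omega, h3⟩
      · exact ⟨i0, j0, hj0, by omega, c, hc, g, by rw [hk]; exact hg, hfe⟩
    · have hfk : f ∈ HermCode F q k := by
        rw [herm_eq] at hf ⊢
        refine (Submodule.span_mono ?_) hf
        rintro _ ⟨i, j, hj, hlt, rfl⟩
        refine ⟨i, j, hj, ?_, rfl⟩
        rcases Nat.lt_succ_iff_lt_or_eq.1 hlt with h | h
        · exact h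
        · exact absurd ⟨i, j, hj, h⟩ hk
      obtain ⟨i0, j0, h1, h2, h3⟩ := ih hfk
      exact ⟨i0, j0, h1, by omega, h3⟩

/-- a nonzero codeword has fewer than `r` zeros -/
lemma zeros_lt [Fintype F] (q r : ℕ) (hq2 : 2 ≤ q) (f : Hsub F q → F) (hf : f ∈ HermCode F q r)
    (hf0 : f ≠ 0) : Nat.card {p : Hsub F q // f p = 0} < r := by
  classical
  obtain ⟨i0, j0, hj0, hlt, c, hc, g, hg, hfe⟩ := exists_leading q r f hf hf0
  refine lt_of_le_of_lt ?_ hlt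
  set Z := {p : Hsub F q // f p = 0}
  have := Fintype.ofFinite Z
  let R : (Hsub F q → F) →ₗ[F] (Z → F) := LinearMap.funLeft F F (fun z : Z => z.1)
  let X : Z → F := fun z => z.1.1.1
  let Y : Z → F := fun z => z.1.1.2
  have hXY : X ^ (q + 1) = Y + Y ^ q := by funext z; exact z.1.2
  have hR : ∀ i j, R (cX F q ^ i * cY F q ^ j) = X ^ i * Y ^ j := fun i j => rfl
  have hRf : R f = 0 := by funext z; exact z.2
  have hgm : R g ∈ Submodule.span F
      {g : Z → F | ∃ i j : ℕ, q * i + (q + 1) * j < q * i0 + (q + 1) * j0 ∧ g = X ^ i * Y ^ j} := by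
    have : R g ∈ (HermCode F q (q * i0 + (q + 1) * j0)).map R := Submodule.mem_map_of_mem hg
    rw [herm_eq, Submodule.map_span] at this
    refine Submodule.span_mono ?_ this
    rintro _ ⟨_, ⟨i, j, hj, h, rfl⟩, rfl⟩
    exact ⟨i, j, h, hR i j⟩
  have hrel : X ^ i0 * Y ^ j0 ∈ Submodule.span F
      {g : Z → F | ∃ i j : ℕ, q * i + (q + 1) * j < q * i0 + (q + 1) * j0 ∧ g = X ^ i * Y ^ j} := by
    have : c • (X ^ i0 * Y ^ j0) = - R g := by
      have := congrArg R hfe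
      rw [hRf, map_add, map_smul, hR] at this
      exact eq_neg_of_add_eq_zero_left this.symm
    have h2 : X ^ i0 * Y ^ j0 = c⁻¹ • (- R g) := by
      rw [← this, smul_smul, inv_mul_cancel₀ hc, one_smul]
    rw [h2]
    exact Submodule.smul_mem _ _ (Submodule.neg_mem _ hgm)
  let S : Finset (ℕ × ℕ) := (Finset.range i0 ×ˢ Finset.Ico j0 q) ∪
    (Finset.range (i0 + q + 1) ×ˢ Finset.range j0)
  let SA : Finset (Z → F) := S.image (fun ij => X ^ ij.1 * Y ^ ij.2)
  have hspan := footprint_span q i0 j0 hq2 hj0 X Y hXY hrel (SA : Set (Z → F))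
    (fun i j h1 h2 h3 => by
      rw [Finset.mem_coe, Finset.mem_image]
      exact ⟨(i, j), by simp [S]; omega, rfl⟩)
    (fun i j h1 h2 => by
      rw [Finset.mem_coe, Finset.mem_image]
      exact ⟨(i, j), by simp [S]; omega, rfl⟩)
  have htop : Submodule.span F (SA : Set (Z → F)) = ⊤ := by
    rw [eq_top_iff, ← mono_span_top X Y (by
      intro z w h1 h2
      exact Subtype.ext (Subtype.ext (Prod.ext h1 h2)))]
    refine Submodule.span_le.2 ?_
    rintro _ ⟨i, j, rfl⟩
    exact hspan _ j i rfl
  have h1 := finrank_span_finset_le_card (R := F) SA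
  rw [Set.finrank, htop, finrank_top, Module.finrank_fintype_fun_eq_card] at h1
  rw [Nat.card_eq_fintype_card]
  refine h1.trans (Finset.card_image_le.trans ((Finset.card_union_le _ _).trans ?_))
  rw [Finset.card_product, Finset.card_product, Finset.card_range, Finset.card_range,
    Finset.card_range, Nat.card_Ico]
  obtain ⟨d, rfl⟩ := Nat.exists_eq_add_of_lt hj0
  have : j0 + d + 1 - j0 = d + 1 := by omega
  rw [this]
  apply le_of_eq; ring

end herm
section cardH
variable {F : Type*} [Field F] [Fintype F]

lemma frob_add [CharP F 2] (ℓ : ℕ) (x y : F) :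
    (x + y) ^ (2 ^ ℓ) = x ^ (2 ^ ℓ) + y ^ (2 ^ ℓ) := by
  have : Fact (Nat.Prime 2) := ⟨Nat.prime_two⟩
  exact add_pow_char_pow x y 2 ℓ

lemma pow_qq (q : ℕ) (hF : Fintype.card F = q ^ 2) (x : F) : x ^ (q * q) = x := by
  rw [← sq, ← hF, FiniteField.pow_card]

/-- few roots of `k1 a^(q+1) + k2 a^q + k3 a + k4` -/
lemma roots_few (q : ℕ) (hq : 2 ≤ q) (k1 k2 k3 k4 : F) (h : k1 ≠ 0) :
    ∃ s : Finset F, s.card ≤ q + 1 ∧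
      ∀ a, k1 * a ^ (q + 1) + k2 * a ^ q + k3 * a + k4 = 0 → a ∈ s := by
  classical
  open Polynomial in
  let P : F[X] := C k1 * X ^ (q + 1) + C k2 * X ^ q + C k3 * X + C k4
  have hP : P ≠ 0 := by
    intro h0
    have h1 := congrArg (fun p => p.coeff (q + 1)) h0
    simp [P, Polynomial.coeff_X, Polynomial.coeff_C, Polynomial.coeff_X_pow] at h1
    rw [if_neg (by omega)] at h1
    exact h (by simpa using h1)
  have hdeg : P.natDegree ≤ q + 1 := by
    have h0 : q ≤ q + 1 := by omega
    have h1 : 1 ≤ q + 1 := by omega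
    simp only [P]
    compute_degree
  refine ⟨P.roots.toFinset, (Multiset.toFinset_card_le _).trans
    ((Polynomial.card_roots' P).trans hdeg), ?_⟩
  intro a ha
  rw [Multiset.mem_toFinset, Polynomial.mem_roots hP]
  simpa [P, Polynomial.IsRoot] using ha

lemma roots_few' (q : ℕ) (hq : 2 ≤ q) (k : F) :
    Nat.card {y : F // y ^ q + k * y = 0} ≤ q := by
  classical
  open Polynomial in
  let P : F[X] := X ^ q + C k * X
  have hdeg : P.natDegree = q := by
    simp only [P]
    rw [Polynomial.natDegree_add_eq_left_of_natDegree_lt]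
    · simp
    · refine lt_of_le_of_lt (Polynomial.natDegree_C_mul_le k Polynomial.X) ?_
      rw [Polynomial.natDegree_X, Polynomial.natDegree_X_pow]; omega
  have hP : P ≠ 0 := by
    intro h0; rw [h0] at hdeg; simp at hdeg; omega
  rw [Nat.card_eq_fintype_card, Fintype.card_subtype]
  refine (Finset.card_le_card (t := P.roots.toFinset) ?_).trans
    ((Multiset.toFinset_card_le _).trans ((Polynomial.card_roots' P).trans hdeg.le))
  intro a ha
  rw [Multiset.mem_toFinset, Polynomial.mem_roots hP]
  simpa [P, Polynomial.IsRoot] using ha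

lemma card_H [CharP F 2] (ℓ q : ℕ) (hl : 0 < ℓ) (hq : q = 2 ^ ℓ) (hF : Fintype.card F = q ^ 2) :
    Nat.card (Hsub F q) = q ^ 3 := by
  classical
  have hq2 : 2 ≤ q := by
    rw [hq]; calc 2 = 2 ^ 1 := by norm_num
      _ ≤ 2 ^ ℓ := Nat.pow_le_pow_right (by norm_num) hl
  have h2 : ∀ x : F, x + x = 0 := fun x => CharTwo.add_self_eq_zero x
  let T : F →+ F :=
    { toFun := fun y => y + y ^ q
      map_zero' := by simp; omega
      map_add' := by
        intro x y
        have : (x + y) ^ q = x ^ q + y ^ q := by rw [hq]; exact frob_add ℓ x y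
        rw [this]; ring }
  have hT : ∀ y, T y = y + y ^ q := fun y => rfl
  have hker : Nat.card T.ker ≤ q := by
    refine le_trans (le_of_eq ?_) (roots_few' (F := F) q hq2 1)
    apply Nat.card_congr
    refine Equiv.subtypeEquivRight ?_
    intro y
    rw [AddMonoidHom.mem_ker, hT, one_mul, add_comm]
  have him : ∀ z ∈ T.range, z ^ q + 1 * z = 0 := by
    rintro _ ⟨y, rfl⟩
    rw [hT]
    have : (y + y ^ q) ^ q = y ^ q + (y ^ q) ^ q := by rw [hq]; exact frob_add ℓ _ _
    rw [this, ← pow_mul, pow_qq q hF]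
    linear_combination h2 y + h2 (y ^ q)
  have hranle : Nat.card T.range ≤ Nat.card {y : F // y ^ q + 1 * y = 0} :=
    Nat.card_le_card_of_injective (fun z => ⟨z.1, him z.1 z.2⟩)
      (fun a b h => Subtype.ext (by simpa using h))
  have hran : Nat.card T.range ≤ q := hranle.trans (roots_few' (F := F) q hq2 1)
  have hprod : Nat.card T.range * Nat.card T.ker = q ^ 2 := by
    have h1 := AddSubgroup.card_eq_card_quotient_mul_card_addSubgroup T.ker
    rw [Nat.card_congr (QuotientAddGroup.quotientKerEquivRange T).toEquiv,
      Nat.card_eq_fintype_card, hF] at h1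
    exact h1.symm
  have hk : Nat.card T.ker = q := by
    apply le_antisymm hker
    by_contra hcon
    push Not at hcon
    have : Nat.card T.range * Nat.card T.ker < q * q := by
      calc _ ≤ q * Nat.card T.ker := Nat.mul_le_mul_right _ hran
        _ < q * q := Nat.mul_lt_mul_of_pos_left hcon (by omega)
    rw [hprod, sq] at this
    exact lt_irrefl _ this
  have hr : Nat.card T.range = q := by
    rw [hk, sq] at hprod
    exact Nat.eq_of_mul_eq_mul_right (by omega) hprod
  have hrange : ∀ z : F, z ^ q = z → z ∈ T.range := by
    intro z hz
    let e : T.range → {y : F // y ^ q + 1 * y = 0} := fun z => ⟨z.1, him z.1 z.2⟩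
    have hinj : Function.Injective e := fun a b h => Subtype.ext (by simpa [e] using h)
    have hcard : Nat.card {y : F // y ^ q + 1 * y = 0} ≤ Nat.card T.range := by
      rw [hr]; exact roots_few' (F := F) q hq2 1
    have hb := (Nat.bijective_iff_injective_and_card e).2 ⟨hinj, le_antisymm hranle hcard⟩
    obtain ⟨w, hw⟩ := hb.2 ⟨z, by rw [hz, one_mul]; exact h2 z⟩
    have : w.1 = z := congrArg Subtype.val hw
    rw [← this]; exact w.2
  have hfib : ∀ x : F, ∃ y, y + y ^ q = x ^ (q + 1) := by
    intro x
    obtain ⟨y, hy⟩ := hrange (x ^ (q + 1)) (by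
      rw [← pow_mul, show (q + 1) * q = q * q + q by ring, pow_add, pow_qq q hF]; ring)
    exact ⟨y, hy⟩
  choose s hs using hfib
  have E : Hsub F q ≃ F × T.ker :=
    { toFun := fun p => (p.1.1, ⟨p.1.2 - s p.1.1, by
        rw [AddMonoidHom.mem_ker, map_sub, hT, hT, hs, ← p.2, sub_self]⟩)
      invFun := fun a => ⟨(a.1, s a.1 + a.2.1), by
        have h1 : T (s a.1 + a.2.1) = a.1 ^ (q + 1) := by
          rw [map_add, a.2.2, add_zero, hT, hs]
        rw [hT] at h1
        exact h1.symm⟩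
      left_inv := fun p => by
        apply Subtype.ext; apply Prod.ext <;> simp
      right_inv := fun a => by
        apply Prod.ext
        · rfl
        · apply Subtype.ext; simp }
  rw [Nat.card_congr E, Nat.card_prod, hk, Nat.card_eq_fintype_card, hF]
  ring

lemma cX_red (q : ℕ) (hF : Fintype.card F = q ^ 2) (t e : ℕ) :
    cX F q ^ (q * q * t + e) = cX F q ^ (t + e) := by
  have : cX F q ^ (q * q) = cX F q := by
    funext p; exact pow_qq q hF _
  rw [pow_add, pow_mul, this, ← pow_add]

lemma cY_red (q : ℕ) (hq2 : 2 ≤ q) (J : ℕ) : cY F q ^ J ∈ Submodule.span F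
    {g : Hsub F q → F | ∃ u j : ℕ, j < q ∧ j + q * u ≤ J ∧
      g = cX F q ^ ((q + 1) * u) * cY F q ^ j} := by
  induction J using Nat.strong_induction_on with
  | _ J ih =>
  by_cases hJ : J < q
  · exact Submodule.subset_span ⟨0, J, hJ, by simp, by simp⟩
  · push Not at hJ
    obtain ⟨J', rfl⟩ := Nat.exists_eq_add_of_le hJ
    have e : cY F q ^ (q + J') = cX F q ^ (q + 1) * cY F q ^ J' - cY F q ^ (J' + 1) := by
      rw [cXY]; ring
    rw [e]
    refine Submodule.sub_mem _ ?_ ?_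
    · have key : ∀ g ∈ Submodule.span F
        {g : Hsub F q → F | ∃ u j : ℕ, j < q ∧ j + q * u ≤ J' ∧
          g = cX F q ^ ((q + 1) * u) * cY F q ^ j}, cX F q ^ (q + 1) * g ∈ Submodule.span F
        {g : Hsub F q → F | ∃ u j : ℕ, j < q ∧ j + q * u ≤ q + J' ∧
          g = cX F q ^ ((q + 1) * u) * cY F q ^ j} := by
        intro g hg
        induction hg using Submodule.span_induction with
        | mem g hg =>
          obtain ⟨u, j, hj, hlt, rfl⟩ := hg
          apply Submodule.subset_span
          refine ⟨u + 1, j, hj, by nlinarith, by ring⟩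
        | zero => simp
        | add x y _ _ hx hy => rw [mul_add _ x y]; exact Submodule.add_mem _ hx hy
        | smul c x _ hx => rw [mul_smul_comm]; exact Submodule.smul_mem _ _ hx
      exact key _ (ih J' (by omega))
    · refine Submodule.span_mono ?_ (ih (J' + 1) (by omega))
      rintro _ ⟨u, j, hj, h, rfl⟩
      exact ⟨u, j, hj, by omega, rfl⟩

/-- one-variable basis -/
def mon1 (F : Type*) [Field F] (q : ℕ) (ij : Fin (q * q) × Fin q) : Hsub F q → F :=
  cX F q ^ (ij.1 : ℕ) * cY F q ^ (ij.2 : ℕ)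

lemma span_mon1 (q : ℕ) (hq2 : 2 ≤ q) (hF : Fintype.card F = q ^ 2) :
    Submodule.span F (Set.range (mon1 F q)) = ⊤ := by
  have hx : ∀ e j : ℕ, j < q → cX F q ^ e * cY F q ^ j ∈
      Submodule.span F (Set.range (mon1 F q)) := by
    intro e
    induction e using Nat.strong_induction_on with
    | _ e ih =>
    intro j hj
    by_cases he : e < q * q
    · exact Submodule.subset_span ⟨(⟨e, he⟩, ⟨j, hj⟩), rfl⟩
    · push Not at he
      obtain ⟨e', rfl⟩ := Nat.exists_eq_add_of_le he
      have := cX_red (F := F) q hF 1 e'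
      rw [mul_one] at this
      rw [this]
      exact ih _ (by nlinarith) j hj
  rw [eq_top_iff, ← mono_span_top (cX F q) (cY F q) (by
      intro z w h1 h2
      exact (Subtype.ext (Prod.ext h1 h2)))]
  refine Submodule.span_le.2 ?_
  rintro _ ⟨i, j, rfl⟩
  have key : ∀ g ∈ Submodule.span F
    {g : Hsub F q → F | ∃ u k : ℕ, k < q ∧ k + q * u ≤ j ∧
      g = cX F q ^ ((q + 1) * u) * cY F q ^ k}, cX F q ^ i * g ∈
        Submodule.span F (Set.range (mon1 F q)) := by
    intro g hg
    induction hg using Submodule.span_induction with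
    | mem g hg =>
      obtain ⟨u, j, hj, hlt, rfl⟩ := hg
      rw [← mul_assoc, ← pow_add]
      exact hx _ _ hj
    | zero => simp
    | add x y _ _ hx hy => rw [mul_add _ x y]; exact Submodule.add_mem _ hx hy
    | smul c x _ hx => rw [mul_smul_comm]; exact Submodule.smul_mem _ _ hx
  exact key _ (cY_red q hq2 j)

/-- multivariate monomials -/
def monM (F : Type*) [Field F] (q m : ℕ) (v : Fin m → Fin (q * q) × Fin q) :
    (Fin m → Hsub F q) → F :=
  fun p => ∏ k, mon1 F q (v k) (p k)

lemma span_monM (q m : ℕ) (hq2 : 2 ≤ q) (hF : Fintype.card F = q ^ 2) :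
    Submodule.span F (Set.range (monM F q m)) = ⊤ := by
  classical
  have hs : ∀ z : Hsub F q, ∃ c : Fin (q * q) × Fin q → F,
      ∑ ij, c ij • mon1 F q ij = Pi.single z (1 : F) := by
    intro z
    apply (Submodule.mem_span_range_iff_exists_fun F).1
    rw [span_mon1 q hq2 hF]; trivial
  choose c hc using hs
  rw [eq_top_iff]
  intro g _
  have hg : g = ∑ P, g P • (Pi.single P (1 : F) : (Fin m → Hsub F q) → F) := by
    funext w
    simp [Finset.sum_apply, Pi.single_apply]
  rw [hg]
  refine Submodule.sum_mem _ fun P _ => Submodule.smul_mem _ _ ?_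
  have hP : (Pi.single P (1 : F) : (Fin m → Hsub F q) → F) =
      ∑ v : Fin m → Fin (q * q) × Fin q, (∏ k, c (P k) (v k)) • monM F q m v := by
    funext w
    have h1 : (Pi.single P (1 : F) : (Fin m → Hsub F q) → F) w =
        ∏ k, (Pi.single (P k) (1 : F) : Hsub F q → F) (w k) := by
      by_cases hw : w = P
      · subst hw; simp
      · rw [Pi.single_eq_of_ne hw]
        obtain ⟨k, hk⟩ := Function.ne_iff.1 hw
        exact (Finset.prod_eq_zero (Finset.mem_univ k) (Pi.single_eq_of_ne hk _)).symm
    rw [h1]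
    have h2 : ∀ k, (Pi.single (P k) (1 : F) : Hsub F q → F) (w k) =
        ∑ ij, c (P k) ij * mon1 F q ij (w k) := by
      intro k
      rw [← hc (P k)]
      simp [Finset.sum_apply]
    rw [Finset.prod_congr rfl fun k _ => h2 k, Finset.prod_univ_sum]
    simp only [Fintype.piFinset_univ, Finset.sum_apply, Pi.smul_apply, smul_eq_mul, monM,
      Finset.prod_mul_distrib]
  rw [hP]
  exact Submodule.sum_mem _ fun v _ => Submodule.smul_mem _ _ (Submodule.subset_span ⟨v, rfl⟩)

end cardH
section restrict
variable {F : Type*} [Field F]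

/-- span of monomials with controlled exponents -/
def MS (F : Type*) [Field F] (q W H L n : ℕ) : Submodule F (Hsub F q → F) :=
  Submodule.span F {g | ∃ h e v : ℕ, h ≤ H ∧ e ≤ L ∧ v ≤ n ∧
    g = cX F q ^ (W * h + e) * cY F q ^ v}

lemma MS_mono {q W H L n H' L' n' : ℕ} (h1 : H ≤ H') (h2 : L ≤ L') (h3 : n ≤ n') :
    MS F q W H L n ≤ MS F q W H' L' n' := by
  apply Submodule.span_mono
  rintro _ ⟨h, e, v, a, b, c, rfl⟩
  exact ⟨h, e, v, a.trans h1, b.trans h2, c.trans h3, rfl⟩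

lemma MS_mul {q W H L n H' L' n' : ℕ} {f g : Hsub F q → F} (hf : f ∈ MS F q W H L n)
    (hg : g ∈ MS F q W H' L' n') : f * g ∈ MS F q W (H + H') (L + L') (n + n') := by
  have h := Submodule.mul_mem_mul hf hg
  rw [MS, MS, Submodule.span_mul_span] at h
  refine Submodule.span_mono ?_ h
  rintro _ ⟨_, ⟨h, e, v, a, b, c, rfl⟩, _, ⟨h', e', v', a', b', c', rfl⟩, rfl⟩
  refine ⟨h + h', e + e', v + v', by omega, by omega, by omega, ?_⟩
  simp only []
  ring

lemma MS_mon {q W H L n : ℕ} (h e v : ℕ) (a : h ≤ H) (b : e ≤ L) (c : v ≤ n) :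
    cX F q ^ (W * h + e) * cY F q ^ v ∈ MS F q W H L n :=
  Submodule.subset_span ⟨h, e, v, a, b, c, rfl⟩

lemma MS_one {q W H L n : ℕ} : (1 : Hsub F q → F) ∈ MS F q W H L n := by
  have := MS_mon (F := F) (q := q) (W := W) (H := H) (L := L) (n := n) 0 0 0
    (by omega) (by omega) (by omega)
  simpa using this

lemma MS_pow {q W H L n : ℕ} {f : Hsub F q → F} (hf : f ∈ MS F q W H L n) (k : ℕ) :
    f ^ k ∈ MS F q W (k * H) (k * L) (k * n) := by
  induction k with
  | zero => rw [pow_zero]; exact MS_one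
  | succ k ih =>
    rw [pow_succ, Nat.succ_mul, Nat.succ_mul, Nat.succ_mul]
    exact MS_mul ih hf

lemma MS_prod {q W H L n m : ℕ} (f : Fin m → Hsub F q → F) (hf : ∀ k, f k ∈ MS F q W H L n) :
    ∏ k, f k ∈ MS F q W (m * H) (m * L) (m * n) := by
  classical
  have : ∀ s : Finset (Fin m), ∏ k ∈ s, f k ∈ MS F q W (s.card * H) (s.card * L) (s.card * n) := by
    intro s
    induction s using Finset.induction_on with
    | empty => simpa using MS_one
    | insert a s ha ih =>
      rw [Finset.prod_insert ha, Finset.card_insert_of_notMem ha, mul_comm (f a),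
        Nat.succ_mul, Nat.succ_mul, Nat.succ_mul]
      exact MS_mul ih (hf a)
  simpa using this Finset.univ

lemma MS_lin {q w : ℕ} [CharP F 2] (a b : F) (h l : ℕ) :
    (a • cX F q + b • 1) ^ (2 ^ w * h + l) ∈ MS F q (2 ^ w) h l 0 := by
  have h1 : (a • cX F q + b • 1) ∈ MS F q (2 ^ w) 0 1 0 := by
    refine Submodule.add_mem _ (Submodule.smul_mem _ _ ?_) (Submodule.smul_mem _ _ MS_one)
    have := MS_mon (F := F) (q := q) (W := 2 ^ w) (H := 0) (L := 1) (n := 0) 0 1 0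
      (by omega) (by omega) (by omega)
    simpa using this
  have h2 : (a • cX F q + b • 1) ^ (2 ^ w) ∈ MS F q (2 ^ w) 1 0 0 := by
    have e : (a • cX F q + b • 1) ^ (2 ^ w) =
        (a ^ (2 ^ w)) • (cX F q ^ (2 ^ w)) + (b ^ (2 ^ w)) • (1 : Hsub F q → F) := by
      have : Fact (Nat.Prime 2) := ⟨Nat.prime_two⟩
      funext p
      simp only [Pi.pow_apply, Pi.add_apply, Pi.smul_apply, smul_eq_mul, Pi.one_apply, mul_one]
      rw [add_pow_char_pow _ _ 2 w, mul_pow]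
    rw [e]
    refine Submodule.add_mem _ (Submodule.smul_mem _ _ ?_) (Submodule.smul_mem _ _ MS_one)
    have := MS_mon (F := F) (q := q) (W := 2 ^ w) (H := 1) (L := 0) (n := 0) 1 0 0
      (by omega) (by omega) (by omega)
    simpa using this
  rw [pow_add, pow_mul]
  have := MS_mul (MS_pow h2 h) (MS_pow h1 l)
  simpa using this

lemma MS_lin2 {q W : ℕ} (a b c : F) (j : ℕ) :
    (a • cY F q + b • cX F q + c • 1) ^ j ∈ MS F q W 0 j j := by
  have h1 : (a • cY F q + b • cX F q + c • 1) ∈ MS F q W 0 1 1 := by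
    refine Submodule.add_mem _ (Submodule.add_mem _ (Submodule.smul_mem _ _ ?_)
      (Submodule.smul_mem _ _ ?_)) (Submodule.smul_mem _ _ MS_one)
    · have := MS_mon (F := F) (q := q) (W := W) (H := 0) (L := 1) (n := 1) 0 0 1
        (by omega) (by omega) (by omega)
      simpa using this
    · have := MS_mon (F := F) (q := q) (W := W) (H := 0) (L := 1) (n := 1) 0 1 0
        (by omega) (by omega) (by omega)
      simpa using this
  have := MS_pow h1 j
  simpa using this

/-- a monomial with a zero window `[p, w)` in every `x`-exponent lies in the lift -/
lemma restr_mem [CharP F 2] {q m w p r D : ℕ} (v : Fin m → Fin (q * q) × Fin q)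
    (hD : q * q = 2 ^ w * D)
    (hv : ∀ k, ((v k).1 : ℕ) % 2 ^ w < 2 ^ p)
    (hMS : MS F q (2 ^ w) (m * (D - 1)) (m * (2 ^ p + q)) (m * q) ≤ HermCode F q r)
    (σ : Fin m → Hsub F q → Hsub F q) (hσ : ∀ k, σ k ∈ PhiHsub F q) :
    restr (monM F q m v) σ ∈ HermCode F q r := by
  apply hMS
  have e : restr (monM F q m v) σ = ∏ k, (fun z => mon1 F q (v k) (σ k z)) := by
    funext z
    simp [restr, monM, Finset.prod_apply]
  rw [e]
  apply MS_prod
  intro k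
  obtain ⟨a, b, c, ha, hbc, h⟩ := hσ k
  set i : ℕ := ((v k).1 : ℕ) with hi
  set j : ℕ := ((v k).2 : ℕ) with hj
  have hjq : j < q := (v k).2.2
  have hiq : i < 2 ^ w * D := by rw [← hD]; exact (v k).1.2
  have e2 : (fun z => mon1 F q (v k) (σ k z)) = (a • cX F q + b • 1) ^ (2 ^ w * (i / 2 ^ w) + i % 2 ^ w)
      * ((a ^ (q + 1)) • cY F q + (a * b ^ q) • cX F q + c • 1) ^ j := by
    rw [Nat.div_add_mod]
    funext z
    simp only [mon1, Pi.mul_apply, Pi.pow_apply, Pi.add_apply, Pi.smul_apply, smul_eq_mul,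
      Pi.one_apply, mul_one, cX, cY, h z, sigmaMap]
    rfl
  rw [e2]
  refine MS_mono ?_ ?_ ?_ (MS_mul (MS_lin a b _ _) (MS_lin2 _ _ c j))
  · have : i / 2 ^ w < D := Nat.div_lt_of_lt_mul hiq
    omega
  · exact Nat.add_le_add (hv k).le hjq.le
  · omega

/-- the window span is contained in the Hermitian code -/
lemma MS_le [Fintype F] {ℓ q m w p r D : ℕ} (hq : q = 2 ^ ℓ) (hq2 : 2 ≤ q) (hm : 1 ≤ m)
    (hF : Fintype.card F = q ^ 2)
    (hD : q * q = 2 ^ w * D) (hD0 : 0 < D) (hpl : ℓ ≤ p) (hpw : 2 ^ p * (6 * m) ≤ 2 ^ w)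
    (hr : q * (q * q - 2 ^ p) + q * q ≤ r) :
    MS F q (2 ^ w) (m * (D - 1)) (m * (2 ^ p + q)) (m * q) ≤ HermCode F q r := by
  have hqp : q ≤ 2 ^ p := by rw [hq]; exact Nat.pow_le_pow_right (by norm_num) hpl
  refine Submodule.span_le.2 ?_
  rintro _ ⟨h, e, v, hh, he, hv, rfl⟩
  have key : ∀ g ∈ Submodule.span F
    {g : Hsub F q → F | ∃ u k : ℕ, k < q ∧ k + q * u ≤ v ∧
      g = cX F q ^ ((q + 1) * u) * cY F q ^ k}, cX F q ^ (2 ^ w * h + e) * g ∈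
        HermCode F q r := by
    intro g hg
    induction hg using Submodule.span_induction with
    | mem g hg =>
      obtain ⟨u, j, hj, hlt, rfl⟩ := hg
      rw [← mul_assoc, ← pow_add]
      have hu : u ≤ m := by
        have : q * u ≤ q * m := by nlinarith
        exact Nat.le_of_mul_le_mul_left this (by omega)
      have e1 : 2 ^ w * h + e + (q + 1) * u =
          q * q * (h / D) + (2 ^ w * (h % D) + e + (q + 1) * u) := by
        have := Nat.div_add_mod h D
        rw [hD]
        calc 2 ^ w * h + e + (q + 1) * u = 2 ^ w * (D * (h / D) + h % D) + e + (q + 1) * u := by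
              rw [this]
          _ = _ := by ring
      rw [e1, cX_red q hF, herm_eq]
      apply Submodule.subset_span
      refine ⟨_, j, hj, ?_, rfl⟩
      have ht : h / D ≤ m := by
        apply Nat.div_le_of_le_mul
        calc h ≤ m * (D - 1) := hh
          _ ≤ m * D := Nat.mul_le_mul_left _ (by omega)
          _ = D * m := by ring
      have hhD : h % D + 1 ≤ D := Nat.mod_lt _ hD0
      have h3 : 2 ^ w * (h % D) + 2 ^ w ≤ q * q := by
        rw [hD]; calc _ = 2 ^ w * (h % D + 1) := by ring
          _ ≤ _ := Nat.mul_le_mul_left _ hhD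
      have h4 : e + (q + 1) * u + h / D + 2 ^ p ≤ 2 ^ w := by
        have a1 : (q + 1) * u ≤ (q + 1) * m := Nat.mul_le_mul_left _ hu
        have a2 : m * q ≤ m * 2 ^ p := Nat.mul_le_mul_left _ hqp
        have a3 : m * 2 ≤ m * q := Nat.mul_le_mul_left _ hq2
        have a4 : 1 * 2 ^ p ≤ m * 2 ^ p := Nat.mul_le_mul_right _ hm
        nlinarith
      have h5 : h / D + (2 ^ w * (h % D) + e + (q + 1) * u) ≤ q * q - 2 ^ p := by
        omega
      have h6 : q * (h / D + (2 ^ w * (h % D) + e + (q + 1) * u)) ≤ q * (q * q - 2 ^ p) :=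
        Nat.mul_le_mul_left _ h5
      have h7 : (q + 1) * j + (q + 1) ≤ (q + 1) * q := by
        calc _ = (q + 1) * (j + 1) := by ring
          _ ≤ _ := Nat.mul_le_mul_left _ hj
      have h8 : (q + 1) * q = q * q + q := by ring
      omega
    | zero => simp
    | add x y _ _ hx hy => rw [mul_add _ x y]; exact Submodule.add_mem _ hx hy
    | smul c x _ hx => rw [mul_smul_comm]; exact Submodule.smul_mem _ _ hx
  exact key _ (cY_red q hq2 v)

end restrict

/-- number of tuples with no zero window -/
lemma bad_count (m B R S : ℕ) (hB : 0 < B) (hR : 0 < R) :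
    ((Fintype.piFinset (fun _ : Fin m => Finset.range (R * B ^ S))).filter
      (fun i => ∀ s < S, ∃ k, R * B ^ s ≤ i k % (R * B ^ (s + 1)))).card
      ≤ (B ^ m - 1) ^ S * R ^ m := by
  classical
  induction S with
  | zero => simp
  | succ S ih =>
    set T := ((Fintype.piFinset (fun _ : Fin m => Finset.range (R * B ^ S))).filter
      (fun i => ∀ s < S, ∃ k, R * B ^ s ≤ i k % (R * B ^ (s + 1)))) with hT
    let V : Finset (Fin m → ℕ) := (Fintype.piFinset (fun _ : Fin m => Finset.range B)).erase 0
    have hV : V.card = B ^ m - 1 := by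
      rw [Finset.card_erase_of_mem, Fintype.card_piFinset]
      · simp
      · simp [hB]
    have hpos : 0 < R * B ^ S := by positivity
    have : ((Fintype.piFinset (fun _ : Fin m => Finset.range (R * B ^ (S + 1)))).filter
      (fun i => ∀ s < S + 1, ∃ k, R * B ^ s ≤ i k % (R * B ^ (s + 1)))).card ≤ (V ×ˢ T).card := by
      apply Finset.card_le_card_of_injOn
        (fun i => (fun k => i k / (R * B ^ S), fun k => i k % (R * B ^ S)))
      · intro i hi
        simp only [Finset.coe_filter, Fintype.mem_piFinset, Finset.mem_range, Set.mem_ofPred_eq] at hi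
        obtain ⟨h1, h2⟩ := hi
        rw [Finset.mem_coe, Finset.mem_product]
        constructor
        · simp only [V, Finset.mem_erase, Fintype.mem_piFinset, Finset.mem_range]
          constructor
          · intro h0
            obtain ⟨k, hk⟩ := h2 S (by omega)
            rw [Nat.mod_eq_of_lt (h1 k)] at hk
            have := congrFun h0 k
            simp only [Pi.zero_apply] at this
            rw [Nat.div_eq_zero_iff] at this
            omega
          · intro k
            apply Nat.div_lt_of_lt_mul
            calc i k < _ := h1 k
              _ = _ := by ring
        · simp only [hT, Finset.mem_filter, Fintype.mem_piFinset, Finset.mem_range]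
          constructor
          · intro k; exact Nat.mod_lt _ hpos
          · intro s hs
            obtain ⟨k, hk⟩ := h2 s (by omega)
            refine ⟨k, ?_⟩
            rw [Nat.mod_mod_of_dvd]
            · exact hk
            · exact Nat.mul_dvd_mul_left _ (pow_dvd_pow _ hs)
      · intro i _ i' _ h
        rw [Prod.mk.injEq] at h
        funext k
        rw [← Nat.div_add_mod (i k) (R * B ^ S), ← Nat.div_add_mod (i' k) (R * B ^ S)]
        rw [show i k / _ = i' k / _ from congrFun h.1 k, show i k % _ = i' k % _ from congrFun h.2 k]
    refine this.trans ?_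
    rw [Finset.card_product, hV, pow_succ']
    calc _ ≤ (B ^ m - 1) * ((B ^ m - 1) ^ S * R ^ m) := Nat.mul_le_mul_left _ ih
      _ = _ := by ring
section liftdim
variable {F : Type*} [Field F]

/-- the lifted code as a submodule -/
def liftW (F : Type*) [Field F] (q m r : ℕ) : Submodule F ((Fin m → Hsub F q) → F) where
  carrier := liftCode (PhiHsub F q) m (HermCode F q r : Set (Hsub F q → F))
  add_mem' := by
    intro f g hf hg σ hσ
    exact Submodule.add_mem _ (hf σ hσ) (hg σ hσ)
  zero_mem' := by
    intro σ hσ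
    exact Submodule.zero_mem _
  smul_mem' := by
    intro c f hf σ hσ
    exact Submodule.smul_mem _ c (hf σ hσ)

lemma liftW_dim [Fintype F] [CharP F 2] {ℓ q m r ρ b S : ℕ} (hl : 0 < ℓ) (hq : q = 2 ^ ℓ)
    (hm : 1 ≤ m) (hF : Fintype.card F = q ^ 2)
    (h2l : 2 * ℓ = ρ + S * b) (hρ : ℓ ≤ ρ) (hb : 6 * m ≤ 2 ^ b)
    (hr : q * (q * q - 2 ^ ρ) + q * q ≤ r) :
    q ^ (3 * m) ≤ Module.finrank F (liftW F q m r) +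
      (((2 ^ b) ^ m - 1) ^ S * (2 ^ ρ) ^ m) * q ^ m := by
  classical
  have hq2 : 2 ≤ q := by
    rw [hq]; calc 2 = 2 ^ 1 := by norm_num
      _ ≤ 2 ^ ℓ := Nat.pow_le_pow_right (by norm_num) hl
  have hqq : q * q = 2 ^ ρ * (2 ^ b) ^ S := by
    rw [hq, ← pow_mul, ← pow_add, ← pow_add]
    congr 1
    rw [mul_comm b S]; omega
  let bad : (Fin m → Fin (q * q) × Fin q) → Prop := fun v =>
    ∀ s < S, ∃ k, 2 ^ ρ * (2 ^ b) ^ s ≤ ((v k).1 : ℕ) % (2 ^ ρ * (2 ^ b) ^ (s + 1))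
  let BS : Finset (Fin m → Fin (q * q) × Fin q) := Finset.univ.filter bad
  have hBS : BS.card ≤ (((2 ^ b) ^ m - 1) ^ S * (2 ^ ρ) ^ m) * q ^ m := by
    have h1 := bad_count m (2 ^ b) (2 ^ ρ) S (by positivity) (by positivity)
    set T := ((Fintype.piFinset (fun _ : Fin m => Finset.range (2 ^ ρ * (2 ^ b) ^ S))).filter
      (fun i => ∀ s < S, ∃ k, 2 ^ ρ * (2 ^ b) ^ s ≤ i k % (2 ^ ρ * (2 ^ b) ^ (s + 1)))) with hT
    have h2 : BS.card ≤ (T ×ˢ (Finset.univ : Finset (Fin m → Fin q))).card := by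
      apply Finset.card_le_card_of_injOn (fun v => (fun k => ((v k).1 : ℕ), fun k => (v k).2))
      · intro v hv
        have hv : bad v := by simpa [BS] using hv
        rw [Finset.mem_coe, Finset.mem_product]
        refine ⟨?_, Finset.mem_univ _⟩
        simp only [hT, Finset.mem_filter, Fintype.mem_piFinset, Finset.mem_range]
        refine ⟨?_, hv⟩
        intro k
        rw [← hqq]; exact (v k).1.2
      · intro v _ v' _ h
        rw [Prod.mk.injEq] at h
        funext k
        exact Prod.ext (Fin.ext (congrFun h.1 k)) (congrFun h.2 k)
    rw [Finset.card_product] at h2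
    refine h2.trans ?_
    have : (Finset.univ : Finset (Fin m → Fin q)).card = q ^ m := by simp
    rw [this]
    exact Nat.mul_le_mul_right _ h1
  have hgood : ∀ v, ¬ bad v → monM F q m v ∈ liftW F q m r := by
    intro v hv
    simp only [bad] at hv
    push Not at hv
    obtain ⟨s, hs, hk⟩ := hv
    have ep : 2 ^ ρ * (2 ^ b) ^ s = 2 ^ (ρ + b * s) := by rw [← pow_mul, ← pow_add]
    have ew : 2 ^ ρ * (2 ^ b) ^ (s + 1) = 2 ^ (ρ + b * (s + 1)) := by rw [← pow_mul, ← pow_add]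
    have hD : q * q = 2 ^ (ρ + b * (s + 1)) * (2 ^ b) ^ (S - (s + 1)) := by
      rw [← ew, mul_assoc, ← pow_add, hqq]
      congr 2; omega
    intro σ hσ
    refine restr_mem (w := ρ + b * (s + 1)) (p := ρ + b * s) (D := (2 ^ b) ^ (S - (s + 1))) v hD
      (by intro k; rw [← ew, ← ep]; exact hk k) ?_ σ hσ
    refine MS_le hq hq2 hm hF hD (by positivity) (by omega) ?_ ?_
    · calc 2 ^ (ρ + b * s) * (6 * m) ≤ 2 ^ (ρ + b * s) * 2 ^ b := Nat.mul_le_mul_left _ hb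
        _ = _ := by rw [← pow_add]; congr 1; ring
    · refine le_trans ?_ hr
      refine Nat.add_le_add_right (Nat.mul_le_mul_left _ (Nat.sub_le_sub_left ?_ _)) _
      exact Nat.pow_le_pow_right (by norm_num) (by omega)
  let U : Finset ((Fin m → Hsub F q) → F) := BS.image (monM F q m)
  have htop : liftW F q m r ⊔ Submodule.span F (U : Set ((Fin m → Hsub F q) → F)) = ⊤ := by
    rw [eq_top_iff, ← span_monM q m hq2 hF]
    refine Submodule.span_le.2 ?_
    rintro _ ⟨v, rfl⟩
    by_cases hv : bad v
    · refine Submodule.mem_sup_right (Submodule.subset_span ?_)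
      rw [Finset.mem_coe, Finset.mem_image]
      exact ⟨v, by simp [BS, hv], rfl⟩
    · exact Submodule.mem_sup_left (hgood v hv)
  have h1 := Submodule.finrank_add_le_finrank_add_finrank (liftW F q m r)
    (Submodule.span F (U : Set ((Fin m → Hsub F q) → F)))
  rw [htop, finrank_top, Module.finrank_fintype_fun_eq_card, ← Nat.card_eq_fintype_card,
    Nat.card_fun, card_H ℓ q hl hq hF, Nat.card_eq_fintype_card, Fintype.card_fin,
    ← pow_mul] at h1
  refine h1.trans (Nat.add_le_add_left ?_ _)
  exact (finrank_span_finset_le_card (R := F) U).trans (Finset.card_image_le.trans hBS)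

end liftdim

section distance
variable {F : Type*} [Field F]

/-- `σ_{a,P}` as a self map of the curve -/
lemma sig_mem [Fintype F] [CharP F 2] {ℓ q : ℕ} (hq : q = 2 ^ ℓ) (hF : Fintype.card F = q ^ 2)
    (a : F) (P p : Hsub F q) :
    (sigmaMap q a P.1.1 P.1.2 p.1).1 ^ (q + 1) =
      (sigmaMap q a P.1.1 P.1.2 p.1).2 + (sigmaMap q a P.1.1 P.1.2 p.1).2 ^ q := by
  obtain ⟨⟨B, C⟩, hP⟩ := P
  obtain ⟨⟨x, y⟩, hp⟩ := p
  simp only [sigmaMap] at *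
  have fr : ∀ u v : F, (u + v) ^ q = u ^ q + v ^ q := by intro u v; rw [hq]; exact frob_add ℓ u v
  have qq : ∀ u : F, (u ^ q) ^ q = u := by intro u; rw [← pow_mul]; exact pow_qq q hF u
  have e1 : (a * x + B) ^ (q + 1) = (a ^ q * x ^ q + B ^ q) * (a * x + B) := by
    rw [pow_succ, fr, mul_pow]
  have e2 : (a ^ (q + 1)) ^ q = a ^ (q + 1) := by
    rw [pow_succ, mul_pow, qq]; ring
  rw [e1, fr, fr, mul_pow, e2, mul_pow, mul_pow, qq]
  rw [pow_succ] at hP hp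
  rw [pow_succ]
  linear_combination (a ^ q * a) * hp + hP

/-- the map -/
def sig [Fintype F] [CharP F 2] {ℓ q : ℕ} (hq : q = 2 ^ ℓ) (hF : Fintype.card F = q ^ 2)
    (P : Hsub F q) (a : Fˣ) : Hsub F q → Hsub F q :=
  fun p => ⟨sigmaMap q a P.1.1 P.1.2 p.1, sig_mem hq hF a P p⟩

lemma sig_phi [Fintype F] [CharP F 2] {ℓ q : ℕ} (hq : q = 2 ^ ℓ) (hF : Fintype.card F = q ^ 2)
    (P : Hsub F q) (a : Fˣ) : sig hq hF P a ∈ PhiHsub F q :=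
  ⟨a, P.1.1, P.1.2, a.ne_zero, P.2, fun _ => rfl⟩

/-- fibre bound for one coordinate -/
lemma fibre1 [Fintype F] [CharP F 2] {ℓ q : ℕ} (hq : q = 2 ^ ℓ) (hq2 : 2 ≤ q)
    (hF : Fintype.card F = q ^ 2) (P p p' R : Hsub F q) (hx' : p'.1.1 ≠ 0)
    (hk : p'.1.2 / p'.1.1 ^ (q + 1) * p.1.1 ^ (q + 1) + p.1.1 ^ (q + 1) + p.1.2 ≠ 0) :
    ∃ s : Finset F, s.card ≤ q + 1 ∧ ∀ a b : Fˣ,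
      sig hq hF (sig hq hF P a p) b p' = R → (a : F) ∈ s := by
  obtain ⟨⟨P1, P2⟩, hP⟩ := P
  obtain ⟨⟨x, y⟩, hp⟩ := p
  obtain ⟨⟨x', y'⟩, hp'⟩ := p'
  obtain ⟨⟨u, v⟩, hR⟩ := R
  simp only at hx' hk
  set s0 := y' / x' ^ (q + 1) with hs0
  have fr : ∀ u v : F, (u + v) ^ q = u ^ q + v ^ q := by intro u v; rw [hq]; exact frob_add ℓ u v
  have h2 : ∀ x : F, x + x = 0 := fun x => CharTwo.add_self_eq_zero x
  obtain ⟨s, hs, hs'⟩ := roots_few q hq2 _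
    (s0 * (u + P1) * x ^ q + (u + P1) * x ^ q)
    (s0 * x * (u + P1) ^ q + x * P1 ^ q + P1 ^ q * x)
    (s0 * (u + P1) ^ (q + 1) + (u + P1) * P1 ^ q + P2 + v) hk
  refine ⟨s, hs, ?_⟩
  intro a b hab
  apply hs'
  have hab1 := congrArg (fun p => p.1.1) hab
  have hab2 := congrArg (fun p => p.1.2) hab
  simp only [sig, sigmaMap] at hab1 hab2
  have hbx : (b : F) * x' = (u + P1) + a * x := by
    linear_combination hab1 - h2 ((a : F) * x) - h2 P1
  have hby : (b : F) ^ (q + 1) * y' = s0 * ((u + P1) + a * x) ^ (q + 1) := by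
    rw [← hbx, hs0, mul_pow]; field_simp
  have e1 : ((u + P1) + a * x) ^ (q + 1) = ((u + P1) ^ q + (a : F) ^ q * x ^ q) * ((u + P1) + a * x) := by
    rw [pow_succ, fr, mul_pow]
  rw [hby, fr (a * x), mul_pow, e1] at hab2
  have e2 : (u + P1) ^ (q + 1) = (u + P1) ^ q * (u + P1) := pow_succ _ _
  rw [e2, pow_succ, pow_succ]
  rw [pow_succ] at hab2
  linear_combination hab2 + h2 v - ((a : F) ^ q * x ^ q + P1 ^ q) * (hbx)

end distance
section distance2
variable {F : Type*} [Field F] [Fintype F] [CharP F 2]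

open Classical in
/-- fibre bound, tuples -/
lemma fibreM {ℓ q m : ℕ} (hq : q = 2 ^ ℓ) (hq2 : 2 ≤ q)
    (hF : Fintype.card F = q ^ 2) (P : Fin m → Hsub F q) (p p' : Hsub F q) (hx' : p'.1.1 ≠ 0)
    (hk : p'.1.2 / p'.1.1 ^ (q + 1) * p.1.1 ^ (q + 1) + p.1.1 ^ (q + 1) + p.1.2 ≠ 0)
    (A : Finset (Fin m → Hsub F q)) :
    ((Finset.univ : Finset ((Fin m → Fˣ) × (Fin m → Fˣ))).filter (fun ab =>
      (fun k => sig hq hF (sig hq hF (P k) (ab.1 k) p) (ab.2 k) p') ∈ A)).card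
      ≤ (q + 1) ^ m * A.card := by
  refine Finset.card_le_mul_card_image_of_maps_to
    (f := fun ab : (Fin m → Fˣ) × (Fin m → Fˣ) =>
      (fun k => sig hq hF (sig hq hF (P k) (ab.1 k) p) (ab.2 k) p'))
    (fun ab hab => (Finset.mem_filter.1 hab).2) _ ?_
  intro R _
  choose s hs hs' using fun k => fibre1 hq hq2 hF (P k) p p' (R k) hx' hk
  have : (Fintype.piFinset s).card ≤ (q + 1) ^ m := by
    rw [Fintype.card_piFinset]
    calc ∏ k, (s k).card ≤ ∏ _k : Fin m, (q + 1) := Finset.prod_le_prod' fun k _ => hs k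
      _ = _ := by simp
  refine le_trans ?_ this
  apply Finset.card_le_card_of_injOn (fun ab k => ((ab.1 k : Fˣ) : F))
  · intro ab hab
    rw [Finset.mem_coe, Finset.mem_filter] at hab
    rw [Finset.mem_coe, Fintype.mem_piFinset]
    intro k
    exact hs' k (ab.1 k) (ab.2 k) (congrFun hab.2 k)
  · intro ab hab ab' hab' h
    rw [Finset.mem_coe, Finset.mem_filter] at hab hab'
    have h1 : ab.1 = ab'.1 := by
      funext k; exact Units.ext (congrFun h k)
    have h2 : ab.2 = ab'.2 := by
      funext k
      have e1 := congrArg (fun p => p.1.1) ((congrFun hab.2 k).trans (congrFun hab'.2 k).symm)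
      simp only [sig, sigmaMap, h1] at e1
      exact Units.ext (mul_right_cancel₀ hx' (add_right_cancel e1))
    exact Prod.ext h1 h2

open Classical in
/-- many good points outside an exceptional set -/
lemma many_good {ℓ q m r M : ℕ} (hl : 0 < ℓ) (hq : q = 2 ^ ℓ) (hq2 : 2 ≤ q)
    (hF : Fintype.card F = q ^ 2) (hM : r + M + 2 * q ^ 2 ≤ q ^ 3)
    (f : (Fin m → Hsub F q) → F) (hf : f ∈ liftW F q m r) (P : Fin m → Hsub F q) (hP : f P ≠ 0)
    (a : Fin m → Fˣ) (bad : Finset (Hsub F q)) (hbad : bad.card ≤ 2 * q ^ 2) :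
    M ≤ ((Finset.univ : Finset (Hsub F q)).filter (fun p => p ∉ bad ∧
      f (fun k => sig hq hF (P k) (a k) p) ≠ 0)).card := by
  set g : Hsub F q → F := restr f (fun k => sig hq hF (P k) (a k)) with hg
  have hgm : g ∈ HermCode F q r := hf _ (fun k => sig_phi hq hF _ _)
  have hg0 : g ≠ 0 := by
    intro h
    have hz : (0 : F) ^ (q + 1) = 0 + 0 ^ q := by
      rw [zero_pow (by omega), zero_pow (by omega), add_zero]
    have h1 : g ⟨(0, 0), hz⟩ = 0 := congrFun h _
    apply hP
    rw [← h1, hg]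
    simp only [restr]
    congr 1
    funext k
    apply Subtype.ext
    simp [sig, sigmaMap]
  have hz := zeros_lt q r hq2 g hgm hg0
  rw [Nat.card_eq_fintype_card, Fintype.card_subtype] at hz
  have hH := card_H (F := F) ℓ q hl hq hF
  rw [Nat.card_eq_fintype_card, ← Finset.card_univ] at hH
  have hcov : (Finset.univ : Finset (Hsub F q)) ⊆
      ((Finset.univ.filter (fun p => g p = 0)) ∪ bad) ∪
      (Finset.univ.filter (fun p => p ∉ bad ∧ f (fun k => sig hq hF (P k) (a k) p) ≠ 0)) := by
    intro p _
    simp only [Finset.mem_union, Finset.mem_filter, Finset.mem_univ, true_and]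
    by_cases h1 : p ∈ bad
    · exact Or.inl (Or.inr h1)
    · by_cases h2 : g p = 0
      · exact Or.inl (Or.inl h2)
      · exact Or.inr ⟨h1, h2⟩
  have h1 := (Finset.card_le_card hcov).trans (Finset.card_union_le _ _)
  have h2 := Finset.card_union_le (Finset.univ.filter (fun p => g p = 0)) bad
  omega

open Classical in
lemma card_bad1 {q : ℕ} (hF : Fintype.card F = q ^ 2) :
    ((Finset.univ : Finset (Hsub F q)).filter (fun p => p.1.1 = 0)).card ≤ q ^ 2 := by
  rw [← hF, ← Finset.card_univ]
  apply Finset.card_le_card_of_injOn (fun p => p.1.2) (fun _ _ => Finset.mem_coe.2 (Finset.mem_univ _))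
  intro p hp p' hp' h
  rw [Finset.mem_coe, Finset.mem_filter] at hp hp'
  exact Subtype.ext (Prod.ext (hp.2.trans hp'.2.symm) h)

open Classical in
lemma card_bad2 {q : ℕ} (hF : Fintype.card F = q ^ 2) (p : Hsub F q) (hp : p.1.1 ≠ 0) :
    ((Finset.univ : Finset (Hsub F q)).filter (fun p' => p'.1.1 = 0 ∨
      p'.1.2 / p'.1.1 ^ (q + 1) * p.1.1 ^ (q + 1) + p.1.1 ^ (q + 1) + p.1.2 = 0)).card
      ≤ 2 * q ^ 2 := by
  have h1 := card_bad1 (F := F) hF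
  have h2 : ((Finset.univ : Finset (Hsub F q)).filter (fun p' => p'.1.1 ≠ 0 ∧
      p'.1.2 / p'.1.1 ^ (q + 1) * p.1.1 ^ (q + 1) + p.1.1 ^ (q + 1) + p.1.2 = 0)).card ≤ q ^ 2 := by
    rw [← hF, ← Finset.card_univ]
    apply Finset.card_le_card_of_injOn (fun p => p.1.1)
      (fun _ _ => Finset.mem_coe.2 (Finset.mem_univ _))
    intro u hu v hv h
    rw [Finset.mem_coe, Finset.mem_filter] at hu hv
    have h : u.1.1 = v.1.1 := h
    refine Subtype.ext (Prod.ext h ?_)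
    have e := hu.2.2.trans hv.2.2.symm
    have e := add_right_cancel (add_right_cancel e)
    have e := mul_right_cancel₀ (pow_ne_zero _ hp) e
    rw [h] at e
    exact (div_left_inj' (pow_ne_zero _ hv.2.1)).1 e
  refine (Finset.card_le_card (t := (Finset.univ.filter (fun p : Hsub F q => p.1.1 = 0)) ∪
    ((Finset.univ : Finset (Hsub F q)).filter (fun p' => p'.1.1 ≠ 0 ∧
      p'.1.2 / p'.1.1 ^ (q + 1) * p.1.1 ^ (q + 1) + p.1.1 ^ (q + 1) + p.1.2 = 0))) ?_).trans
    ((Finset.card_union_le _ _).trans (by omega))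
  intro u hu
  simp only [Finset.mem_union, Finset.mem_filter, Finset.mem_univ, true_and] at hu ⊢
  tauto

open Classical in
/-- weight lower bound via two steps -/
lemma weight_bound {ℓ q m r M : ℕ} (hl : 0 < ℓ) (hq : q = 2 ^ ℓ) (hq2 : 2 ≤ q)
    (hF : Fintype.card F = q ^ 2) (hM : r + M + 2 * q ^ 2 ≤ q ^ 3)
    (f : (Fin m → Hsub F q) → F) (hf : f ∈ liftW F q m r) (hf0 : f ≠ 0) :
    ((q ^ 2 - 1) ^ m * M) ^ 2 ≤ (q ^ 3) ^ 2 * ((q + 1) ^ m *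
      ((Finset.univ : Finset (Fin m → Hsub F q)).filter (fun p => f p ≠ 0)).card) := by
  obtain ⟨P, hP⟩ := Function.ne_iff.1 hf0
  have hP : f P ≠ 0 := hP
  set A := (Finset.univ : Finset (Fin m → Hsub F q)).filter (fun p => f p ≠ 0) with hA
  let b1 : Finset (Hsub F q) := Finset.univ.filter (fun p => p.1.1 = 0)
  let b2 : Hsub F q → Finset (Hsub F q) := fun p => Finset.univ.filter (fun p' => p'.1.1 = 0 ∨
      p'.1.2 / p'.1.1 ^ (q + 1) * p.1.1 ^ (q + 1) + p.1.1 ^ (q + 1) + p.1.2 = 0)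
  let Q : (Fin m → Fˣ) → Hsub F q → (Fin m → Hsub F q) := fun a p k => sig hq hF (P k) (a k) p
  let R : (Fin m → Fˣ) → (Fin m → Fˣ) → Hsub F q → Hsub F q → (Fin m → Hsub F q) :=
    fun a b p p' k => sig hq hF (Q a p k) (b k) p'
  let G : (Fin m → Fˣ) → (Fin m → Fˣ) → Hsub F q → Hsub F q → ℕ := fun a b p p' =>
    if (p ∉ b1 ∧ f (Q a p) ≠ 0) ∧ (p' ∉ b2 p ∧ f (R a b p p') ≠ 0) then 1 else 0
  have hcu : (Finset.univ : Finset (Fin m → Fˣ)).card = (q ^ 2 - 1) ^ m := by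
    rw [Finset.card_univ, Fintype.card_fun, Fintype.card_units, hF, Fintype.card_fin]
  have hH := card_H (F := F) ℓ q hl hq hF
  rw [Nat.card_eq_fintype_card, ← Finset.card_univ] at hH
  have lower : ((q ^ 2 - 1) ^ m * M) ^ 2 ≤ ∑ a, ∑ p, ∑ b, ∑ p', G a b p p' := by
    have hin : ∀ a p, p ∉ b1 ∧ f (Q a p) ≠ 0 → (q ^ 2 - 1) ^ m * M ≤ ∑ b, ∑ p', G a b p p' := by
      intro a p hp
      rw [← hcu, ← smul_eq_mul]
      apply Finset.card_nsmul_le_sum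
      intro b _
      have h1 := many_good hl hq hq2 hF hM f hf (Q a p) hp.2 b (b2 p)
        (card_bad2 hF p (by simpa [b1] using hp.1))
      refine h1.trans (le_of_eq ?_)
      rw [Finset.card_filter]
      apply Finset.sum_congr rfl
      intro p' _
      simp only [G, R]
      exact if_congr (by rw [and_iff_right hp]) rfl rfl
    have hout : ∀ a, M * ((q ^ 2 - 1) ^ m * M) ≤ ∑ p, ∑ b, ∑ p', G a b p p' := by
      intro a
      have h1 := many_good hl hq hq2 hF hM f hf P hP a b1
        ((card_bad1 hF).trans (by omega))
      calc M * ((q ^ 2 - 1) ^ m * M) ≤ _ := Nat.mul_le_mul_right _ h1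
        _ ≤ ∑ p ∈ Finset.univ.filter (fun p => p ∉ b1 ∧ f (Q a p) ≠ 0), ∑ b, ∑ p', G a b p p' := by
            rw [← smul_eq_mul]
            apply Finset.card_nsmul_le_sum
            intro p hp
            exact hin a p (Finset.mem_filter.1 hp).2
        _ ≤ _ := Finset.sum_le_sum_of_subset (Finset.filter_subset _ _)
    calc ((q ^ 2 - 1) ^ m * M) ^ 2 = (Finset.univ : Finset (Fin m → Fˣ)).card •
          (M * ((q ^ 2 - 1) ^ m * M)) := by rw [hcu, smul_eq_mul]; ring
      _ ≤ _ := Finset.card_nsmul_le_sum _ _ _ fun a _ => hout a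
  refine lower.trans ?_
  have swap : ∑ a, ∑ p, ∑ b, ∑ p', G a b p p' = ∑ p, ∑ p', ∑ ab : (Fin m → Fˣ) × (Fin m → Fˣ),
      G ab.1 ab.2 p p' := by
    rw [Finset.sum_comm]
    apply Finset.sum_congr rfl
    intro p _
    have e : ∀ p', ∑ ab : (Fin m → Fˣ) × (Fin m → Fˣ), G ab.1 ab.2 p p' =
        ∑ a, ∑ b, G a b p p' := fun p' => Fintype.sum_prod_type _
    rw [Finset.sum_congr rfl fun p' _ => e p', Finset.sum_comm (s := Finset.univ (α := Hsub F q))]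
    apply Finset.sum_congr rfl
    intro a _
    exact Finset.sum_comm
  rw [swap]
  have hub : ∀ p p', ∑ ab : (Fin m → Fˣ) × (Fin m → Fˣ), G ab.1 ab.2 p p' ≤
      (q + 1) ^ m * A.card := by
    intro p p'
    by_cases hp : p' ∉ b2 p
    · have h1 : p'.1.1 ≠ 0 ∧ p'.1.2 / p'.1.1 ^ (q + 1) * p.1.1 ^ (q + 1) + p.1.1 ^ (q + 1) + p.1.2 ≠ 0 := by
        simpa [b2] using hp
      refine le_trans ?_ (fibreM hq hq2 hF P p p' h1.1 h1.2 A)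
      rw [Finset.card_filter]
      apply Finset.sum_le_sum
      intro ab _
      simp only [G]
      split_ifs with h2 h3
      · exact le_rfl
      · exact absurd (show R ab.1 ab.2 p p' ∈ A from
          Finset.mem_filter.2 ⟨Finset.mem_univ _, h2.2.2⟩) h3
      · exact Nat.zero_le _
      · exact le_rfl
    · have : ∀ ab : (Fin m → Fˣ) × (Fin m → Fˣ), G ab.1 ab.2 p p' = 0 := by
        intro ab
        simp only [G]
        rw [if_neg]
        exact fun h => hp h.2.1
      simp [this]
  calc _ ≤ ∑ _p : Hsub F q, ∑ _p' : Hsub F q, (q + 1) ^ m * A.card :=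
        Finset.sum_le_sum fun p _ => Finset.sum_le_sum fun p' _ => hub p p'
    _ = _ := by
      rw [Finset.sum_const, Finset.sum_const, hH, smul_eq_mul, smul_eq_mul]; ring

end distance2
lemma rpow_bound (q m k : ℕ) (e : ℝ) (hq : 1 ≤ q) (h : (k : ℝ) ≤ 3 * m * e) :
    (q : ℝ) ^ k ≤ ((q ^ (3 * m) : ℕ) : ℝ) ^ e := by
  have hq' : (1 : ℝ) ≤ q := by exact_mod_cast hq
  rw [Nat.cast_pow, ← Real.rpow_natCast (q : ℝ) (3 * m), ← Real.rpow_mul (by linarith),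
    ← Real.rpow_natCast]
  apply Real.rpow_le_rpow_of_exponent_le hq'
  push_cast
  exact h

lemma dist_arith (q m c M A : ℕ) (hq : 2 ≤ q) (hM : 2 ^ (c + 1) * M = q ^ 3)
    (h : ((q ^ 2 - 1) ^ m * M) ^ 2 ≤ (q ^ 3) ^ 2 * ((q + 1) ^ m * A)) :
    q ^ (3 * m) ≤ 4 ^ m * 4 ^ (c + 1) * A := by
  have h1 : (q + 1) * q ^ 3 ≤ 4 * (q ^ 2 - 1) ^ 2 := by
    obtain ⟨t, rfl⟩ := Nat.exists_eq_add_of_le hq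
    have : (2 + t) ^ 2 - 1 = t ^ 2 + 4 * t + 3 := by
      have : (2 + t) ^ 2 = t ^ 2 + 4 * t + 3 + 1 := by ring
      omega
    rw [this]
    nlinarith [sq_nonneg t, Nat.zero_le (t ^ 3), Nat.zero_le (t ^ 4)]
  have h2 : ((q ^ 2 - 1) ^ m) ^ 2 ≤ 4 ^ (c + 1) * ((q + 1) ^ m * A) := by
    have hpos : 0 < (q ^ 3) ^ 2 := by positivity
    apply Nat.le_of_mul_le_mul_left _ hpos
    calc (q ^ 3) ^ 2 * ((q ^ 2 - 1) ^ m) ^ 2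
        = 4 ^ (c + 1) * ((q ^ 2 - 1) ^ m * M) ^ 2 := by
          rw [← hM, show (4 : ℕ) ^ (c + 1) = (2 ^ (c + 1)) ^ 2 by
            rw [← pow_mul, mul_comm (c + 1) 2, pow_mul]; norm_num]
          ring
      _ ≤ 4 ^ (c + 1) * ((q ^ 3) ^ 2 * ((q + 1) ^ m * A)) := Nat.mul_le_mul_left _ h
      _ = _ := by ring
  have hpos : 0 < (q + 1) ^ m := by positivity
  apply Nat.le_of_mul_le_mul_left _ hpos
  calc (q + 1) ^ m * q ^ (3 * m) = ((q + 1) * q ^ 3) ^ m := by rw [mul_pow, ← pow_mul]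
    _ ≤ (4 * (q ^ 2 - 1) ^ 2) ^ m := Nat.pow_le_pow_left h1 m
    _ = 4 ^ m * ((q ^ 2 - 1) ^ m) ^ 2 := by rw [mul_pow, ← pow_mul, ← pow_mul, mul_comm 2 m]
    _ ≤ 4 ^ m * (4 ^ (c + 1) * ((q + 1) ^ m * A)) := Nat.mul_le_mul_left _ h2
    _ = _ := by ring

end LH

/-- High rate locally correctable codes from lifted Hermitian codes (main theorem,
code parameters). For every `ε, α ∈ (0,1)` there is a `τ > 0` such that for every `N₀`
there are `N ≥ N₀`, a power of two `q = 2^ℓ`, and `m ≥ 1` with: `N = q^(3m)`; the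
alphabet `F = F_(q²)` satisfies `q² ≤ N^(ε/3)`; the query complexity satisfies
`q⁶ ≤ N^ε`; and for a suitable `r = (1 − 2^(−c))·q³` the lifted Hermitian code
`L = lift_{Φ_H}^m(Herm_q[r])` is an `F`-linear code of block length `N` with
`dim_F L ≥ (1−α)·N` and relative distance at least `τ`. -/
theorem lifted_hermitian_main (ε α : ℝ) (hε0 : 0 < ε) (hε1 : ε < 1)
    (hα0 : 0 < α) (hα1 : α < 1) :
    ∃ τ : ℝ, 0 < τ ∧ ∀ N₀ : ℕ, ∃ N q ℓ m : ℕ,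
      N₀ ≤ N ∧ 0 < ℓ ∧ q = 2 ^ ℓ ∧ 1 ≤ m ∧
      N = q ^ (3 * m) ∧
      Nat.card (GaloisField 2 (2 * ℓ)) = q ^ 2 ∧
      (q : ℝ) ^ 2 ≤ (N : ℝ) ^ (ε / 3) ∧
      (q : ℝ) ^ 6 ≤ (N : ℝ) ^ ε ∧
      ∃ c r : ℕ, 0 < c ∧
        (r : ℝ) = (1 - ((2 : ℝ) ^ c)⁻¹) * (q : ℝ) ^ 3 ∧
        ∃ W : Submodule (GaloisField 2 (2 * ℓ))
            ((Fin m → Hsub (GaloisField 2 (2 * ℓ)) q) → GaloisField 2 (2 * ℓ)),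
          (W : Set ((Fin m → Hsub (GaloisField 2 (2 * ℓ)) q) → GaloisField 2 (2 * ℓ)))
              = liftCode (PhiHsub (GaloisField 2 (2 * ℓ)) q) m
                  (HermCode (GaloisField 2 (2 * ℓ)) q r :
                    Set (Hsub (GaloisField 2 (2 * ℓ)) q → GaloisField 2 (2 * ℓ))) ∧
          (1 - α) * (N : ℝ) ≤ (Module.finrank (GaloisField 2 (2 * ℓ)) W : ℝ) ∧
          ∀ f ∈ liftCode (PhiHsub (GaloisField 2 (2 * ℓ)) q) m
              (HermCode (GaloisField 2 (2 * ℓ)) q r :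
                Set (Hsub (GaloisField 2 (2 * ℓ)) q → GaloisField 2 (2 * ℓ))),
            ∀ g ∈ liftCode (PhiHsub (GaloisField 2 (2 * ℓ)) q) m
              (HermCode (GaloisField 2 (2 * ℓ)) q r :
                Set (Hsub (GaloisField 2 (2 * ℓ)) q → GaloisField 2 (2 * ℓ))),
              f ≠ g → τ ≤ relDist f g := by
  classical
  set m : ℕ := ⌈2 / ε⌉₊ with hm
  have hmε : 2 ≤ (m : ℝ) * ε := by
    have : 2 / ε ≤ m := Nat.le_ceil _
    rwa [div_le_iff₀ hε0] at this
  have hm1 : 1 ≤ m := by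
    rcases Nat.eq_zero_or_pos m with h | h
    · rw [h] at hmε; norm_num at hmε
    · exact h
  set b : ℕ := m + 3 with hb
  have hb6 : 6 * m ≤ 2 ^ b := by
    have : m < 2 ^ m := Nat.lt_two_pow_self
    rw [hb, pow_add]; omega
  set Bm : ℕ := (2 ^ b) ^ m with hBm
  have hBm1 : 1 ≤ Bm := Nat.one_le_pow _ _ (by positivity)
  have hBm0 : (0 : ℝ) < (Bm : ℝ) := by exact_mod_cast hBm1
  obtain ⟨S, hS⟩ := exists_pow_lt_of_lt_one hα0 (y := ((Bm : ℝ) - 1) / Bm) (by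
    rw [div_lt_one hBm0]; linarith)
  set c : ℕ := S * b + 1 with hc
  refine ⟨1 / (4 ^ m * 4 ^ (c + 1)), by positivity, ?_⟩
  intro N₀
  set ℓ : ℕ := c + 2 + N₀ with hℓ
  set q : ℕ := 2 ^ ℓ with hq
  have hl0 : 0 < ℓ := by omega
  have hq2 : 2 ≤ q := by
    rw [hq]; calc 2 = 2 ^ 1 := by norm_num
      _ ≤ 2 ^ ℓ := Nat.pow_le_pow_right (by norm_num) hl0
  have hcard : Nat.card (GaloisField 2 (2 * ℓ)) = q ^ 2 := by
    rw [GaloisField.card 2 _ (by omega), hq, ← pow_mul, mul_comm]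
  have hq3 : q ^ 3 = 2 ^ (3 * ℓ) := by rw [hq, ← pow_mul, mul_comm]
  refine ⟨q ^ (3 * m), q, ℓ, m, ?_, hl0, rfl, hm1, rfl, hcard, ?_, ?_, ?_⟩
  · calc N₀ ≤ ℓ := by omega
      _ ≤ 2 ^ ℓ := Nat.lt_two_pow_self.le
      _ = q ^ 1 := by rw [pow_one]
      _ ≤ q ^ (3 * m) := Nat.pow_le_pow_right (by omega) (by omega)
  · apply LH.rpow_bound _ _ _ _ (by omega)
    push_cast; linarith
  · apply LH.rpow_bound _ _ _ _ (by omega)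
    push_cast; linarith
  set r : ℕ := 2 ^ (3 * ℓ) - 2 ^ (3 * ℓ - c) with hr
  have hle : 2 ^ (3 * ℓ - c) ≤ 2 ^ (3 * ℓ) := Nat.pow_le_pow_right (by norm_num) (by omega)
  let _ : Fintype (GaloisField 2 (2 * ℓ)) := Fintype.ofFinite _
  have hF : Fintype.card (GaloisField 2 (2 * ℓ)) = q ^ 2 := by
    rw [← Nat.card_eq_fintype_card, hcard]
  refine ⟨c, r, by omega, ?_, LH.liftW (GaloisField 2 (2 * ℓ)) q m r, rfl, ?_, ?_⟩
  · rw [hr, Nat.cast_sub hle]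
    have e : (2 : ℝ) ^ (3 * ℓ) = 2 ^ (3 * ℓ - c) * 2 ^ c := by
      rw [← pow_add]; congr 1; omega
    have e3 : (q : ℝ) ^ 3 = 2 ^ (3 * ℓ) := by exact_mod_cast hq3
    rw [e3]
    push_cast
    rw [e]
    field_simp
  · have hdim := LH.liftW_dim (F := GaloisField 2 (2 * ℓ)) (q := q) (m := m) (r := r)
      (ρ := 2 * ℓ - S * b) (b := b) (S := S) hl0 hq hm1 hF (by omega) (by omega) hb6 (by
        have e1 : q * (q * q - 2 ^ (2 * ℓ - S * b)) + q * q =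
            2 ^ (3 * ℓ) - 2 ^ (3 * ℓ - c + 1) + 2 ^ (2 * ℓ) := by
          rw [Nat.mul_sub, hq, ← pow_add, ← pow_add, ← pow_add]
          congr 2
          · congr 1; omega
          · congr 1; omega
          · omega
        have e2 : 2 ^ (2 * ℓ) ≤ 2 ^ (3 * ℓ - c) := Nat.pow_le_pow_right (by norm_num) (by omega)
        have e3 : 2 ^ (3 * ℓ - c + 1) ≤ 2 ^ (3 * ℓ) := Nat.pow_le_pow_right (by norm_num) (by omega)
        have e4 : 2 ^ (3 * ℓ - c + 1) = 2 * 2 ^ (3 * ℓ - c) := by ring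
        rw [e1, hr]
        omega)
    set W := Module.finrank (GaloisField 2 (2 * ℓ)) (LH.liftW (GaloisField 2 (2 * ℓ)) q m r)
    rw [← hBm] at hdim
    set R : ℕ := 2 ^ (2 * ℓ - S * b) with hR
    have hRB : R ^ m * Bm ^ S * q ^ m = q ^ (3 * m) := by
      have : R * (2 ^ b) ^ S = q ^ 2 := by
        rw [hR, hq, ← pow_mul, ← pow_mul, ← pow_add]
        congr 1
        rw [mul_comm b S]; omega
      calc R ^ m * Bm ^ S * q ^ m = (R * (2 ^ b) ^ S) ^ m * q ^ m := by rw [hBm]; ring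
        _ = _ := by rw [this]; ring
    have hdimR : ((q ^ (3 * m) : ℕ) : ℝ) ≤ (W : ℝ) + ((Bm : ℝ) - 1) ^ S * (R : ℝ) ^ m * (q : ℝ) ^ m := by
      have : ((q ^ (3 * m) : ℕ) : ℝ) ≤ ((W + ((Bm - 1) ^ S * R ^ m) * q ^ m : ℕ) : ℝ) := by
        exact_mod_cast hdim
      rw [Nat.cast_add, Nat.cast_mul, Nat.cast_mul, Nat.cast_pow, Nat.cast_pow, Nat.cast_pow,
        Nat.cast_sub hBm1, Nat.cast_one] at this
      exact_mod_cast this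
    have hfrac : ((Bm : ℝ) - 1) ^ S * (R : ℝ) ^ m * (q : ℝ) ^ m ≤ α * ((q ^ (3 * m) : ℕ) : ℝ) := by
      rw [← hRB, div_pow, div_lt_iff₀ (by positivity)] at *
      push_cast
      calc ((Bm : ℝ) - 1) ^ S * (R : ℝ) ^ m * (q : ℝ) ^ m
          ≤ (α * (Bm : ℝ) ^ S) * (R : ℝ) ^ m * (q : ℝ) ^ m := by gcongr
        _ = _ := by ring
    linarith
  · intro f hf g hg hfg
    have hfgm : f - g ∈ LH.liftW (GaloisField 2 (2 * ℓ)) q m r := Submodule.sub_mem _ hf hg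
    have hM : 2 ^ (c + 1) * 2 ^ (3 * ℓ - c - 1) = q ^ 3 := by
      rw [hq3, ← pow_add]; congr 1; omega
    have hw := LH.weight_bound (F := GaloisField 2 (2 * ℓ)) (M := 2 ^ (3 * ℓ - c - 1)) hl0 hq hq2 hF
      (by
        have e1 : 2 * q ^ 2 = 2 ^ (2 * ℓ + 1) := by rw [hq]; ring
        have e2 : 2 ^ (2 * ℓ + 1) ≤ 2 ^ (3 * ℓ - c - 1) :=
          Nat.pow_le_pow_right (by norm_num) (by omega)
        have e3 : 2 ^ (3 * ℓ - c) = 2 * 2 ^ (3 * ℓ - c - 1) := by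
          rw [← pow_succ']; congr 1; omega
        rw [e1, hq3, hr]
        omega) (f - g) hfgm (sub_ne_zero.2 hfg)
    have hfin := LH.dist_arith q m c _ _ hq2 hM hw
    have hset : Set.ncard {x | f x ≠ g x} = ((Finset.univ :
        Finset (Fin m → Hsub (GaloisField 2 (2 * ℓ)) q)).filter (fun p => (f - g) p ≠ 0)).card := by
      rw [← Set.ncard_coe_finset]
      congr 1
      ext x
      simp [sub_eq_zero]
    have hN : Nat.card (Fin m → Hsub (GaloisField 2 (2 * ℓ)) q) = q ^ (3 * m) := by
      rw [Nat.card_fun, LH.card_H ℓ q hl0 hq hF, Nat.card_eq_fintype_card, Fintype.card_fin,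
        ← pow_mul]
    rw [relDist, hset, hN, div_le_div_iff₀ (by positivity) (by positivity), one_mul]
    have : ((q ^ (3 * m) : ℕ) : ℝ) ≤ ((4 ^ m * 4 ^ (c + 1) * ((Finset.univ :
        Finset (Fin m → Hsub (GaloisField 2 (2 * ℓ)) q)).filter
          (fun p => (f - g) p ≠ 0)).card : ℕ) : ℝ) := by exact_mod_cast hfin
    refine this.trans (le_of_eq ?_)
    push_cast
    ring
end
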